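/- Let n ≥ 3 and let (p,q) be a Schrödinger-admissible pair in dimension n with p > 2. There is a constant C = C(n,p) such that for every Schwartz function g on ℝ × ℝ^n the following holds. Set h(s,x) = ⟨x⟩^{-1} (⟨∂_s⟩^{1/4} g)(s,x). Then the retarded integral F(t,x) = ∫_{−∞}^{t} [ e^{i(t−s)Δ} h(s,·) ](x) ds satisfies ‖F‖_{L^p_t L^q_x} ≤ C ‖g‖_{L²(ℝ×ℝ^n)}. -/

import Mathlib

open MeasureTheory ENNReal SchwartzMap

/-- The free Schrödinger evolution `(e^{itΔ}f)(x)`, given for `t ≠ 0` by the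
explicit convolution formula with the principal branch of the complex power. -/
noncomputable def schrod (n : ℕ) (t : ℝ) (f : EuclideanSpace ℝ (Fin n) → ℂ)
    (x : EuclideanSpace ℝ (Fin n)) : ℂ :=
  if t = 0 then f x
  else (4 * Real.pi * Complex.I * (t : ℂ)) ^ (-(n : ℂ) / 2) *
    ∫ y : EuclideanSpace ℝ (Fin n),
      Complex.exp (Complex.I * (‖x - y‖ : ℂ) ^ 2 / (4 * (t : ℂ))) * f y

/-- The fractional derivative `⟨∂_s⟩^a` in the time variable, i.e. the Fourier
multiplier with symbol `(1+λ²)^{a/2}`. -/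
noncomputable def fracD {n : ℕ} (a : ℝ) (g : ℝ × EuclideanSpace ℝ (Fin n) → ℂ)
    (s : ℝ) (x : EuclideanSpace ℝ (Fin n)) : ℂ :=
  (2 * Real.pi : ℂ)⁻¹ *
    ∫ lam : ℝ, Complex.exp (Complex.I * (s : ℂ) * (lam : ℂ)) *
      (((1 + lam ^ 2 : ℝ) ^ (a / 2) : ℝ) : ℂ) *
      ∫ σ : ℝ, Complex.exp (-(Complex.I * (σ : ℂ) * (lam : ℂ))) * g (σ, x)

/-- The mixed norm `‖F‖_{L^p_t L^q_x}`, with exponents in `ℝ≥0∞`. -/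
noncomputable def mixedNorm {n : ℕ} (p q : ℝ≥0∞)
    (F : ℝ → EuclideanSpace ℝ (Fin n) → ℂ) : ℝ≥0∞ :=
  if p = ⊤ then essSup (fun t => eLpNorm (F t) q volume) volume
  else (∫⁻ t : ℝ, (eLpNorm (F t) q volume) ^ p.toReal) ^ (1 / p.toReal)

set_option linter.unusedSectionVars false
set_option autoImplicit false

namespace Schrodinger

open FourierTransform Topology Filter ComplexConjugate

theorem hasTemperateGrowth_cexp_I : (fun y : ℝ => Complex.exp ((y : ℂ) * Complex.I)).HasTemperateGrowth := by
  have key : ∀ k : ℕ, ∀ x : ℝ, iteratedDeriv k (fun y : ℝ => Complex.exp ((y : ℂ) * Complex.I)) x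
      = Complex.I ^ k * Complex.exp ((x : ℂ) * Complex.I) := by
    intro k
    induction k with
    | zero => intro x; simp
    | succ k ih =>
      intro x
      rw [iteratedDeriv_succ, funext ih]
      have h1 : HasDerivAt (fun y : ℝ => (y : ℂ) * Complex.I) (1 * Complex.I) x :=
        (Complex.ofRealCLM.hasDerivAt (x := x)).mul_const _
      have := (h1.cexp.const_mul (Complex.I ^ k)).deriv
      rw [this]; ring
  refine ⟨?_, fun k => ⟨0, 1, fun x => ?_⟩⟩
  · exact (Complex.ofRealCLM.contDiff.mul contDiff_const).cexp
  · rw [norm_iteratedFDeriv_eq_norm_iteratedDeriv, key]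
    simp [Complex.norm_exp_ofReal_mul_I]

section Propagator

variable {V : Type*} [NormedAddCommGroup V] [InnerProductSpace ℝ V] [FiniteDimensional ℝ V]
  [MeasurableSpace V] [BorelSpace V]

/-- The space `L²(V)`. -/
noncomputable abbrev L2 (V : Type*) [NormedAddCommGroup V] [InnerProductSpace ℝ V] [FiniteDimensional ℝ V]
    [MeasurableSpace V] [BorelSpace V] := Lp ℂ 2 (volume : Measure V)

/-- The Fourier symbol of the free Schrödinger group. -/
noncomputable def sym (t : ℝ) (ξ : V) : ℂ :=
  Complex.exp (((-(4 * Real.pi ^ 2 * t * ‖ξ‖ ^ 2) : ℝ) : ℂ) * Complex.I)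

theorem sym_hasTemperateGrowth (t : ℝ) : (sym t : V → ℂ).HasTemperateGrowth := by
  have h : (fun ξ : V => -(4 * Real.pi ^ 2 * t * ‖ξ‖ ^ 2)).HasTemperateGrowth :=
    (((Function.HasTemperateGrowth.const (4 * Real.pi ^ 2 * t)).mul
      (Function.hasTemperateGrowth_norm_sq (H := V)))).neg
  exact hasTemperateGrowth_cexp_I.comp h

theorem norm_sym (t : ℝ) (ξ : V) : ‖sym t ξ‖ = 1 := Complex.norm_exp_ofReal_mul_I _

theorem sym_zero (ξ : V) : sym 0 ξ = 1 := by simp [sym]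

theorem sym_add (s t : ℝ) (ξ : V) : sym (s + t) ξ = sym s ξ * sym t ξ := by
  rw [sym, sym, sym, ← Complex.exp_add]; congr 1; push_cast; ring

theorem continuous_sym : Continuous (fun z : ℝ × V => sym z.1 z.2) := by
  unfold sym; fun_prop

theorem continuous_sym_left (ξ : V) : Continuous (fun t : ℝ => sym t ξ) := by
  unfold sym; fun_prop

theorem continuous_sym_right (t : ℝ) : Continuous (fun ξ : V => sym t ξ) := by
  unfold sym; fun_prop

/-- The free Schrödinger group on Schwartz functions. -/
noncomputable def uS (t : ℝ) : 𝓢(V, ℂ) →L[ℂ] 𝓢(V, ℂ) := fourierMultiplierCLM ℂ (sym t)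

theorem fourier_uS_eq (t : ℝ) (φ : 𝓢(V, ℂ)) : 𝓕 (uS t φ) = smulLeftCLM ℂ (sym t) (𝓕 φ) := by
  rw [uS, fourierMultiplierCLM_apply]; simp

theorem fourier_uS (t : ℝ) (φ : 𝓢(V, ℂ)) (ξ : V) : 𝓕 (uS t φ) ξ = sym t ξ * 𝓕 φ ξ := by
  rw [fourier_uS_eq, smulLeftCLM_apply_apply (sym_hasTemperateGrowth t), smul_eq_mul]

theorem uS_add (s t : ℝ) (φ : 𝓢(V, ℂ)) : uS s (uS t φ) = uS (s + t) φ := by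
  rw [uS, uS, fourierMultiplierCLM_fourierMultiplierCLM_apply (sym_hasTemperateGrowth s)
    (sym_hasTemperateGrowth t), uS]
  congr 2
  ext ξ; simp [sym_add]

theorem uS_zero (φ : 𝓢(V, ℂ)) : uS 0 φ = φ := by
  have : (sym 0 : V → ℂ) = fun _ => 1 := by ext ξ; exact sym_zero ξ
  rw [uS, this, fourierMultiplierCLM_const]; simp

theorem uS_apply (t : ℝ) (φ : 𝓢(V, ℂ)) (x : V) :
    uS t φ x = ∫ ξ, Complex.exp (2 * Real.pi * Complex.I * (inner ℝ ξ x : ℝ)) * (sym t ξ * 𝓕 φ ξ) := by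
  have : uS t φ = 𝓕⁻ (𝓕 (uS t φ)) := by simp
  rw [this, fourierInv_coe, Real.fourierInv_eq']
  refine integral_congr_ae (Eventually.of_forall fun ξ => ?_)
  simp only [fourier_uS, smul_eq_mul]
  congr 2
  push_cast; ring


theorem norm_toLp_uS (t : ℝ) (φ : 𝓢(V, ℂ)) : ‖(uS t φ).toLp 2 volume‖ = ‖φ.toLp 2 volume‖ := by
  rw [← norm_fourier_toL2_eq (uS t φ), ← norm_fourier_toL2_eq φ, SchwartzMap.norm_toLp, SchwartzMap.norm_toLp]
  congr 1
  refine eLpNorm_congr_norm_ae (Eventually.of_forall fun ξ => ?_)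
  simp [fourier_uS, norm_sym]

theorem norm_uS_apply_le (t : ℝ) (φ : 𝓢(V, ℂ)) (x : V) : ‖uS t φ x‖ ≤ ∫ ξ, ‖𝓕 φ ξ‖ := by
  rw [uS_apply]
  refine (norm_integral_le_integral_norm _).trans (le_of_eq ?_)
  congr 1; ext ξ
  rw [norm_mul, norm_mul, norm_sym, one_mul]
  have : (2 * Real.pi * Complex.I * (inner ℝ ξ x : ℝ) : ℂ) = ((2 * Real.pi * inner ℝ ξ x : ℝ) : ℂ) * Complex.I := by
    push_cast; ring
  rw [this, Complex.norm_exp_ofReal_mul_I, one_mul]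

theorem continuous_uS_apply (φ : 𝓢(V, ℂ)) : Continuous (fun z : ℝ × V => uS z.1 φ z.2) := by
  simp_rw [uS_apply]
  refine continuous_of_dominated (bound := fun ξ => ‖𝓕 φ ξ‖) (fun z => ?_) (fun z => ?_)
    ((𝓕 φ).integrable.norm) ?_
  · refine Continuous.aestronglyMeasurable ?_
    have := continuous_sym_right (V := V) z.1
    have := (𝓕 φ).continuous
    fun_prop
  · refine Eventually.of_forall fun ξ => ?_
    rw [norm_mul, norm_mul, norm_sym, one_mul]
    have : (2 * Real.pi * Complex.I * (inner ℝ ξ z.2 : ℝ) : ℂ) = ((2 * Real.pi * inner ℝ ξ z.2 : ℝ) : ℂ) * Complex.I := by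
      push_cast; ring
    rw [this, Complex.norm_exp_ofReal_mul_I, one_mul]
  · refine Eventually.of_forall fun ξ => ?_
    have h1 : Continuous (fun z : ℝ × V => sym z.1 ξ) := (continuous_sym_left ξ).comp continuous_fst
    fun_prop

/-- `uS t` as a linear equivalence. -/
noncomputable def uSEquiv (t : ℝ) : 𝓢(V, ℂ) ≃ₗ[ℂ] 𝓢(V, ℂ) :=
  LinearEquiv.ofLinearMap (uS t).toLinearMap (uS (-t)).toLinearMap
    (LinearMap.ext fun φ => (uS_add t (-t) φ).trans (by rw [add_neg_cancel, uS_zero]; rfl))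
    (LinearMap.ext fun φ => (uS_add (-t) t φ).trans (by rw [neg_add_cancel, uS_zero]; rfl))

/-- Schwartz functions inside `L²`. -/
noncomputable def toL2 : 𝓢(V, ℂ) →ₗ[ℂ] L2 V := (toLpCLM ℂ ℂ 2 (volume : Measure V)).toLinearMap

theorem denseRange_toL2 : DenseRange (toL2 : 𝓢(V, ℂ) → L2 V) :=
  denseRange_toLpCLM (E := V) (F := ℂ) (p := 2) (μ := volume) ENNReal.ofNat_ne_top

/-- The free Schrödinger group on `L²`. -/
noncomputable def U (t : ℝ) : L2 V ≃ₗᵢ[ℂ] L2 V :=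
  (uSEquiv t).extendOfIsometry toL2 toL2 denseRange_toL2 denseRange_toL2 (norm_toLp_uS t)

theorem U_toLp (t : ℝ) (φ : 𝓢(V, ℂ)) :
    U t (φ.toLp 2 (volume : Measure V)) = (uS t φ).toLp 2 (volume : Measure V) :=
  LinearEquiv.extendOfIsometry_eq (uSEquiv t) toL2 toL2 denseRange_toL2 denseRange_toL2
    (norm_toLp_uS t) φ

theorem dense_toLp {P : L2 V → Prop} (hc : IsClosed {f | P f})
    (h : ∀ φ : 𝓢(V, ℂ), P (φ.toLp 2 volume)) (f : L2 V) : P f :=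
  denseRange_toL2.induction_on f hc h

theorem U_add (s t : ℝ) (f : L2 V) : U s (U t f) = U (s + t) f := by
  refine dense_toLp (P := fun f => U s (U t f) = U (s + t) f) (isClosed_eq ?_ ?_) (fun φ => ?_) f
  · exact (U s).continuous.comp (U t).continuous
  · exact (U (s + t)).continuous
  · simp only [U_toLp, uS_add]

theorem U_zero (f : L2 V) : U 0 f = f := by
  refine dense_toLp (P := fun f => U 0 f = f) (isClosed_eq (U 0).continuous continuous_id)
    (fun φ => ?_) f
  simp only [U_toLp, uS_zero]

theorem inner_U_left (t : ℝ) (f g : L2 V) :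
    inner ℂ (U t f) g = inner ℂ f (U (-t) g) := by
  have : g = U t (U (-t) g) := by rw [U_add, add_neg_cancel, U_zero]
  conv_lhs => rw [this]
  exact (U t).inner_map_map _ _

theorem continuous_toLp_uS (φ : 𝓢(V, ℂ)) : Continuous (fun t => (uS t φ).toLp 2 (volume : Measure V)) := by
  have hn : ∀ ψ : 𝓢(V, ℂ), ‖ψ.toLp 2 (volume : Measure V)‖ ^ 2 = ∫ ξ, ‖𝓕 ψ ξ‖ ^ 2 := by
    intro ψ
    rw [integral_norm_sq_fourier, ← real_inner_self_eq_norm_sq, ]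
    have : (inner ℝ (ψ.toLp 2 (volume : Measure V)) (ψ.toLp 2 volume)) = ∫ x, ‖ψ x‖^2 := by
      rw [MeasureTheory.L2.inner_def]
      refine integral_congr_ae ?_
      filter_upwards [ψ.coeFn_toLp 2 volume] with x hx
      rw [hx, real_inner_self_eq_norm_sq]
    exact this
  rw [continuous_iff_continuousAt]
  intro t
  rw [ContinuousAt, tendsto_iff_norm_sub_tendsto_zero]
  have h2 : Tendsto (fun s => ‖(uS s φ).toLp 2 (volume : Measure V) - (uS t φ).toLp 2 volume‖ ^ 2) (𝓝 t) (𝓝 0) := by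
    have e : ∀ s, ‖(uS s φ).toLp 2 (volume : Measure V) - (uS t φ).toLp 2 volume‖ ^ 2
        = ∫ ξ, ‖(sym s ξ - sym t ξ) * 𝓕 φ ξ‖ ^ 2 := by
      intro s
      have : (uS s φ).toLp 2 (volume : Measure V) - (uS t φ).toLp 2 volume = (uS s φ - uS t φ).toLp 2 volume :=
        ((toLpCLM ℂ ℂ 2 (volume : Measure V)).map_sub _ _).symm
      rw [this, hn]
      congr 1; ext ξ
      have : 𝓕 (uS s φ - uS t φ) = 𝓕 (uS s φ) - 𝓕 (uS t φ) := by
        exact (fourierTransformCLM ℂ).map_sub _ _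
      rw [this, sub_apply, fourier_uS, fourier_uS, sub_mul]
    simp_rw [e]
    have h0 : ∫ ξ : V, ‖(sym t ξ - sym t ξ) * 𝓕 φ ξ‖ ^ 2 = 0 := by simp
    rw [← h0]
    refine tendsto_integral_filter_of_dominated_convergence (fun ξ => 4 * ‖𝓕 φ ξ‖ ^ 2) ?_ ?_ ?_ ?_
    · refine Eventually.of_forall fun s => Continuous.aestronglyMeasurable ?_
      have := continuous_sym_right (V := V) s
      have := continuous_sym_right (V := V) t
      have := (𝓕 φ).continuous
      fun_prop
    · refine Eventually.of_forall fun s => Eventually.of_forall fun ξ => ?_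
      rw [Real.norm_of_nonneg (by positivity), norm_mul, mul_pow]
      gcongr
      have : ‖sym s ξ - sym t ξ‖ ≤ 2 := (norm_sub_le _ _).trans (by rw [norm_sym, norm_sym]; norm_num)
      nlinarith [norm_nonneg (sym s ξ - sym t ξ)]
    · have := (memLp_two_iff_integrable_sq_norm (𝓕 φ).continuous.aestronglyMeasurable).1 ((𝓕 φ).memLp 2 volume)
      exact this.const_mul 4
    · refine Eventually.of_forall fun ξ => ?_
      have := (continuous_sym_left ξ).continuousAt (x := t)
      exact ((((this.sub continuousAt_const).mul continuousAt_const).norm).pow 2)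
  have h3 := (Real.continuous_sqrt.tendsto 0).comp h2
  simpa [Function.comp_def, Real.sqrt_sq (norm_nonneg _)] using h3

theorem continuous_U_apply (f : L2 V) : Continuous (fun t => U t f) := by
  refine dense_toLp (P := fun f => Continuous (fun t => U t f)) ?_ (fun φ => ?_) f
  · rw [← isSeqClosed_iff_isClosed]
    intro F f hF hlim
    have : TendstoUniformly (fun k t => U t (F k)) (fun t => U t f) atTop := by
      rw [Metric.tendstoUniformly_iff]
      intro ε hε
      filter_upwards [Metric.tendsto_nhds.1 hlim ε hε] with k hk t
      rw [dist_comm, (U t).dist_map]; exact hk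
    exact this.continuous (Frequently.of_forall hF)
  · simp only [U_toLp]; exact continuous_toLp_uS φ

theorem continuous_U : Continuous (fun z : ℝ × L2 V => U z.1 z.2) := by
  rw [continuous_iff_continuousAt]
  rintro ⟨t, f⟩
  rw [ContinuousAt, tendsto_iff_dist_tendsto_zero]
  have hb : ∀ z : ℝ × L2 V, dist (U z.1 z.2) (U t f) ≤ dist z.2 f + dist (U z.1 f) (U t f) := by
    intro z
    refine (dist_triangle _ (U z.1 f) _).trans ?_
    rw [(U z.1).dist_map]
  refine squeeze_zero (fun _ => dist_nonneg) hb ?_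
  have c : Continuous (fun z : ℝ × L2 V => dist z.2 f + dist (U z.1 f) (U t f)) := by
    have := continuous_U_apply f
    fun_prop
  have := c.tendsto (t, f)
  simpa using this

end Propagator

section Kernel

variable {V : Type*} [NormedAddCommGroup V] [InnerProductSpace ℝ V] [FiniteDimensional ℝ V]
  [MeasurableSpace V] [BorelSpace V]

/-- The integral kernel of the free Schrödinger group. -/
noncomputable def kern (t : ℝ) (z : V) : ℂ :=
  (4 * Real.pi * Complex.I * (t : ℂ)) ^ (-(Module.finrank ℝ V : ℂ) / 2) *
    Complex.exp (Complex.I * (‖z‖ : ℂ) ^ 2 / (4 * (t : ℂ)))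

/-- The dispersive decay factor. -/
noncomputable def disp (V : Type*) [NormedAddCommGroup V] [InnerProductSpace ℝ V] (t : ℝ) : ℝ :=
  (4 * Real.pi * |t|) ^ (-(Module.finrank ℝ V : ℝ) / 2)

theorem norm_kern {t : ℝ} (ht : t ≠ 0) (z : V) : ‖kern t z‖ = disp V t := by
  have h0 : (4 * Real.pi * Complex.I * (t : ℂ)) ≠ 0 := by
    simp [ht, Real.pi_ne_zero]
  have h1 : (Complex.I * (‖z‖ : ℂ) ^ 2 / (4 * (t : ℂ))) = ((‖z‖ ^ 2 / (4 * t) : ℝ) : ℂ) * Complex.I := by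
    push_cast; ring
  have h2 : (-(Module.finrank ℝ V : ℂ) / 2) = ((-(Module.finrank ℝ V : ℝ) / 2 : ℝ) : ℂ) := by push_cast; ring
  rw [kern, disp, norm_mul, h1, Complex.norm_exp_ofReal_mul_I, mul_one, h2, Complex.norm_cpow_real]
  congr 1
  simp [abs_of_pos Real.pi_pos]

theorem disp_nonneg (t : ℝ) : 0 ≤ disp V t := by unfold disp; positivity

theorem continuous_kern (t : ℝ) : Continuous (fun z : V => kern t z) := by
  unfold kern
  fun_prop

theorem measurable_kern : Measurable (fun z : ℝ × V => kern z.1 z.2) := by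
  unfold kern
  fun_prop

theorem conj_kern (t : ℝ) (z : V) : conj (kern t z) = kern (-t) z := by
  have ha : (4 * Real.pi * Complex.I * (t : ℂ)).arg ≠ Real.pi := by
    rw [Ne, Complex.arg_eq_pi_iff]
    simp
  rw [kern, kern, map_mul, ← Complex.exp_conj]
  congr 1
  · have h1 : (4 * Real.pi * Complex.I * ((-t : ℝ) : ℂ)) = conj (4 * Real.pi * Complex.I * (t : ℂ)) := by
      simp only [map_mul, Complex.conj_ofReal, Complex.conj_I, map_ofNat]; push_cast; ring
    rw [h1, Complex.conj_cpow _ _ ha]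
    simp only [map_div₀, map_neg, map_natCast, map_ofNat]
  · congr 1
    simp only [map_div₀, map_mul, map_pow, Complex.conj_ofReal, Complex.conj_I, map_ofNat]
    push_cast
    ring

theorem integral_gauss_fourier (φ : 𝓢(V, ℂ)) {b : ℂ} (hb : 0 < b.re) (x : V) :
    ∫ ξ, Complex.exp (-b * ‖ξ‖ ^ 2 + 2 * Real.pi * Complex.I * (inner ℝ x ξ : ℝ)) * 𝓕 φ ξ =
      ∫ y, (Real.pi / b) ^ (Module.finrank ℝ V / 2 : ℂ) *
        Complex.exp (-Real.pi ^ 2 * ‖x - y‖ ^ 2 / b) * φ y := by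
  have := VectorFourier.integral_fourierIntegral_smul_eq_flip (μ := (volume : Measure V)) (ν := (volume : Measure V))
    (L := innerₗ V) Real.continuous_fourierChar continuous_inner
    (GaussianFourier.integrable_cexp_neg_mul_sq_norm_add hb (2 * Real.pi * Complex.I) x) φ.integrable
  rw [flip_innerₗ] at this
  simp only [smul_eq_mul] at this
  rw [fourier_coe]
  refine Eq.trans this.symm ?_
  refine integral_congr_ae (Eventually.of_forall fun y => ?_)
  simp only
  congr 1
  exact fourier_gaussian_innerProductSpace' hb x y

theorem uS_eq_kern {t : ℝ} (ht : t ≠ 0) (φ : 𝓢(V, ℂ)) (x : V) :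
    uS t φ x = ∫ y, kern t (x - y) * φ y := by
  set b : ℝ → ℂ := fun δ => (δ : ℂ) + 4 * Real.pi ^ 2 * t * Complex.I with hbdef
  have hb0 : Tendsto b (𝓝[>] 0) (𝓝 (b 0)) := by
    have : Continuous b := by fun_prop
    exact this.continuousAt.tendsto.mono_left nhdsWithin_le_nhds
  have hbre : ∀ δ, (b δ).re = δ := by
    intro δ
    simp [hbdef, ← Complex.ofReal_pow]
  have hb0ne : b 0 ≠ 0 := by simp [hbdef, ht, Real.pi_ne_zero]
  have h1 : Tendsto (fun δ : ℝ => ∫ ξ, Complex.exp (-b δ * ‖ξ‖ ^ 2 + 2 * Real.pi * Complex.I * (inner ℝ x ξ : ℝ)) * 𝓕 φ ξ)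
      (𝓝[>] 0) (𝓝 (uS t φ x)) := by
    have e : uS t φ x = ∫ ξ, Complex.exp (-b 0 * ‖ξ‖ ^ 2 + 2 * Real.pi * Complex.I * (inner ℝ x ξ : ℝ)) * 𝓕 φ ξ := by
      rw [uS_apply]
      congr 1; ext ξ
      rw [← mul_assoc, sym, ← Complex.exp_add]
      congr 2
      rw [real_inner_comm]
      simp only [hbdef]
      push_cast; ring
    rw [e]
    refine tendsto_integral_filter_of_dominated_convergence (fun ξ => ‖𝓕 φ ξ‖) ?_ ?_ ((𝓕 φ).integrable.norm) ?_
    · refine Eventually.of_forall fun δ => Continuous.aestronglyMeasurable ?_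
      have := (𝓕 φ).continuous
      fun_prop
    · filter_upwards [self_mem_nhdsWithin] with δ hδ
      refine Eventually.of_forall fun ξ => ?_
      rw [norm_mul, Complex.norm_exp]
      have : (-b δ * ‖ξ‖ ^ 2 + 2 * Real.pi * Complex.I * (inner ℝ x ξ : ℝ)).re = -(δ * ‖ξ‖ ^ 2) := by
        have h2 : (2 * Real.pi * Complex.I * (inner ℝ x ξ : ℝ) : ℂ) = ((2 * Real.pi * inner ℝ x ξ : ℝ) : ℂ) * Complex.I := by
          push_cast; ring
        rw [h2, ← Complex.ofReal_pow, Complex.add_re, Complex.re_mul_ofReal, Complex.neg_re, hbre]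
        simp
      rw [this]
      have h3 : Real.exp (-(δ * ‖ξ‖ ^ 2)) ≤ 1 := by
        rw [Real.exp_le_one_iff]
        have := le_of_lt (Set.mem_Ioi.1 hδ)
        have := mul_nonneg this (sq_nonneg ‖ξ‖)
        linarith
      exact mul_le_of_le_one_left (norm_nonneg _) h3
    · refine Eventually.of_forall fun ξ => ?_
      have : Continuous (fun z : ℂ => Complex.exp (-z * ‖ξ‖ ^ 2 + 2 * Real.pi * Complex.I * (inner ℝ x ξ : ℝ)) * 𝓕 φ ξ) := by
        fun_prop
      exact (this.tendsto (b 0)).comp hb0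
  have hcpow : Tendsto (fun δ : ℝ => (Real.pi / b δ) ^ (Module.finrank ℝ V / 2 : ℂ)) (𝓝[>] 0)
      (𝓝 ((Real.pi / b 0) ^ (Module.finrank ℝ V / 2 : ℂ))) := by
    have hs : (Real.pi / b 0 : ℂ) ∈ Complex.slitPlane := by
      right
      have : (Real.pi / b 0 : ℂ) = ((-1 / (4 * Real.pi * t) : ℝ) : ℂ) * Complex.I := by
        simp only [hbdef]
        push_cast
        have : (Real.pi : ℂ) ≠ 0 := by exact_mod_cast Real.pi_ne_zero
        have : (t : ℂ) ≠ 0 := by exact_mod_cast ht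
        field_simp
        ring_nf
        rw [Complex.I_sq]; ring
      rw [this, Complex.im_ofReal_mul]
      simp [ht, Real.pi_ne_zero]
    exact (tendsto_const_nhds.div hb0 hb0ne).cpow tendsto_const_nhds hs
  have h2 : Tendsto (fun δ : ℝ => ∫ y, (Real.pi / b δ) ^ (Module.finrank ℝ V / 2 : ℂ) *
        Complex.exp (-Real.pi ^ 2 * ‖x - y‖ ^ 2 / b δ) * φ y) (𝓝[>] 0) (𝓝 (∫ y, kern t (x - y) * φ y)) := by
    have e : (fun y => kern t (x - y) * φ y) = fun y => (Real.pi / b 0) ^ (Module.finrank ℝ V / 2 : ℂ) *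
        Complex.exp (-Real.pi ^ 2 * ‖x - y‖ ^ 2 / b 0) * φ y := by
      have hp : (Real.pi : ℂ) ≠ 0 := by exact_mod_cast Real.pi_ne_zero
      have ht' : (t : ℂ) ≠ 0 := by exact_mod_cast ht
      ext y
      rw [kern]
      congr 2
      · have e1 : (Real.pi / b 0 : ℂ) = (4 * Real.pi * Complex.I * (t : ℂ))⁻¹ := by
          simp only [hbdef]
          push_cast
          field_simp
          simp
        rw [e1, Complex.inv_cpow, neg_div, Complex.cpow_neg]
        rw [Ne, Complex.arg_eq_pi_iff]
        simp
      · congr 1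
        simp only [hbdef]
        push_cast
        rw [zero_add, div_eq_div_iff (by simp [ht']) (by simp [ht', hp])]
        ring_nf
        rw [Complex.I_sq]; ring
    rw [e]
    obtain ⟨M, hM⟩ : ∃ M : ℝ, ∀ᶠ δ in 𝓝[>] (0 : ℝ), ‖(Real.pi / b δ) ^ (Module.finrank ℝ V / 2 : ℂ)‖ ≤ M :=
      ⟨_, (hcpow.norm.eventually_lt_const (lt_add_one _)).mono fun _ h => h.le⟩
    refine tendsto_integral_filter_of_dominated_convergence (fun ξ => M * ‖φ ξ‖) ?_ ?_ (φ.integrable.norm.const_mul M) ?_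
    · refine Eventually.of_forall fun δ => Continuous.aestronglyMeasurable ?_
      have := φ.continuous
      fun_prop
    · filter_upwards [self_mem_nhdsWithin, hM] with δ hδ hM
      refine Eventually.of_forall fun y => ?_
      rw [norm_mul, norm_mul]
      have : ‖Complex.exp (-Real.pi ^ 2 * ‖x - y‖ ^ 2 / b δ)‖ ≤ 1 := by
        rw [Complex.norm_exp, Real.exp_le_one_iff]
        have : (-Real.pi ^ 2 * ‖x - y‖ ^ 2 / b δ : ℂ) = ((-Real.pi ^ 2 * ‖x - y‖ ^ 2 : ℝ) : ℂ) * (b δ)⁻¹ := by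
          push_cast; ring
        rw [this, Complex.re_ofReal_mul, Complex.inv_re, hbre]
        have h4 : 0 ≤ δ / Complex.normSq (b δ) := div_nonneg (le_of_lt hδ) (Complex.normSq_nonneg _)
        have h5 : 0 ≤ Real.pi ^ 2 * ‖x - y‖ ^ 2 := by positivity
        nlinarith [mul_nonneg h5 h4]
      calc _ ≤ M * 1 * ‖φ y‖ := by gcongr; exact (norm_nonneg _).trans hM
        _ = _ := by ring
    · refine Eventually.of_forall fun y => ?_
      refine (hcpow.mul ?_).mul tendsto_const_nhds
      exact (Complex.continuous_exp.tendsto _).comp (tendsto_const_nhds.div hb0 hb0ne)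
  refine tendsto_nhds_unique h1 (h2.congr' ?_)
  filter_upwards [self_mem_nhdsWithin] with δ hδ
  exact (integral_gauss_fourier φ (by rw [hbre]; exact hδ) x).symm

end Kernel

section Explicit

variable {V : Type*} [NormedAddCommGroup V] [InnerProductSpace ℝ V] [FiniteDimensional ℝ V]
  [MeasurableSpace V] [BorelSpace V]

theorem ae_eq_of_schwartz {F G : V → ℂ} (hF : LocallyIntegrable F) (hG : LocallyIntegrable G)
    (h : ∀ ψ : 𝓢(V, ℂ), HasCompactSupport ψ → ∫ x, conj (ψ x) * F x = ∫ x, conj (ψ x) * G x) :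
    F =ᵐ[volume] G := by
  refine ae_eq_of_integral_contDiff_smul_eq hF hG fun g hg hgs => ?_
  have hs : HasCompactSupport (fun x => (g x : ℂ)) := hgs.comp_left Complex.ofReal_zero
  have hd : ContDiff ℝ (↑(⊤ : ℕ∞)) (fun x => (g x : ℂ)) := Complex.ofRealCLM.contDiff.comp hg
  have := h (hs.toSchwartzMap hd) hs
  have e : ∀ x, conj ((hs.toSchwartzMap hd) x) = (g x : ℂ) := fun x => Complex.conj_ofReal _
  simp_rw [e] at this
  simpa only [Complex.real_smul] using this

theorem inner_toLp (ψ : 𝓢(V, ℂ)) (f : L2 V) :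
    inner ℂ (ψ.toLp 2 volume) f = ∫ x, conj (ψ x) * f x := by
  rw [MeasureTheory.L2.inner_def]
  refine integral_congr_ae ?_
  filter_upwards [ψ.coeFn_toLp 2 volume] with x hx
  rw [hx, RCLike.inner_apply', ]

theorem kern_neg (t : ℝ) (z : V) : kern t (-z) = kern t z := by simp [kern]

theorem U_ae_eq_kern {t : ℝ} (ht : t ≠ 0) {f : V → ℂ} (hf1 : Integrable f) (hf2 : MemLp f 2) :
    (U t (hf2.toLp f) : V → ℂ) =ᵐ[volume] fun x => ∫ y, kern t (x - y) * f y := by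
  have hGc : Continuous (fun x => ∫ y, kern t (x - y) * f y) := by
    refine continuous_of_dominated (bound := fun y => disp V t * ‖f y‖) (fun x => ?_) (fun x => ?_)
      (hf1.norm.const_mul _) ?_
    · have := continuous_kern (V := V) t
      exact (by fun_prop : Continuous fun y => kern t (x - y)).aestronglyMeasurable.mul hf1.1
    · exact Eventually.of_forall fun y => by rw [norm_mul, norm_kern ht]
    · have := continuous_kern (V := V) t
      exact Eventually.of_forall fun y => by fun_prop
  refine ae_eq_of_schwartz ((Lp.memLp _).locallyIntegrable (by norm_num)) hGc.locallyIntegrable ?_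
  intro ψ _
  rw [← inner_toLp]
  have e1 : inner ℂ (ψ.toLp 2 volume) (U t (hf2.toLp f)) = inner ℂ (U (-t) (ψ.toLp 2 volume)) (hf2.toLp f) := by
    rw [inner_U_left, neg_neg]
  rw [e1, U_toLp, inner_toLp]
  have e2 : ∫ x, conj (uS (-t) ψ x) * (hf2.toLp f : V → ℂ) x
      = ∫ y, ∫ x, conj (ψ x) * (kern t (x - y) * f y) := by
    refine integral_congr_ae ?_
    filter_upwards [hf2.coeFn_toLp] with y hy
    rw [hy, uS_eq_kern (neg_ne_zero.2 ht), ← integral_conj, ← integral_mul_const]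
    congr 1; ext x
    rw [map_mul, conj_kern, neg_neg, ← neg_sub, kern_neg]; ring
  rw [e2, integral_integral_swap]
  · congr 1; ext x; rw [integral_const_mul]
  · have : Integrable (fun z : V × V => (disp V t) * (‖f z.1‖ * ‖ψ z.2‖)) (volume.prod volume) :=
      (hf1.norm.mul_prod ψ.integrable.norm).const_mul _
    refine this.mono' ?_ (Eventually.of_forall fun z => ?_)
    · have := continuous_kern (V := V) t
      have hψ := ψ.continuous
      have h1 : AEStronglyMeasurable (fun z : V × V => f z.1) (volume.prod volume) := hf1.1.comp_fst
      have h2 : Continuous (fun z : V × V => conj (ψ z.2)) := by fun_prop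
      have h3 : Continuous (fun z : V × V => kern t (z.2 - z.1)) := by fun_prop
      exact h2.aestronglyMeasurable.mul (h3.aestronglyMeasurable.mul h1)
    · simp only [Function.uncurry, norm_mul, norm_kern ht, RCLike.norm_conj]
      exact le_of_eq (by ring)

end Explicit

section Interpolation

/-- Interpolation of a coefficient: equals `c` at `z = θ` when `r (1 + θ) / 2 = 1`. -/
noncomputable def interpCoeff (r : ℝ) (c : ℂ) (z : ℂ) : ℂ :=
  if c = 0 then 0 else (c / ‖c‖) * Complex.exp ((Real.log ‖c‖ * r / 2 : ℝ) * (1 + z))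

theorem norm_interpCoeff {r : ℝ} (hr : 0 < r) (c z : ℂ) (hz : 0 ≤ z.re) :
    ‖interpCoeff r c z‖ = ‖c‖ ^ (r * (1 + z.re) / 2) := by
  unfold interpCoeff
  split_ifs with h
  · rw [h, norm_zero, Real.zero_rpow]; nlinarith
  · have hc : 0 < ‖c‖ := norm_pos_iff.2 h
    rw [norm_mul, norm_div, Complex.norm_real, norm_norm, div_self hc.ne', one_mul, Complex.norm_exp,
      Complex.re_ofReal_mul, Real.rpow_def_of_pos hc]
    congr 1; simp; ring

theorem interpCoeff_self {r θ : ℝ} (h : r * (1 + θ) / 2 = 1) (c : ℂ) : interpCoeff r c θ = c := by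
  unfold interpCoeff
  split_ifs with h0
  · exact h0.symm
  · have hc : 0 < ‖c‖ := norm_pos_iff.2 h0
    have : ((Real.log ‖c‖ * r / 2 : ℝ) * (1 + (θ : ℂ)) : ℂ) = ((Real.log ‖c‖ : ℝ) : ℂ) := by
      rw [← Complex.ofReal_one, ← Complex.ofReal_add, ← Complex.ofReal_mul]
      congr 1
      calc _ = Real.log ‖c‖ * (r * (1 + θ) / 2) := by ring
        _ = _ := by rw [h, mul_one]
    have hc' : (‖c‖ : ℂ) ≠ 0 := by exact_mod_cast hc.ne'
    rw [this, ← Complex.ofReal_exp, Real.exp_log hc, div_mul_cancel₀ _ hc']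

theorem differentiable_interpCoeff (r : ℝ) (c : ℂ) : Differentiable ℂ (interpCoeff r c) := by
  unfold interpCoeff
  split_ifs with h
  · exact differentiable_const _
  · fun_prop

theorem bilinear_interpolation {ι κ : Type*} [Fintype ι] [Fintype κ] (M : ι → κ → ℂ) (v : ι → ℝ) (w : κ → ℝ)
    (hv : ∀ i, 0 ≤ v i) (hw : ∀ j, 0 ≤ w j) {D : ℝ} (hD : 0 ≤ D)
    (h2 : ∀ (a : ι → ℂ) (b : κ → ℂ), ‖∑ i, ∑ j, a i * b j * M i j‖ ≤
      Real.sqrt (∑ i, ‖a i‖ ^ 2 * v i) * Real.sqrt (∑ j, ‖b j‖ ^ 2 * w j))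
    (h1 : ∀ i j, ‖M i j‖ ≤ D * (v i * w j)) {r : ℝ} (hr1 : 1 < r) (hr2 : r ≤ 2)
    (a : ι → ℂ) (b : κ → ℂ) :
    ‖∑ i, ∑ j, a i * b j * M i j‖ ≤ D ^ (2 / r - 1) *
      ((∑ i, ‖a i‖ ^ r * v i) ^ (1 / r) * (∑ j, ‖b j‖ ^ r * w j) ^ (1 / r)) := by
  have hr0 : 0 < r := by linarith
  set θ : ℝ := 2 / r - 1 with hθ
  have hθ0 : 0 ≤ θ := by rw [hθ, sub_nonneg, le_div_iff₀ hr0]; linarith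
  have hθ1 : θ < 1 := by rw [hθ, sub_lt_iff_lt_add, div_lt_iff₀ hr0]; linarith
  have hrθ : r * (1 + θ) / 2 = 1 := by rw [hθ]; field_simp; ring
  set A := ∑ i, ‖a i‖ ^ r * v i
  set B := ∑ j, ‖b j‖ ^ r * w j
  have hA : 0 ≤ A := Finset.sum_nonneg fun i _ => mul_nonneg (by positivity) (hv i)
  have hB : 0 ≤ B := Finset.sum_nonneg fun i _ => mul_nonneg (by positivity) (hw i)
  set f : ℂ → ℂ := fun z => ∑ i, ∑ j, interpCoeff r (a i) z * interpCoeff r (b j) z * M i j with hf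
  have hfd : Differentiable ℂ f := by
    have := fun i => differentiable_interpCoeff r (a i)
    have := fun i => differentiable_interpCoeff r (b i)
    fun_prop
  have hpow : ∀ (x y : ℝ), 0 ≤ x → 0 ≤ y → y ≤ 1 → x ^ (r * (1 + y) / 2) ≤ 1 + x ^ r := by
    intro x y hx hy hy1
    rcases le_total x 1 with h | h
    · have : x ^ (r * (1 + y) / 2) ≤ 1 := Real.rpow_le_one hx h (by positivity)
      have : 0 ≤ x ^ r := by positivity
      linarith
    · have : x ^ (r * (1 + y) / 2) ≤ x ^ r := Real.rpow_le_rpow_of_exponent_le h (by nlinarith)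
      linarith
  have hbdd : BddAbove ((norm ∘ f) '' Complex.HadamardThreeLines.verticalClosedStrip 0 1) := by
    refine ⟨∑ i, ∑ j, (1 + ‖a i‖ ^ r) * (1 + ‖b j‖ ^ r) * ‖M i j‖, ?_⟩
    rintro _ ⟨z, hz, rfl⟩
    have hz' : 0 ≤ z.re ∧ z.re ≤ 1 := hz
    refine (norm_sum_le _ _).trans (Finset.sum_le_sum fun i _ => (norm_sum_le _ _).trans
      (Finset.sum_le_sum fun j _ => ?_))
    rw [norm_mul, norm_mul, norm_interpCoeff hr0 _ _ hz'.1, norm_interpCoeff hr0 _ _ hz'.1]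
    have h1 := hpow ‖a i‖ z.re (norm_nonneg _) hz'.1 hz'.2
    have h2 := hpow ‖b j‖ z.re (norm_nonneg _) hz'.1 hz'.2
    gcongr
  have key := Complex.HadamardThreeLines.norm_le_interp_of_mem_verticalClosedStrip' (f := f) (z := (θ : ℂ))
    (a := Real.sqrt A * Real.sqrt B) (b := D * (A * B)) zero_lt_one
    (by constructor <;> simp [hθ0, hθ1.le]) hfd.diffContOnCl hbdd ?_ ?_
  · have e : f θ = ∑ i, ∑ j, a i * b j * M i j := by
      simp only [hf, interpCoeff_self hrθ]
    rw [e] at key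
    refine key.trans (le_of_eq ?_)
    simp only [Complex.ofReal_re, sub_zero, div_one]
    rw [Real.mul_rpow hD (by positivity), ← Real.sqrt_mul hA, Real.sqrt_eq_rpow, ← Real.rpow_mul (by positivity),
      ← Real.mul_rpow hA hB]
    have h3 : (A * B) ^ (1 / r) = (A * B) ^ (1 / 2 * (1 - θ)) * (A * B) ^ θ := by
      rw [← Real.rpow_add_of_nonneg (by positivity) (by linarith) hθ0]
      congr 1; rw [hθ]; field_simp; ring
    rw [h3]; ring
  · intro z hz
    have hz : z.re = 0 := hz
    refine (h2 _ _).trans (le_of_eq ?_)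
    have : ∀ c : ℂ, ‖interpCoeff r c z‖ ^ 2 = ‖c‖ ^ r := by
      intro c
      rw [norm_interpCoeff hr0 _ _ hz.ge, hz, ← Real.rpow_natCast, ← Real.rpow_mul (norm_nonneg _)]
      congr 1; push_cast; ring
    simp only [this, A, B]
  · intro z hz
    have hz : z.re = 1 := hz
    have : ∀ c : ℂ, ‖interpCoeff r c z‖ = ‖c‖ ^ r := by
      intro c
      rw [norm_interpCoeff hr0 _ _ (by rw [hz]; norm_num), hz]
      congr 1; ring
    calc ‖f z‖ ≤ ∑ i, ∑ j, ‖a i‖ ^ r * ‖b j‖ ^ r * (D * (v i * w j)) := by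
          refine (norm_sum_le _ _).trans (Finset.sum_le_sum fun i _ => (norm_sum_le _ _).trans
            (Finset.sum_le_sum fun j _ => ?_))
          rw [norm_mul, norm_mul, this, this]
          have := h1 i j
          gcongr
      _ = D * (A * B) := by
          rw [Finset.sum_mul_sum, Finset.mul_sum]
          refine Finset.sum_congr rfl fun i _ => ?_
          rw [Finset.mul_sum]
          exact Finset.sum_congr rfl fun j _ => by ring

variable {V : Type*} [NormedAddCommGroup V] [InnerProductSpace ℝ V] [FiniteDimensional ℝ V]
  [MeasurableSpace V] [BorelSpace V]

theorem norm_inner_U_indicator_le {t : ℝ} (ht : t ≠ 0) {E F : Set V} (hE : MeasurableSet E)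
    (hF : MeasurableSet F) (hμE : volume E ≠ ⊤) (hμF : volume F ≠ ⊤) :
    ‖inner ℂ (U t (indicatorConstLp 2 hE hμE (1 : ℂ))) (indicatorConstLp 2 hF hμF (1 : ℂ))‖ ≤
      disp V t * (volume.real E * volume.real F) := by
  rw [← inner_conj_symm, RCLike.norm_conj, L2.inner_indicatorConstLp_one]
  have hi : Integrable (E.indicator fun _ => (1 : ℂ)) := (integrable_indicator_iff hE).2 (integrableOn_const hμE)
  have h := U_ae_eq_kern ht hi (memLp_indicator_const 2 hE 1 (Or.inr hμE))
  have h' : ∀ᵐ x ∂(volume.restrict F), ‖(U t (indicatorConstLp 2 hE hμE (1 : ℂ)) : V → ℂ) x‖ ≤ disp V t * volume.real E := by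
    refine ae_restrict_of_ae ?_
    filter_upwards [h] with x hx
    have : (U t (indicatorConstLp 2 hE hμE (1 : ℂ)) : V → ℂ) x = ∫ y, kern t (x - y) * E.indicator (fun _ => (1 : ℂ)) y := hx
    rw [this]
    have e : (fun y => kern t (x - y) * E.indicator (fun _ => (1 : ℂ)) y) = E.indicator (fun y => kern t (x - y)) := by
      ext y; by_cases hy : y ∈ E <;> simp [hy]
    rw [e, integral_indicator hE]
    exact norm_setIntegral_le_of_norm_le_const hμE.lt_top (fun y _ => (norm_kern ht _).le)
  rw [← mul_assoc]
  exact norm_setIntegral_le_of_norm_le_const_ae hμF.lt_top h'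

theorem norm_sum_smul_indicator {ι : Type*} [Fintype ι] (E : ι → Set V) (hE : ∀ i, MeasurableSet (E i))
    (hμE : ∀ i, volume (E i) ≠ ⊤) (hd : Pairwise (fun i j => Disjoint (E i) (E j))) (a : ι → ℂ) :
    ‖∑ i, a i • indicatorConstLp 2 (hE i) (hμE i) (1 : ℂ)‖ = Real.sqrt (∑ i, ‖a i‖ ^ 2 * volume.real (E i)) := by
  rw [eq_comm, Real.sqrt_eq_iff_mul_self_eq (Finset.sum_nonneg fun i _ => by positivity) (norm_nonneg _), eq_comm, ← sq]
  have := inner_self_eq_norm_sq_to_K (𝕜 := ℂ) (∑ i, a i • indicatorConstLp 2 (hE i) (hμE i) (1 : ℂ))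
  have h2 : ((‖∑ i, a i • indicatorConstLp 2 (hE i) (hμE i) (1 : ℂ)‖ ^ 2 : ℝ) : ℂ)
     = ((∑ i, ‖a i‖ ^ 2 * volume.real (E i) : ℝ) : ℂ) := by
    push_cast
    refine this.symm.trans ?_
    rw [sum_inner]
    refine Finset.sum_congr rfl fun i _ => ?_
    rw [inner_sum, Finset.sum_eq_single i]
    · rw [inner_smul_left, inner_smul_right, L2.inner_indicatorConstLp_one_indicatorConstLp_one
        _ _ (hμE i) (hμE i), Set.inter_self, ← mul_assoc, Complex.conj_mul']
      rfl
    · intro j _ hj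
      rw [inner_smul_left, inner_smul_right, L2.inner_indicatorConstLp_one_indicatorConstLp_one
        _ _ (hμE i) (hμE j), Set.disjoint_iff_inter_eq_empty.1 (hd hj.symm)]
      simp
    · simp
  exact_mod_cast h2

end Interpolation

section Dispersive

variable {V : Type*} [NormedAddCommGroup V] [InnerProductSpace ℝ V] [FiniteDimensional ℝ V]
  [MeasurableSpace V] [BorelSpace V]

/-- The nonzero values of a simple function. -/
noncomputable def nzRange (f : SimpleFunc V ℂ) : Finset ℂ := f.range.filter (· ≠ 0)

theorem measure_fiber_ne_top {f : SimpleFunc V ℂ} (hf : MemLp f 2) (c : nzRange f) :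
    volume (f ⁻¹' {(c : ℂ)}) ≠ ⊤ :=
  (SimpleFunc.measure_preimage_lt_top_of_memLp two_ne_zero ENNReal.ofNat_ne_top f hf c
    (Finset.mem_filter.1 c.2).2).ne

theorem sum_nzRange_indicator {M : Type*} [AddCommMonoid M] (f : SimpleFunc V ℂ) (F : ℂ → M) (h0 : F 0 = 0) (x : V) :
    ∑ c : nzRange f, (f ⁻¹' {(c : ℂ)}).indicator (fun _ => F c) x = F (f x) := by
  by_cases hx : f x = 0
  · rw [hx, h0]
    refine Finset.sum_eq_zero fun c _ => ?_
    have := (Finset.mem_filter.1 c.2).2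
    rw [Set.indicator_of_notMem]
    intro h
    exact this (by rw [← hx]; exact h.symm)
  · have hm : f x ∈ nzRange f := Finset.mem_filter.2 ⟨f.mem_range_self x, hx⟩
    rw [Finset.sum_eq_single ⟨f x, hm⟩]
    · simp
    · intro c _ hc
      rw [Set.indicator_of_notMem]
      intro h
      exact hc (Subtype.ext h.symm)
    · simp

theorem simpleFunc_toLp_eq {f : SimpleFunc V ℂ} (hf : MemLp f 2) :
    hf.toLp f = ∑ c : nzRange f, (c : ℂ) •
      indicatorConstLp 2 (f.measurableSet_fiber c) (measure_fiber_ne_top hf c) (1 : ℂ) := by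
  refine Lp.ext ?_
  have h1 : ∀ᵐ x ∂(volume : Measure V), ∀ c : nzRange f,
      ((c : ℂ) • indicatorConstLp 2 (f.measurableSet_fiber c) (measure_fiber_ne_top hf c) (1 : ℂ) : L2 V) x
        = (f ⁻¹' {(c : ℂ)}).indicator (fun _ => (c : ℂ)) x := by
    rw [ae_all_iff]
    intro c
    filter_upwards [Lp.coeFn_smul (c : ℂ) (indicatorConstLp 2 (f.measurableSet_fiber c) (measure_fiber_ne_top hf c) (1 : ℂ)),
      indicatorConstLp_coeFn (p := 2) (hs := f.measurableSet_fiber c) (hμs := measure_fiber_ne_top hf c) (c := (1 : ℂ))] with x h1 h2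
    rw [h1, Pi.smul_apply, h2]
    by_cases h : x ∈ f ⁻¹' {(c : ℂ)} <;> simp [h]
  have h2 := Lp.coeFn_fun_finsetSum Finset.univ (fun c : nzRange f => (c : ℂ) •
      indicatorConstLp 2 (f.measurableSet_fiber c) (measure_fiber_ne_top hf c) (1 : ℂ))
  filter_upwards [hf.coeFn_toLp, h1, h2] with x hx h1 h2
  rw [hx, h2]
  simp_rw [h1]
  exact (sum_nzRange_indicator f (fun c => c) rfl x).symm

theorem sum_norm_rpow_nzRange {f : SimpleFunc V ℂ} (hf : MemLp f 2) {r : ℝ} (hr : 0 < r) :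
    ∑ c : nzRange f, ‖(c : ℂ)‖ ^ r * volume.real (f ⁻¹' {(c : ℂ)}) = ∫ x, ‖f x‖ ^ r := by
  have : ∀ x, ‖f x‖ ^ r = ∑ c : nzRange f, (f ⁻¹' {(c : ℂ)}).indicator (fun _ => ‖(c : ℂ)‖ ^ r) x := fun x =>
    (sum_nzRange_indicator f (fun c => ‖c‖ ^ r) (by simp [hr.ne']) x).symm
  simp_rw [this]
  rw [integral_finsetSum _ fun (c : nzRange f) _ => (integrable_indicator_iff (f.measurableSet_fiber c)).2
    (integrableOn_const (measure_fiber_ne_top hf c))]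
  refine Finset.sum_congr rfl fun c _ => ?_
  rw [integral_indicator (f.measurableSet_fiber c), setIntegral_const, smul_eq_mul, mul_comm]

theorem norm_inner_U_simpleFunc_le {t : ℝ} (ht : t ≠ 0) {f g : SimpleFunc V ℂ} (hf : MemLp f 2) (hg : MemLp g 2)
    {r : ℝ} (hr1 : 1 < r) (hr2 : r ≤ 2) :
    ‖inner ℂ (U t (hf.toLp f)) (hg.toLp g)‖ ≤
      disp V t ^ (2 / r - 1) * ((∫ x, ‖f x‖ ^ r) ^ (1 / r) * (∫ x, ‖g x‖ ^ r) ^ (1 / r)) := by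
  have hr0 : 0 < r := by linarith
  set iE : nzRange f → L2 V := fun c => indicatorConstLp 2 (f.measurableSet_fiber c) (measure_fiber_ne_top hf c) (1 : ℂ)
  set iF : nzRange g → L2 V := fun c => indicatorConstLp 2 (g.measurableSet_fiber c) (measure_fiber_ne_top hg c) (1 : ℂ)
  have hexp : ∀ (a : nzRange f → ℂ) (b : nzRange g → ℂ),
      inner ℂ (U t (∑ c, a c • iE c)) (∑ d, b d • iF d) = ∑ c, ∑ d, conj (a c) * b d * inner ℂ (U t (iE c)) (iF d) := by
    intro a b
    rw [map_sum, sum_inner]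
    refine Finset.sum_congr rfl fun c _ => ?_
    rw [inner_sum]
    refine Finset.sum_congr rfl fun d _ => ?_
    rw [map_smul, inner_smul_left, inner_smul_right, mul_assoc]
  have hdis : ∀ f : SimpleFunc V ℂ, Pairwise fun i j : nzRange f => Disjoint (f ⁻¹' {(i : ℂ)}) (f ⁻¹' {(j : ℂ)}) := by
    intro f i j hij
    refine Disjoint.preimage _ ?_
    rw [Set.disjoint_singleton]
    exact fun h => hij (Subtype.ext h)
  have := bilinear_interpolation (fun c d => inner ℂ (U t (iE c)) (iF d))
    (fun c : nzRange f => volume.real (f ⁻¹' {(c : ℂ)})) (fun d : nzRange g => volume.real (g ⁻¹' {(d : ℂ)}))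
    (fun _ => measureReal_nonneg) (fun _ => measureReal_nonneg) (disp_nonneg (V := V) t) ?_ ?_ hr1 hr2
    (fun c => conj (c : ℂ)) (fun d => (d : ℂ))
  · simp only [RCLike.norm_conj] at this
    rw [sum_norm_rpow_nzRange hf hr0, sum_norm_rpow_nzRange hg hr0] at this
    rw [simpleFunc_toLp_eq hf, simpleFunc_toLp_eq hg]
    rw [hexp (fun c => (c : ℂ)) (fun d => (d : ℂ))]
    exact this
  · intro a b
    have h1 := hexp (fun c => conj (a c)) b
    simp only [RCLike.conj_conj] at h1
    rw [← h1]
    refine (norm_inner_le_norm _ _).trans (le_of_eq ?_)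
    rw [LinearIsometryEquiv.norm_map, norm_sum_smul_indicator _ _ _ (hdis f), norm_sum_smul_indicator _ _ _ (hdis g)]
    simp only [RCLike.norm_conj]
  · intro c d
    exact norm_inner_U_indicator_le ht _ _ _ _

theorem norm_inner_U_simpleFunc_le' {t : ℝ} (ht : t ≠ 0) {f g : SimpleFunc V ℂ} (hf : MemLp f 2) (hg : MemLp g 2)
    {r : ℝ} (hr1 : 1 < r) (hr2 : r ≤ 2) (hfr : MemLp f (ENNReal.ofReal r)) (hgr : MemLp g (ENNReal.ofReal r)) :
    ‖inner ℂ (U t (hf.toLp f)) (hg.toLp g)‖ ≤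
      disp V t ^ (2 / r - 1) * ((eLpNorm f (ENNReal.ofReal r) volume).toReal * (eLpNorm g (ENNReal.ofReal r) volume).toReal) := by
  have hr0 : 0 < r := by linarith
  refine (norm_inner_U_simpleFunc_le ht hf hg hr1 hr2).trans (le_of_eq ?_)
  have e : ∀ f : V → ℂ, MemLp f (ENNReal.ofReal r) → (eLpNorm f (ENNReal.ofReal r) volume).toReal = (∫ x, ‖f x‖ ^ r) ^ (1 / r) := by
    intro f hf
    rw [hf.eLpNorm_eq_integral_rpow_norm (by simpa using hr0) ENNReal.ofReal_ne_top, ENNReal.toReal_ofReal hr0.le,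
      ENNReal.toReal_ofReal (Real.rpow_nonneg (integral_nonneg fun x => by positivity) _), one_div]
  rw [e f hfr, e g hgr]

/-- The interpolated dispersive estimate in bilinear form. -/
theorem norm_inner_U_le {t : ℝ} (ht : t ≠ 0) (f g : L2 V) {r : ℝ} (hr1 : 1 < r) (hr2 : r ≤ 2)
    (hfr : MemLp f (ENNReal.ofReal r)) (hgr : MemLp g (ENNReal.ofReal r)) :
    ‖inner ℂ (U t f) g‖ ≤
      disp V t ^ (2 / r - 1) * ((eLpNorm f (ENNReal.ofReal r) volume).toReal * (eLpNorm g (ENNReal.ofReal r) volume).toReal) := by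
  have key : ∀ f : L2 V, MemLp f (ENNReal.ofReal r) → ∃ F : ℕ → SimpleFunc V ℂ, ∃ h2 : ∀ k, MemLp (F k) 2,
      (∀ k, MemLp (F k) (ENNReal.ofReal r)) ∧
      Tendsto (fun k => (h2 k).toLp (F k)) atTop (𝓝 f) ∧
      Tendsto (fun k => (eLpNorm (F k) (ENNReal.ofReal r) volume).toReal) atTop (𝓝 (eLpNorm f (ENNReal.ofReal r) volume).toReal) := by
    intro f hfr
    have hr : (1 : ℝ≥0∞) ≤ ENNReal.ofReal r := by
      rw [← ENNReal.ofReal_one]; exact ENNReal.ofReal_le_ofReal hr1.le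
    have : Fact ((1 : ℝ≥0∞) ≤ ENNReal.ofReal r) := ⟨hr⟩
    have hsm := Lp.stronglyMeasurable f
    have hm : Measurable f := hsm.measurable
    have : TopologicalSpace.SeparableSpace (Set.range f ∪ {0} : Set ℂ) := inferInstance
    have h2 := Lp.memLp f
    refine ⟨fun k => SimpleFunc.approxOn f hm (Set.range f ∪ {0}) 0 (by simp) k,
      fun k => SimpleFunc.memLp_approxOn_range hm h2 k, fun k => SimpleFunc.memLp_approxOn_range hm hfr k, ?_, ?_⟩
    · have := SimpleFunc.tendsto_approxOn_range_Lp ENNReal.ofNat_ne_top hm h2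
      simpa using this
    · have h3 := SimpleFunc.tendsto_approxOn_range_Lp ENNReal.ofReal_ne_top hm hfr
      have h4 := (continuous_norm.tendsto _).comp h3
      simp only [Function.comp_def, Lp.norm_toLp] at h4
      exact h4
  obtain ⟨F, F2, Fr, hF, hF'⟩ := key f hfr
  obtain ⟨G, G2, Gr, hG, hG'⟩ := key g hgr
  refine le_of_tendsto_of_tendsto' (Tendsto.norm ?_) ((hF'.mul hG').const_mul _)
    (fun k => norm_inner_U_simpleFunc_le' ht (F2 k) (G2 k) hr1 hr2 (Fr k) (Gr k))
  exact Tendsto.inner (((U t).continuous.tendsto _).comp hF) hG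

end Dispersive

section HLS

theorem lintegral_Ioc_rpow {a : ℝ} (ha : -1 < a) {L : ℝ} (hL : 0 ≤ L) :
    ∫⁻ τ in Set.Ioc 0 L, ENNReal.ofReal (τ ^ a) = ENNReal.ofReal (L ^ (a + 1) / (a + 1)) := by
  rw [← ofReal_integral_eq_lintegral_ofReal]
  · rw [← intervalIntegral.integral_of_le hL, integral_rpow (Or.inl ha), Real.zero_rpow (by linarith), sub_zero]
  · exact (intervalIntegrable_iff_integrableOn_Ioc_of_le hL).1 (intervalIntegral.intervalIntegrable_rpow' ha)
  · exact (ae_restrict_mem measurableSet_Ioc).mono fun τ hτ => Real.rpow_nonneg hτ.1.le _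

theorem lintegral_abs_rpow_le {γ : ℝ} (h1 : γ < 1) {L : ℝ} (hL : 0 ≤ L) :
    ∫⁻ τ in Set.Icc (-L) L, ENNReal.ofReal (|τ| ^ (-γ)) ≤ ENNReal.ofReal (2 / (1 - γ) * L ^ (1 - γ)) := by
  have hpos : ∫⁻ τ in Set.Ioc 0 L, ENNReal.ofReal (|τ| ^ (-γ)) = ENNReal.ofReal (L ^ (1 - γ) / (1 - γ)) := by
    rw [show 1 - γ = -γ + 1 by ring, ← lintegral_Ioc_rpow (by linarith) hL]
    refine setLIntegral_congr_fun measurableSet_Ioc fun τ hτ => ?_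
    simp only [abs_of_pos hτ.1]
  have hneg : ∫⁻ τ in Set.Ico (-L) 0, ENNReal.ofReal (|τ| ^ (-γ)) = ENNReal.ofReal (L ^ (1 - γ) / (1 - γ)) := by
    rw [← hpos, ← lintegral_indicator measurableSet_Ioc, ← lintegral_indicator measurableSet_Ico]
    rw [← lintegral_neg_eq_self (f := Set.indicator (Set.Ioc 0 L) _)]
    congr 1; ext τ
    simp only [Set.indicator, Set.mem_Ico, Set.mem_Ioc, abs_neg]
    congr 1
    rw [eq_iff_iff]; constructor <;> rintro ⟨h1, h2⟩ <;> constructor <;> linarith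
  calc ∫⁻ τ in Set.Icc (-L) L, ENNReal.ofReal (|τ| ^ (-γ))
      ≤ ∫⁻ τ in (Set.Ico (-L) 0 ∪ {0}) ∪ Set.Ioc 0 L, ENNReal.ofReal (|τ| ^ (-γ)) := by
        refine lintegral_mono_set fun τ hτ => ?_
        simp only [Set.mem_union, Set.mem_Ico, Set.mem_Ioc, Set.mem_singleton_iff]
        rcases lt_trichotomy τ 0 with h | h | h
        · exact Or.inl (Or.inl ⟨hτ.1, h⟩)
        · exact Or.inl (Or.inr h)
        · exact Or.inr ⟨h, hτ.2⟩
    _ ≤ (ENNReal.ofReal (L ^ (1 - γ) / (1 - γ)) + 0) + ENNReal.ofReal (L ^ (1 - γ) / (1 - γ)) := by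
        refine (lintegral_union_le _ _ _).trans (add_le_add ((lintegral_union_le _ _ _).trans (add_le_add hneg.le ?_)) hpos.le)
        simp
    _ = _ := by
        have : 0 ≤ L ^ (1 - γ) / (1 - γ) := div_nonneg (Real.rpow_nonneg hL _) (by linarith)
        rw [add_zero, ← ENNReal.ofReal_add this this]
        congr 1; ring

theorem setLIntegral_kernel_le {γ : ℝ} (h0 : 0 < γ) (h1 : γ < 1) (E : Set ℝ) (s : ℝ) :
    ∫⁻ t in E, ENNReal.ofReal (|s - t| ^ (-γ)) ≤ ENNReal.ofReal (2 / (1 - γ) + 1) * volume E ^ (1 - γ) := by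
  have hc : 0 < 2 / (1 - γ) + 1 := by have : 0 < 1 - γ := by linarith
                                      positivity
  by_cases htop : volume E = ⊤
  · rw [htop, ENNReal.top_rpow_of_pos (by linarith), ENNReal.mul_top]
    · exact le_top
    · simpa using hc
  by_cases hz : volume E = 0
  · rw [setLIntegral_measure_zero _ _ hz]; exact zero_le
  set L := (volume E).toReal with hL
  have hL0 : 0 < L := ENNReal.toReal_pos hz htop
  have hE' : volume E = ENNReal.ofReal L := (ENNReal.ofReal_toReal htop).symm
  have hpt : ∀ t, ENNReal.ofReal (|s - t| ^ (-γ)) ≤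
      (Set.Icc (-L) L).indicator (fun τ => ENNReal.ofReal (|τ| ^ (-γ))) (s - t) + ENNReal.ofReal (L ^ (-γ)) := by
    intro t
    by_cases h : s - t ∈ Set.Icc (-L) L
    · rw [Set.indicator_of_mem h]; exact le_self_add
    · have : L < |s - t| := by
        rw [Set.mem_Icc, ← abs_le] at h; linarith
      refine le_add_left (ENNReal.ofReal_le_ofReal ?_)
      exact Real.rpow_le_rpow_of_nonpos hL0 this.le (by linarith)
  calc ∫⁻ t in E, ENNReal.ofReal (|s - t| ^ (-γ))
      ≤ ∫⁻ t in E, ((Set.Icc (-L) L).indicator (fun τ => ENNReal.ofReal (|τ| ^ (-γ))) (s - t) + ENNReal.ofReal (L ^ (-γ))) :=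
        lintegral_mono hpt
    _ = (∫⁻ t in E, ((Set.Icc (-L) L).indicator (fun τ => ENNReal.ofReal (|τ| ^ (-γ))) (s - t))) + ENNReal.ofReal (L ^ (-γ)) * volume E := by
        rw [lintegral_add_right _ measurable_const, setLIntegral_const]
    _ ≤ ENNReal.ofReal (2 / (1 - γ) * L ^ (1 - γ)) + ENNReal.ofReal (L ^ (-γ)) * ENNReal.ofReal L := by
        rw [hE']
        refine add_le_add ((setLIntegral_le_lintegral _ _).trans ?_) le_rfl
        rw [lintegral_sub_left_eq_self, lintegral_indicator measurableSet_Icc]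
        exact lintegral_abs_rpow_le h1 hL0.le
    _ = _ := by
        have e : L ^ (-γ) * L = L ^ (1 - γ) := by
          nth_rewrite 2 [← Real.rpow_one L]
          rw [← Real.rpow_add hL0]; congr 1; ring
        have : 0 < 1 - γ := by linarith
        rw [hE', ENNReal.ofReal_rpow_of_nonneg hL0.le this.le, ← ENNReal.ofReal_mul (by positivity), e,
          ← ENNReal.ofReal_add (by positivity) (by positivity), ← ENNReal.ofReal_mul hc.le]
        congr 1; ring

/-- Hölder bound for the truncated layer-cake integral. -/
theorem setLIntegral_rpow_le {γ : ℝ} (h0 : 0 < γ) (h1 : γ < 1) {v : ℝ → ℝ≥0∞} (hv : Measurable v) {β : ℝ} (hβ : 0 ≤ β) :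
    ∫⁻ α in Set.Ioc 0 β, v α ^ (1 - γ) ≤
      ENNReal.ofReal ((2 - γ) ^ γ) * (∫⁻ α in Set.Ioi 0, v α * ENNReal.ofReal (α ^ (2 / (2 - γ) - 1))) ^ (1 - γ)
        * ENNReal.ofReal (β ^ (2 / (2 - γ) - 1)) := by
  have hg : 0 < 1 - γ := by linarith
  have hg2 : 0 < 2 - γ := by linarith
  set e := 2 / (2 - γ) - 1 with he
  have hee : e = γ / (2 - γ) := by rw [he]; field_simp; ring
  have hconj : (1 / (1 - γ)).HolderConjugate (1 / γ) := by
    rw [Real.holderConjugate_iff]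
    constructor
    · rw [lt_div_iff₀ hg]; linarith
    · simp
  have hH := ENNReal.lintegral_mul_le_Lp_mul_Lq (volume.restrict (Set.Ioc 0 β)) hconj
    (f := fun α => (v α * ENNReal.ofReal (α ^ e)) ^ (1 - γ)) (g := fun α => ENNReal.ofReal (α ^ (-(e * (1 - γ)))))
    (by fun_prop) (by fun_prop)
  calc ∫⁻ α in Set.Ioc 0 β, v α ^ (1 - γ)
      = ∫⁻ α in Set.Ioc 0 β, ((fun α => (v α * ENNReal.ofReal (α ^ e)) ^ (1 - γ)) * (fun α => ENNReal.ofReal (α ^ (-(e * (1 - γ)))))) α := by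
        refine setLIntegral_congr_fun measurableSet_Ioc fun α hα => ?_
        have hα : 0 < α := hα.1
        simp only [Pi.mul_apply]
        rw [ENNReal.mul_rpow_of_nonneg _ _ hg.le, ENNReal.ofReal_rpow_of_nonneg (by positivity) hg.le,
          mul_assoc, ← ENNReal.ofReal_mul (by positivity), ← Real.rpow_mul hα.le, ← Real.rpow_add hα]
        simp
    _ ≤ _ := hH
    _ ≤ (∫⁻ α in Set.Ioi 0, v α * ENNReal.ofReal (α ^ e)) ^ (1 - γ) * (ENNReal.ofReal ((2 - γ) ^ γ) * ENNReal.ofReal (β ^ e)) := by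
        rw [one_div_one_div, one_div_one_div]
        gcongr ?_ ^ _ * ?_
        · refine (lintegral_mono_set Set.Ioc_subset_Ioi_self).trans (lintegral_mono fun α => ?_)
          rw [← ENNReal.rpow_mul, mul_one_div_cancel hg.ne', ENNReal.rpow_one]
        · have : ∀ α ∈ Set.Ioc 0 β, ENNReal.ofReal (α ^ (-(e * (1 - γ)))) ^ (1 / γ) = ENNReal.ofReal (α ^ (-((1 - γ) / (2 - γ)))) := by
            intro α hα
            have hα : 0 < α := hα.1
            rw [ENNReal.ofReal_rpow_of_nonneg (by positivity) (by positivity), ← Real.rpow_mul hα.le, hee]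
            congr 2; field_simp
          rw [setLIntegral_congr_fun measurableSet_Ioc this, lintegral_Ioc_rpow _ hβ]
          · have h3 : -((1 - γ) / (2 - γ)) + 1 = 1 / (2 - γ) := by field_simp; ring
            rw [h3, div_div_eq_mul_div, div_one, ENNReal.ofReal_rpow_of_nonneg (by positivity) h0.le, ← ENNReal.ofReal_mul (by positivity),
              Real.mul_rpow (by positivity) (by positivity), ← Real.rpow_mul hβ, hee]
            refine ENNReal.ofReal_le_ofReal (le_of_eq ?_)
            rw [mul_comm]; congr 2; field_simp
          · rw [neg_lt_neg_iff, div_lt_one hg2]; linarith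
    _ = _ := by ring

/-- The diagonal Hardy–Littlewood–Sobolev inequality on the line. -/
theorem hls {γ : ℝ} (h0 : 0 < γ) (h1 : γ < 1) : ∃ C : ℝ≥0∞, C ≠ ⊤ ∧ ∀ f : ℝ → ℝ, Measurable f → (∀ t, 0 ≤ f t) →
    ∫⁻ s, ∫⁻ t, ENNReal.ofReal (f s) * ENNReal.ofReal (f t) * ENNReal.ofReal (|s - t| ^ (-γ)) ≤
      C * (∫⁻ t, ENNReal.ofReal (f t ^ (2 / (2 - γ)))) ^ (2 - γ) := by
  have hg : 0 < 1 - γ := by linarith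
  have hg2 : 0 < 2 - γ := by linarith
  set r := 2 / (2 - γ) with hr
  have hr0 : 0 < r := by positivity
  set Ck := ENNReal.ofReal (2 / (1 - γ) + 1)
  set Ch := ENNReal.ofReal ((2 - γ) ^ γ)
  refine ⟨2 * (Ck * Ch), by finiteness, fun f hf hf0 => ?_⟩
  set B := ∫⁻ t, ENNReal.ofReal (f t ^ r) with hB
  set v : ℝ → ℝ≥0∞ := fun α => volume {t | α < f t} with hv
  have hvm : Measurable v := Antitone.measurable fun α β h => measure_mono fun t ht => lt_of_le_of_lt h ht
  have hA : ∫⁻ α in Set.Ioi 0, v α * ENNReal.ofReal (α ^ (r - 1)) ≤ B := by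
    have := lintegral_rpow_eq_lintegral_meas_lt_mul volume (Eventually.of_forall hf0) hf.aemeasurable hr0
    rw [hB, this]
    have h : 1 ≤ ENNReal.ofReal r := by
      rw [ENNReal.one_le_ofReal, hr, le_div_iff₀ hg2]; linarith
    exact le_mul_of_one_le_left' h
  have hin : ∀ s, ∫⁻ t in {t | f t ≤ f s}, ENNReal.ofReal (f t) * ENNReal.ofReal (|s - t| ^ (-γ)) ≤
      Ck * (Ch * B ^ (1 - γ) * ENNReal.ofReal (f s ^ (r - 1))) := by
    intro s
    have hlay : ∀ t, f t ≤ f s → ENNReal.ofReal (f t) ≤ ∫⁻ β in Set.Ioc 0 (f s), ({t | β < f t} : Set ℝ).indicator 1 t := by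
      intro t ht
      have : ∀ β, ({t | β < f t} : Set ℝ).indicator (1 : ℝ → ℝ≥0∞) t = (Set.Iio (f t)).indicator 1 β := by
        intro β; simp [Set.indicator]
      simp_rw [this]
      rw [lintegral_indicator_one measurableSet_Iio, Measure.restrict_apply measurableSet_Iio]
      calc ENNReal.ofReal (f t) = volume (Set.Ioo 0 (f t)) := by simp
        _ ≤ _ := measure_mono fun β (hβ : β ∈ Set.Ioo 0 (f t)) => Set.mem_inter (Set.mem_Iio.2 hβ.2) (Set.mem_Ioc.2 ⟨hβ.1, hβ.2.le.trans ht⟩)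
    have hmeas : Measurable (fun z : ℝ × ℝ => ({t | z.2 < f t} : Set ℝ).indicator (1 : ℝ → ℝ≥0∞) z.1) := by
      have : (fun z : ℝ × ℝ => ({t | z.2 < f t} : Set ℝ).indicator (1 : ℝ → ℝ≥0∞) z.1) = ({z : ℝ × ℝ | z.2 < f z.1}).indicator 1 := by
        ext z; simp [Set.indicator]
      rw [this]
      exact measurable_one.indicator (measurableSet_lt measurable_snd (hf.comp measurable_fst))
    calc ∫⁻ t in {t | f t ≤ f s}, ENNReal.ofReal (f t) * ENNReal.ofReal (|s - t| ^ (-γ))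
        ≤ ∫⁻ t in {t | f t ≤ f s}, (∫⁻ β in Set.Ioc 0 (f s), ({t | β < f t} : Set ℝ).indicator 1 t) * ENNReal.ofReal (|s - t| ^ (-γ)) :=
          setLIntegral_mono' (measurableSet_le hf measurable_const) fun t ht => by gcongr; exact hlay t ht
      _ ≤ ∫⁻ t, (∫⁻ β in Set.Ioc 0 (f s), ({t | β < f t} : Set ℝ).indicator 1 t) * ENNReal.ofReal (|s - t| ^ (-γ)) :=
          setLIntegral_le_lintegral _ _
      _ = ∫⁻ t, ∫⁻ β in Set.Ioc 0 (f s), ({t | β < f t} : Set ℝ).indicator 1 t * ENNReal.ofReal (|s - t| ^ (-γ)) := by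
          refine lintegral_congr fun t => ?_
          rw [lintegral_mul_const' _ _ ENNReal.ofReal_ne_top]
      _ = ∫⁻ β in Set.Ioc 0 (f s), ∫⁻ t, ({t | β < f t} : Set ℝ).indicator 1 t * ENNReal.ofReal (|s - t| ^ (-γ)) := by
          refine lintegral_lintegral_swap (Measurable.aemeasurable ?_)
          exact hmeas.mul (by fun_prop)
      _ ≤ ∫⁻ β in Set.Ioc 0 (f s), Ck * v β ^ (1 - γ) := by
          refine lintegral_mono fun β => ?_
          have hm : MeasurableSet {t | β < f t} := measurableSet_lt measurable_const hf
          refine le_trans (le_of_eq ?_) (setLIntegral_kernel_le h0 h1 _ s)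
          rw [← lintegral_indicator hm]
          congr 1; ext t
          by_cases h : t ∈ {t | β < f t}
          · rw [Set.indicator_of_mem h, Set.indicator_of_mem h, Pi.one_apply, one_mul]
          · rw [Set.indicator_of_notMem h, Set.indicator_of_notMem h, zero_mul]
      _ = Ck * ∫⁻ β in Set.Ioc 0 (f s), v β ^ (1 - γ) := lintegral_const_mul' _ _ ENNReal.ofReal_ne_top
      _ ≤ _ := by
          gcongr
          refine (setLIntegral_rpow_le h0 h1 hvm (hf0 s)).trans ?_
          gcongr
  set K : ℝ → ℝ → ℝ≥0∞ := fun s t => ENNReal.ofReal (f s) * ENNReal.ofReal (f t) * ENNReal.ofReal (|s - t| ^ (-γ)) with hK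
  have hKm : Measurable (Function.uncurry K) := by simp only [hK]; fun_prop
  have hKs : ∀ s t, K s t = K t s := fun s t => by simp only [hK, abs_sub_comm s t]; ring
  set S : Set (ℝ × ℝ) := {z | f z.2 ≤ f z.1}
  have hS : MeasurableSet S := measurableSet_le (hf.comp measurable_snd) (hf.comp measurable_fst)
  set J : ℝ × ℝ → ℝ≥0∞ := S.indicator (Function.uncurry K)
  have hJm : Measurable J := hKm.indicator hS
  have hKJ : ∀ s t, K s t ≤ J (s, t) + J (t, s) := by
    intro s t
    rcases le_total (f t) (f s) with h | h
    · refine le_add_right (le_of_eq ?_)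
      exact (Set.indicator_of_mem (show (s, t) ∈ S from h) (Function.uncurry K)).symm
    · refine le_add_left (le_of_eq ?_)
      exact (hKs s t).trans (Set.indicator_of_mem (show (t, s) ∈ S from h) (Function.uncurry K)).symm
  have hJ : ∫⁻ s, ∫⁻ t, J (s, t) ≤ Ck * Ch * B ^ (2 - γ) := by
    calc ∫⁻ s, ∫⁻ t, J (s, t) ≤ ∫⁻ s, (Ck * Ch * B ^ (1 - γ)) * ENNReal.ofReal (f s ^ r) := by
          refine lintegral_mono fun s => ?_
          have hSs : MeasurableSet {t | f t ≤ f s} := measurableSet_le hf measurable_const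
          calc ∫⁻ t, J (s, t) = ∫⁻ t in {t | f t ≤ f s}, ENNReal.ofReal (f s) * (ENNReal.ofReal (f t) * ENNReal.ofReal (|s - t| ^ (-γ))) := by
                rw [← lintegral_indicator hSs]
                congr 1; ext t
                simp only [J, S, Set.indicator, Set.mem_ofPred_eq, Function.uncurry, hK, mul_assoc]
            _ = ENNReal.ofReal (f s) * ∫⁻ t in {t | f t ≤ f s}, (ENNReal.ofReal (f t) * ENNReal.ofReal (|s - t| ^ (-γ))) :=
                lintegral_const_mul' _ _ ENNReal.ofReal_ne_top
            _ ≤ ENNReal.ofReal (f s) * (Ck * (Ch * B ^ (1 - γ) * ENNReal.ofReal (f s ^ (r - 1)))) := by gcongr; exact hin s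
            _ = (Ck * Ch * B ^ (1 - γ)) * (ENNReal.ofReal (f s) * ENNReal.ofReal (f s ^ (r - 1))) := by ring
            _ = _ := by
                rw [← ENNReal.ofReal_mul (hf0 s)]
                congr 2
                rcases (hf0 s).eq_or_lt with h | h
                · rw [← h, Real.zero_rpow hr0.ne', zero_mul]
                · rw [Real.rpow_sub_one h.ne']; field_simp
      _ = (Ck * Ch * B ^ (1 - γ)) * B := by rw [lintegral_const_mul _ (by fun_prop)]
      _ = _ := by
          rw [mul_assoc]; congr 1
          nth_rewrite 2 [← ENNReal.rpow_one B]
          rw [← ENNReal.rpow_add_of_nonneg _ _ hg.le zero_le_one]; congr 1; ring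
  calc ∫⁻ s, ∫⁻ t, K s t ≤ ∫⁻ s, ∫⁻ t, (J (s, t) + J (t, s)) := lintegral_mono fun s => lintegral_mono fun t => hKJ s t
    _ = (∫⁻ s, ∫⁻ t, J (s, t)) + ∫⁻ s, ∫⁻ t, J (t, s) := by
        rw [← lintegral_add_left hJm.lintegral_prod_right']
        refine lintegral_congr fun s => ?_
        exact lintegral_add_left (hJm.comp measurable_prodMk_left) _
    _ = (∫⁻ s, ∫⁻ t, J (s, t)) + ∫⁻ s, ∫⁻ t, J (s, t) := by
        congr 1
        exact lintegral_lintegral_swap (f := fun s t => J (t, s)) (hJm.comp measurable_swap).aemeasurable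
    _ ≤ Ck * Ch * B ^ (2 - γ) + Ck * Ch * B ^ (2 - γ) := add_le_add hJ hJ
    _ = _ := by ring

end HLS

section Strichartz

variable {V : Type*} [NormedAddCommGroup V] [InnerProductSpace ℝ V] [FiniteDimensional ℝ V]
  [MeasurableSpace V] [BorelSpace V]

theorem disp_rpow_le {p q : ℝ} (hp : 2 < p) (hq : 2 < q)
    (hpq : 2 / p = Module.finrank ℝ V * (1 / 2 - 1 / q)) (t : ℝ) :
    disp V t ^ (2 / (q / (q - 1)) - 1) ≤ |t| ^ (-(2 / p)) := by
  have h1 : 0 ≤ 4 * Real.pi * |t| := by positivity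
  rw [disp, ← Real.rpow_mul h1]
  have e : -(Module.finrank ℝ V : ℝ) / 2 * (2 / (q / (q - 1)) - 1) = -(2 / p) := by
    rw [hpq]; field_simp; ring
  rw [e, Real.mul_rpow (by positivity) (abs_nonneg _)]
  refine mul_le_of_le_one_left (by positivity) (Real.rpow_le_one_of_one_le_of_nonpos ?_ ?_)
  · nlinarith [Real.pi_gt_three]
  · rw [neg_nonpos]; positivity

theorem aestronglyMeasurable_U {G : ℝ → L2 V} {μ : Measure ℝ} (hG : AEStronglyMeasurable G μ) {τ : ℝ → ℝ} (hτ : Continuous τ) :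
    AEStronglyMeasurable (fun t => U (τ t) (G t)) μ :=
  Continuous.comp_aestronglyMeasurable (g := fun z : ℝ × L2 V => U z.1 z.2) (f := fun t => (τ t, G t)) continuous_U
    (hτ.aestronglyMeasurable.prodMk hG)

/-- The dual Strichartz estimate. -/
theorem dual_strichartz {p q : ℝ} (hp : 2 < p) (hq : 2 < q)
    (hpq : 2 / p = Module.finrank ℝ V * (1 / 2 - 1 / q)) : ∃ C : ℝ≥0∞, C ≠ ⊤ ∧
    ∀ (G : ℝ → L2 V) (b : ℝ → ℝ), Integrable G → Measurable b → (∀ t, 0 ≤ b t) →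
      (∀ t, eLpNorm (G t) (ENNReal.ofReal (q / (q - 1))) volume ≤ ENNReal.ofReal (b t)) →
      ENNReal.ofReal (‖∫ t, U (-t) (G t)‖ ^ 2) ≤
        C * (∫⁻ t, ENNReal.ofReal (b t ^ (2 / (2 - 2 / p)))) ^ (2 - 2 / p) := by
  have hγ0 : 0 < 2 / p := by positivity
  have hγ1 : 2 / p < 1 := by rw [div_lt_one (by linarith)]; exact hp
  have hr1 : 1 < q / (q - 1) := by rw [lt_div_iff₀ (by linarith)]; linarith
  have hr2 : q / (q - 1) ≤ 2 := by rw [div_le_iff₀ (by linarith)]; linarith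
  obtain ⟨C, hC, h⟩ := hls hγ0 hγ1
  refine ⟨C, hC, fun G b hG hb hb0 hGb => (le_trans ?_ (h b hb hb0))⟩
  set W : ℝ → L2 V := fun t => U (-t) (G t) with hW
  have hWi : Integrable W := by
    refine (integrable_norm_iff (aestronglyMeasurable_U hG.1 continuous_neg)).1 ?_
    simp only [LinearIsometryEquiv.norm_map]
    exact hG.norm
  have e1 : ((‖∫ t, W t‖ ^ 2 : ℝ) : ℂ) = ∫ s, ∫ t, inner ℂ (W s) (W t) := by
    have := inner_self_eq_norm_sq_to_K (𝕜 := ℂ) (∫ t, W t)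
    push_cast
    refine this.symm.trans ?_
    rw [← inner_conj_symm, ← integral_inner hWi, ← integral_conj]
    simp only [inner_conj_symm, integral_inner hWi]
  have e2 : ENNReal.ofReal (‖∫ t, W t‖ ^ 2) = ‖∫ s, ∫ t, inner ℂ (W s) (W t)‖ₑ := by
    rw [← e1, ← ofReal_norm, Complex.norm_real, Real.norm_of_nonneg (sq_nonneg _)]
  rw [e2]
  refine (enorm_integral_le_lintegral_enorm _).trans (lintegral_mono fun s => ?_)
  refine (enorm_integral_le_lintegral_enorm _).trans (lintegral_mono_ae ?_)
  have hne : ∀ᵐ t : ℝ, t ≠ s := by simp [ae_iff]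
  filter_upwards [hne] with t hts
  have hin : inner ℂ (W s) (W t) = inner ℂ (U (t - s) (G s)) (G t) := by
    simp only [hW]
    rw [show U (-t) (G t) = U (-t) (G t) from rfl, ← inner_U_left t, U_add, sub_eq_add_neg]
  have hmem : ∀ t, MemLp (G t) (ENNReal.ofReal (q / (q - 1))) := fun t =>
    ⟨Lp.aestronglyMeasurable _, (hGb t).trans_lt ENNReal.ofReal_lt_top⟩
  have hto : ∀ t, (eLpNorm (G t) (ENNReal.ofReal (q / (q - 1))) volume).toReal ≤ b t := fun t =>
    ENNReal.toReal_le_of_le_ofReal (hb0 t) (hGb t)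
  rw [hin, ← ofReal_norm, ← ENNReal.ofReal_mul (hb0 s), ← ENNReal.ofReal_mul (mul_nonneg (hb0 s) (hb0 t))]
  refine ENNReal.ofReal_le_ofReal ((norm_inner_U_le (sub_ne_zero.2 hts) _ _ hr1 hr2 (hmem s) (hmem t)).trans ?_)
  rw [mul_comm, abs_sub_comm]
  have := disp_rpow_le (V := V) hp hq hpq (t - s)
  have h1 := hto s
  have h2 := hto t
  have h3 := Real.rpow_nonneg (disp_nonneg (V := V) (t - s)) (2 / (q / (q - 1)) - 1)
  have h4 := hb0 s
  have h5 := hb0 t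
  gcongr

theorem memLp_indicator_compact {K : Set V} (hK : IsCompact K) {h : V → ℂ} (hh : Continuous h) :
    MemLp (K.indicator h) 2 volume := by
  obtain ⟨M, hM⟩ := hK.exists_bound_of_continuousOn hh.continuousOn
  refine (memLp_indicator_iff_restrict hK.measurableSet).2 ?_
  have : IsFiniteMeasure (volume.restrict K) := ⟨by simpa using hK.measure_lt_top⟩
  exact MemLp.of_bound hh.aestronglyMeasurable M ((ae_restrict_mem hK.measurableSet).mono hM)

theorem memLp_indicator_slice {K : Set V} (hK : IsCompact K) {h : ℝ → V → ℂ} (hh : Continuous (Function.uncurry h)) (t : ℝ) :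
    MemLp (K.indicator (h t)) 2 volume :=
  memLp_indicator_compact hK (hh.comp (Continuous.prodMk_right t))

theorem norm_sq_L2 (f : L2 V) : ‖f‖ ^ 2 = ∫ x, ‖f x‖ ^ 2 := by
  have h := inner_self_eq_norm_sq_to_K (𝕜 := ℂ) f
  rw [MeasureTheory.L2.inner_def] at h
  have h2 : ((‖f‖ ^ 2 : ℝ) : ℂ) = ((∫ x, ‖f x‖ ^ 2 : ℝ) : ℂ) := by
    rw [← integral_complex_ofReal]
    push_cast
    refine h.symm.trans (integral_congr_ae (Eventually.of_forall fun x => ?_))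
    exact inner_self_eq_norm_sq_to_K (𝕜 := ℂ) (f x)
  exact_mod_cast h2

theorem continuous_toLp_indicator {K : Set V} (hK : IsCompact K) {h : ℝ → V → ℂ} (hh : Continuous (Function.uncurry h)) :
    Continuous (fun t => (memLp_indicator_slice hK hh t).toLp (K.indicator (h t))) := by
  rw [continuous_iff_continuousAt]
  intro t₀
  rw [ContinuousAt, tendsto_iff_norm_sub_tendsto_zero]
  have hc : Continuous (fun t => ∫ x in K, ‖h t x - h t₀ x‖ ^ 2) := by
    refine continuous_parametric_integral_of_continuous ?_ hK
    have h1 : Continuous fun z : ℝ × V => h t₀ z.2 := hh.comp (Continuous.prodMk continuous_const continuous_snd)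
    have h2 : Continuous fun z : ℝ × V => h z.1 z.2 := hh
    exact ((h2.sub h1).norm.pow 2)
  have h1 := (hc.tendsto t₀).sqrt
  simp only [sub_self, norm_zero, ne_eq, OfNat.ofNat_ne_zero, not_false_eq_true, zero_pow, integral_zero, Real.sqrt_zero] at h1
  refine h1.congr fun t => ?_
  rw [← Real.sqrt_sq (norm_nonneg (_ - _)), ← MemLp.toLp_sub, norm_sq_L2]
  congr 1
  rw [← integral_indicator hK.measurableSet]
  refine integral_congr_ae ?_
  filter_upwards [((memLp_indicator_slice hK hh t).sub
    (memLp_indicator_slice hK hh t₀)).coeFn_toLp] with x hx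
  by_cases hxK : x ∈ K
  · rw [hx]; simp [hxK]
  · rw [hx]; simp [hxK]
end Strichartz

section StrichartzSchwartz

variable {V : Type*} [NormedAddCommGroup V] [InnerProductSpace ℝ V] [FiniteDimensional ℝ V]
  [MeasurableSpace V] [BorelSpace V]

/-- The `L^q` norm of the free evolution over a set. -/
noncomputable def locN (q : ℝ) (K : Set V) (φ : 𝓢(V, ℂ)) (t : ℝ) : ℝ := (∫ x in K, ‖uS t φ x‖ ^ q) ^ (1 / q)

theorem continuous_locN {q : ℝ} (hq : 2 < q) {K : Set V} (hK : IsCompact K) (φ : 𝓢(V, ℂ)) : Continuous (locN q K φ) := by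
  refine Continuous.rpow_const ?_ fun t => Or.inr (by positivity)
  refine continuous_parametric_integral_of_continuous ?_ hK
  exact ((continuous_uS_apply φ).norm.rpow_const fun _ => Or.inr (by linarith))

theorem locN_nonneg (q : ℝ) (K : Set V) (φ : 𝓢(V, ℂ)) (t : ℝ) : 0 ≤ locN q K φ t :=
  Real.rpow_nonneg (integral_nonneg fun _ => by positivity) _

theorem locN_rpow {q : ℝ} (hq : 2 < q) (K : Set V) (φ : 𝓢(V, ℂ)) (t : ℝ) :
    locN q K φ t ^ q = ∫ x in K, ‖uS t φ x‖ ^ q := by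
  rw [locN, ← Real.rpow_mul (integral_nonneg fun _ => by positivity), one_div_mul_cancel (by linarith), Real.rpow_one]

theorem integrableOn_rpow {q : ℝ} (hq : 2 < q) {K : Set V} (hK : IsCompact K) (φ : 𝓢(V, ℂ)) (t : ℝ) :
    IntegrableOn (fun x => ‖uS t φ x‖ ^ q) K :=
  ((uS t φ).continuous.norm.rpow_const fun _ => Or.inr (by linarith)).continuousOn.integrableOn_compact hK

/-- The `L^{q'}` dual function of the free evolution. -/
noncomputable def dualFun (q : ℝ) (φ : 𝓢(V, ℂ)) (t : ℝ) (x : V) : ℂ := ((‖uS t φ x‖ ^ (q - 2) : ℝ) : ℂ) * uS t φ x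

theorem continuous_dualFun {q : ℝ} (hq : 2 < q) (φ : 𝓢(V, ℂ)) : Continuous (Function.uncurry (dualFun q φ)) := by
  have h := continuous_uS_apply φ
  exact (Complex.continuous_ofReal.comp (h.norm.rpow_const fun _ => Or.inr (by linarith))).mul h

theorem norm_dualFun {q : ℝ} (hq : 2 < q) (φ : 𝓢(V, ℂ)) (t : ℝ) (x : V) : ‖dualFun q φ t x‖ = ‖uS t φ x‖ ^ (q - 1) := by
  rw [dualFun, norm_mul, Complex.norm_real, Real.norm_of_nonneg (by positivity)]
  rcases (norm_nonneg (uS t φ x)).eq_or_lt with h | h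
  · rw [← h, mul_zero, Real.zero_rpow (by linarith)]
  · rw [show q - 1 = (q - 2) + 1 by ring, Real.rpow_add_one h.ne']

theorem conj_dualFun_mul {q : ℝ} (hq : 2 < q) (φ : 𝓢(V, ℂ)) (t : ℝ) (x : V) :
    conj (dualFun q φ t x) * uS t φ x = ((‖uS t φ x‖ ^ q : ℝ) : ℂ) := by
  rw [dualFun, map_mul, Complex.conj_ofReal, mul_assoc, Complex.conj_mul', ← Complex.ofReal_pow, ← Complex.ofReal_mul]
  congr 1
  rcases (norm_nonneg (uS t φ x)).eq_or_lt with h | h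
  · rw [← h, Real.zero_rpow (sub_pos.2 hq).ne', Real.zero_rpow (by positivity)]; simp
  · rw [← Real.rpow_natCast, ← Real.rpow_add h]; congr 1; push_cast; ring

theorem eLpNorm_dualFun {q : ℝ} (hq : 2 < q) {K : Set V} (hK : IsCompact K) (φ : 𝓢(V, ℂ)) (t : ℝ) :
    eLpNorm (K.indicator (dualFun q φ t)) (ENNReal.ofReal (q / (q - 1))) volume = ENNReal.ofReal (locN q K φ t ^ (q - 1)) := by
  have hq1 : 0 < q - 1 := by linarith
  have hr : 0 < q / (q - 1) := by positivity
  rw [eLpNorm_indicator_eq_eLpNorm_restrict hK.measurableSet,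
    eLpNorm_eq_lintegral_rpow_enorm_toReal (by simpa using hr) ENNReal.ofReal_ne_top, ENNReal.toReal_ofReal hr.le]
  have e : ∀ x, ‖dualFun q φ t x‖ₑ ^ (q / (q - 1)) = ENNReal.ofReal (‖uS t φ x‖ ^ q) := by
    intro x
    rw [← ofReal_norm, norm_dualFun hq, ENNReal.ofReal_rpow_of_nonneg (by positivity) hr.le, ← Real.rpow_mul (norm_nonneg _)]
    congr 2; field_simp
  simp_rw [e]
  rw [← ofReal_integral_eq_lintegral_ofReal (integrableOn_rpow hq hK φ t) (Eventually.of_forall fun x => by positivity),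
    ← locN_rpow hq, ENNReal.ofReal_rpow_of_nonneg (Real.rpow_nonneg (locN_nonneg ..) _) (by positivity), ← Real.rpow_mul (locN_nonneg ..)]
  congr 2; field_simp

theorem strichartz_truncated {p q : ℝ} (hp : 2 < p) (hq : 2 < q)
    (hpq : 2 / p = Module.finrank ℝ V * (1 / 2 - 1 / q)) : ∃ C : ℝ, 0 ≤ C ∧
    ∀ (φ : 𝓢(V, ℂ)) (K : Set V) (T : Set ℝ), IsCompact K → IsCompact T → (∀ t ∈ T, 0 < locN q K φ t) →
      ∫ t in T, locN q K φ t ^ p ≤ (C * ‖φ.toLp 2 (volume : Measure V)‖ ^ 2) ^ (p / 2) := by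
  obtain ⟨C, hC, hdual⟩ := dual_strichartz (V := V) hp hq hpq
  refine ⟨C.toReal, ENNReal.toReal_nonneg, fun φ K T hK hT hpos => ?_⟩
  set N := locN q K φ with hN
  have hNc : Continuous N := continuous_locN hq hK φ
  have hN0 : ∀ t, 0 ≤ N t := locN_nonneg q K φ
  set H : ℝ → L2 V := fun t => (memLp_indicator_slice hK (continuous_dualFun hq φ) t).toLp (K.indicator (dualFun q φ t)) with hH
  have hHc : Continuous H := continuous_toLp_indicator hK (continuous_dualFun hq φ)
  set c : ℝ → ℂ := fun t => ((N t ^ (p - q) : ℝ) : ℂ) with hc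
  have hcc : ContinuousOn c T := by
    refine Complex.continuous_ofReal.comp_continuousOn (hNc.continuousOn.rpow_const fun t ht => Or.inl (hpos t ht).ne')
  set G : ℝ → L2 V := T.indicator (fun t => c t • H t) with hG
  set b : ℝ → ℝ := T.indicator (fun t => N t ^ (p - 1)) with hb
  set S := ∫ t in T, N t ^ p with hS
  have hS0 : 0 ≤ S := integral_nonneg fun t => Real.rpow_nonneg (hN0 t) _
  have hpi : IntegrableOn (fun t => N t ^ p) T :=
    (hNc.rpow_const fun _ => Or.inr (by linarith)).continuousOn.integrableOn_compact hT
  have hGi : Integrable G := (integrable_indicator_iff hT.measurableSet).2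
    ((hcc.smul hHc.continuousOn).integrableOn_compact hT)
  have hbm : Measurable b := Measurable.indicator ((hNc.rpow_const fun _ => Or.inr (by linarith)).measurable) hT.measurableSet
  have hb0 : ∀ t, 0 ≤ b t := fun t => Set.indicator_nonneg (fun t _ => Real.rpow_nonneg (hN0 t) _) t
  have hGb : ∀ t, eLpNorm (G t) (ENNReal.ofReal (q / (q - 1))) volume ≤ ENNReal.ofReal (b t) := by
    intro t
    by_cases ht : t ∈ T
    · simp only [hG, hb, Set.indicator_of_mem ht]
      rw [eLpNorm_congr_ae (Lp.coeFn_smul (c t) (H t)), eLpNorm_const_smul, eLpNorm_congr_ae (MemLp.coeFn_toLp _),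
        eLpNorm_dualFun hq hK, ← ofReal_norm, Complex.norm_real, Real.norm_of_nonneg (Real.rpow_nonneg (hN0 t) _),
        ← ENNReal.ofReal_mul (Real.rpow_nonneg (hN0 t) _), ← Real.rpow_add (hpos t ht)]
      refine ENNReal.ofReal_le_ofReal (le_of_eq ?_)
      congr 1; ring
    · simp only [hG, hb, Set.indicator_of_notMem ht]
      rw [eLpNorm_congr_ae (Lp.coeFn_zero ℂ 2 (volume : Measure V)), eLpNorm_zero]
      exact zero_le
  have hD := hdual G b hGi hbm hb0 hGb
  set I := ∫ t, U (-t) (G t) with hI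
  have hWi : Integrable (fun t => U (-t) (G t)) := by
    refine (integrable_norm_iff (aestronglyMeasurable_U hGi.1 continuous_neg)).1 ?_
    simp only [LinearIsometryEquiv.norm_map]
    exact hGi.norm
  have hin : inner ℂ (φ.toLp 2 (volume : Measure V)) I = (S : ℂ) := by
    rw [hI, ← integral_inner hWi, hS, ← integral_indicator hT.measurableSet, ← integral_complex_ofReal]
    refine integral_congr_ae (Eventually.of_forall fun t => ?_)
    simp only
    rw [← inner_U_left, U_toLp]
    by_cases ht : t ∈ T
    · simp only [hG, Set.indicator_of_mem ht]
      rw [inner_smul_right, ← inner_conj_symm, MeasureTheory.L2.inner_def]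
      have : ∫ x, inner ℂ (H t x) ((uS t φ).toLp 2 (volume : Measure V) x) = ((N t ^ q : ℝ) : ℂ) := by
        rw [hN, locN_rpow hq, ← integral_complex_ofReal, ← integral_indicator hK.measurableSet]
        refine integral_congr_ae ?_
        filter_upwards [(memLp_indicator_slice hK (continuous_dualFun hq φ) t).coeFn_toLp, (uS t φ).coeFn_toLp 2 volume] with x hx hx2
        rw [hx2, RCLike.inner_apply', hH, hx]
        by_cases hxK : x ∈ K
        · rw [Set.indicator_of_mem hxK, Set.indicator_of_mem hxK]
          exact conj_dualFun_mul hq φ t x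
        · rw [Set.indicator_of_notMem hxK, Set.indicator_of_notMem hxK, map_zero, zero_mul]
      rw [this, Complex.conj_ofReal, hc]
      simp only
      rw [← Complex.ofReal_mul, ← Real.rpow_add (hpos t ht)]
      congr 2; ring
    · simp only [hG, Set.indicator_of_notMem ht, inner_zero_right, Complex.ofReal_zero]
  have h1 : S ≤ ‖φ.toLp 2 (volume : Measure V)‖ * ‖I‖ := by
    have := norm_inner_le_norm (𝕜 := ℂ) (φ.toLp 2 (volume : Measure V)) I
    rwa [hin, Complex.norm_real, Real.norm_of_nonneg hS0] at this
  have h2 : ‖I‖ ^ 2 ≤ C.toReal * S ^ (2 - 2 / p) := by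
    have e : ∫⁻ t, ENNReal.ofReal (b t ^ (2 / (2 - 2 / p))) = ENNReal.ofReal S := by
      rw [hS, ofReal_integral_eq_lintegral_ofReal hpi (Eventually.of_forall fun t => Real.rpow_nonneg (hN0 t) _),
        ← lintegral_indicator hT.measurableSet]
      refine lintegral_congr fun t => ?_
      have hp1 : 0 < p - 1 := by linarith
      have h22 : 2 - 2 / p = 2 * (p - 1) / p := by field_simp
      by_cases ht : t ∈ T
      · simp only [hb, Set.indicator_of_mem ht]
        rw [← Real.rpow_mul (hN0 t), h22]
        congr 2; field_simp
      · simp only [hb, Set.indicator_of_notMem ht]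
        rw [Real.zero_rpow, ENNReal.ofReal_zero]
        rw [h22]; positivity
    have hpp : 0 ≤ 2 - 2 / p := by
      have : 2 / p ≤ 1 := by rw [div_le_one (by linarith)]; linarith
      linarith
    rw [e, ENNReal.ofReal_rpow_of_nonneg hS0 hpp, ← ENNReal.ofReal_toReal hC, ← ENNReal.ofReal_mul ENNReal.toReal_nonneg,
      ENNReal.ofReal_le_ofReal_iff (mul_nonneg ENNReal.toReal_nonneg (Real.rpow_nonneg hS0 _))] at hD
    exact hD
  rcases hS0.eq_or_lt with h0 | h0
  · rw [← h0]; positivity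
  have h3 : S ^ 2 ≤ ‖φ.toLp 2 (volume : Measure V)‖ ^ 2 * (C.toReal * S ^ (2 - 2 / p)) := by
    calc S ^ 2 ≤ (‖φ.toLp 2 (volume : Measure V)‖ * ‖I‖) ^ 2 := by gcongr
      _ ≤ _ := by rw [mul_pow]; gcongr
  have h4 : S ^ (2 / p) ≤ C.toReal * ‖φ.toLp 2 (volume : Measure V)‖ ^ 2 := by
    have h5 : S ^ 2 = S ^ (2 / p) * S ^ (2 - 2 / p) := by
      rw [← Real.rpow_add h0, ← Real.rpow_natCast]; congr 1; push_cast; ring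
    have h6 : 0 < S ^ (2 - 2 / p) := Real.rpow_pos_of_pos h0 _
    rw [h5] at h3
    nlinarith
  calc S = (S ^ (2 / p)) ^ (p / 2) := by
        rw [← Real.rpow_mul hS0, div_mul_div_cancel₀ (by linarith), div_self two_ne_zero, Real.rpow_one]
    _ ≤ _ := by gcongr

end StrichartzSchwartz

section StrichartzHomogeneous

variable {V : Type*} [NormedAddCommGroup V] [InnerProductSpace ℝ V] [FiniteDimensional ℝ V]
  [MeasurableSpace V] [BorelSpace V]

theorem lowerSemicontinuous_eLpNorm (q : ℝ≥0∞) : LowerSemicontinuous fun g : L2 V => eLpNorm g q (volume : Measure V) := by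
  rw [lowerSemicontinuous_iff_isClosed_preimage]
  refine fun c => IsSeqClosed.isClosed fun g f hg hgf => ?_
  obtain ⟨ns, -, hns⟩ := (tendstoInMeasure_of_tendsto_Lp hgf).exists_seq_tendsto_ae
  refine (Lp.eLpNorm_lim_le_liminf_eLpNorm (fun n => (Lp.aestronglyMeasurable (g (ns n)))) f hns).trans ?_
  refine (liminf_le_liminf (v := fun _ => c) (Eventually.of_forall fun n => hg (ns n))).trans ?_
  simp

theorem eLpNorm_rpow_le_liminf (q : ℝ≥0∞) {p : ℝ} (hp : 0 ≤ p) {g : ℕ → L2 V} {f : L2 V} (h : Tendsto g atTop (𝓝 f)) :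
    eLpNorm f q (volume : Measure V) ^ p ≤ liminf (fun n => eLpNorm (g n) q (volume : Measure V) ^ p) atTop := by
  have hl : LowerSemicontinuous fun f : L2 V => eLpNorm f q (volume : Measure V) ^ p :=
    ENNReal.continuous_rpow_const.comp_lowerSemicontinuous (lowerSemicontinuous_eLpNorm q)
      (ENNReal.monotone_rpow_of_nonneg hp)
  exact (lowerSemicontinuousAt_iff_le_liminf.1 (hl f)).trans (liminf_le_liminf_of_le h)

theorem measurable_eLpNorm_U (q : ℝ≥0∞) {G : ℝ → L2 V} (hG : Continuous G) :
    Measurable fun t => eLpNorm (G t) q (volume : Measure V) :=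
  ((lowerSemicontinuous_eLpNorm q).comp hG).measurable

theorem ofReal_locN {q : ℝ} (hq : 2 < q) {K : Set V} (hK : IsCompact K) (φ : 𝓢(V, ℂ)) (t : ℝ) :
    ENNReal.ofReal (locN q K φ t) = (∫⁻ x in K, ‖uS t φ x‖ₑ ^ q) ^ (1 / q) := by
  have hq0 : 0 < q := by linarith
  rw [locN, ← ENNReal.ofReal_rpow_of_nonneg (integral_nonneg fun _ => by positivity) (by positivity),
    ofReal_integral_eq_lintegral_ofReal (integrableOn_rpow hq hK φ t) (Eventually.of_forall fun x => by positivity)]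
  congr 1
  refine lintegral_congr fun x => ?_
  rw [← ENNReal.ofReal_rpow_of_nonneg (norm_nonneg _) hq0.le, ofReal_norm]

theorem tendsto_locN {q : ℝ} (hq : 2 < q) (φ : 𝓢(V, ℂ)) (t : ℝ) :
    Tendsto (fun k : ℕ => ENNReal.ofReal (locN q (Metric.closedBall 0 k) φ t)) atTop
      (𝓝 (eLpNorm (uS t φ) (ENNReal.ofReal q) volume)) := by
  have hq0 : 0 < q := by linarith
  rw [eLpNorm_eq_lintegral_rpow_enorm_toReal (by simpa using hq0) ENNReal.ofReal_ne_top, ENNReal.toReal_ofReal hq0.le]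
  simp_rw [ofReal_locN hq (isCompact_closedBall _ _)]
  refine (ENNReal.continuous_rpow_const.tendsto _).comp ?_
  exact (aecover_closedBall (x := (0 : V)) tendsto_natCast_atTop_atTop).lintegral_tendsto_of_countably_generated
    ((uS t φ).continuous.enorm.measurable.pow_const q).aemeasurable

theorem strichartz_schwartz {p q : ℝ} (hp : 2 < p) (hq : 2 < q)
    (hpq : 2 / p = Module.finrank ℝ V * (1 / 2 - 1 / q)) : ∃ C : ℝ, 0 ≤ C ∧ ∀ φ : 𝓢(V, ℂ),
      ∫⁻ t : ℝ, eLpNorm (uS t φ) (ENNReal.ofReal q) volume ^ p ≤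
        ENNReal.ofReal ((C * ‖φ.toLp 2 (volume : Measure V)‖ ^ 2) ^ (p / 2)) := by
  obtain ⟨C, hC, h⟩ := strichartz_truncated (V := V) hp hq hpq
  refine ⟨C, hC, fun φ => ?_⟩
  set N : ℕ → ℝ → ℝ := fun k => locN q (Metric.closedBall 0 k) φ with hN
  have hNc : ∀ k, Continuous (N k) := fun k => continuous_locN hq (isCompact_closedBall _ _) φ
  have hN0 : ∀ k t, 0 ≤ N k t := fun k t => locN_nonneg ..
  have hp0 : 0 < p := by linarith
  set T : ℕ → Set ℝ := fun k => Set.Icc (-(k : ℝ)) k ∩ {t | 1 / ((k : ℝ) + 1) ≤ N k t} with hT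
  have hTc : ∀ k, IsCompact (T k) := fun k => isCompact_Icc.inter_right (isClosed_le continuous_const (hNc k))
  have hk : ∀ k, ∫⁻ t, (T k).indicator (fun t => ENNReal.ofReal (N k t) ^ p) t ≤
      ENNReal.ofReal ((C * ‖φ.toLp 2 (volume : Measure V)‖ ^ 2) ^ (p / 2)) := by
    intro k
    have := h φ _ _ (isCompact_closedBall 0 (k : ℝ)) (hTc k) fun t ht => lt_of_lt_of_le (by positivity) ht.2
    refine le_trans (le_of_eq ?_) (ENNReal.ofReal_le_ofReal this)
    rw [lintegral_indicator (hTc k).measurableSet, ofReal_integral_eq_lintegral_ofReal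
      (((hNc k).rpow_const fun _ => Or.inr hp0.le).continuousOn.integrableOn_compact (hTc k))
      (Eventually.of_forall fun t => Real.rpow_nonneg (hN0 k t) _)]
    exact lintegral_congr fun t => ENNReal.ofReal_rpow_of_nonneg (hN0 k t) hp0.le
  have hlim : ∀ t, eLpNorm (uS t φ) (ENNReal.ofReal q) volume ^ p ≤
      liminf (fun k => (T k).indicator (fun t => ENNReal.ofReal (N k t) ^ p) t) atTop := by
    intro t
    have ht := tendsto_locN hq φ t
    rcases (zero_le (a := eLpNorm (uS t φ) (ENNReal.ofReal q) volume)).eq_or_lt with h0 | h0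
    · rw [← h0, ENNReal.zero_rpow_of_pos hp0]; exact zero_le
    have hev : ∀ᶠ k : ℕ in atTop, t ∈ T k := by
      obtain ⟨ε, hε, hε2⟩ := ENNReal.lt_iff_exists_real_btwn.1 h0
      have hε0 : 0 < ε := ENNReal.ofReal_pos.1 hε2.1
      have e1 := ht.eventually_const_lt hε2.2
      have e2 : ∀ᶠ k : ℕ in atTop, 1 / ((k : ℝ) + 1) < ε := tendsto_one_div_add_atTop_nhds_zero_nat.eventually_lt_const hε0
      have e3 : ∀ᶠ k : ℕ in atTop, |t| ≤ (k : ℝ) := tendsto_natCast_atTop_atTop.eventually_ge_atTop _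
      filter_upwards [e1, e2, e3] with k h1 h2 h3
      exact ⟨abs_le.1 h3, h2.le.trans ((ENNReal.ofReal_lt_ofReal_iff_of_nonneg hε).1 h1).le⟩
    refine le_of_eq (Tendsto.liminf_eq ?_).symm
    refine Tendsto.congr' ?_ ((ENNReal.continuous_rpow_const.tendsto _).comp ht)
    filter_upwards [hev] with k hk
    rw [Set.indicator_of_mem hk]; rfl
  refine (lintegral_mono hlim).trans ((lintegral_liminf_le fun k => ?_).trans ?_)
  · exact (((hNc k).measurable.ennreal_ofReal).pow_const p).indicator (hTc k).measurableSet
  · refine (liminf_le_liminf (Eventually.of_forall hk)).trans ?_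
    simp

/-- Homogeneous Strichartz estimate away from the endpoint. -/
theorem strichartz {p q : ℝ} (hp : 2 < p) (hq : 2 < q)
    (hpq : 2 / p = Module.finrank ℝ V * (1 / 2 - 1 / q)) : ∃ C : ℝ≥0∞, C ≠ ⊤ ∧ ∀ f : L2 V,
      (∫⁻ t : ℝ, eLpNorm (U t f) (ENNReal.ofReal q) volume ^ p) ^ (1 / p) ≤ C * ‖f‖ₑ := by
  obtain ⟨C, hC, h⟩ := strichartz_schwartz (V := V) hp hq hpq
  have hp0 : 0 < p := by linarith
  refine ⟨ENNReal.ofReal (C ^ (1 / 2 : ℝ)), ENNReal.ofReal_ne_top, fun f => ?_⟩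
  have hS : ∀ φ : 𝓢(V, ℂ), ∫⁻ t : ℝ, eLpNorm (U t (φ.toLp 2 (volume : Measure V))) (ENNReal.ofReal q) volume ^ p ≤
        ENNReal.ofReal ((C * ‖φ.toLp 2 (volume : Measure V)‖ ^ 2) ^ (p / 2)) := by
    intro φ
    refine le_trans (le_of_eq (lintegral_congr fun t => ?_)) (h φ)
    rw [U_toLp, eLpNorm_congr_ae ((uS t φ).coeFn_toLp 2 volume)]
  have hL : ∫⁻ t : ℝ, eLpNorm (U t f) (ENNReal.ofReal q) volume ^ p ≤ ENNReal.ofReal ((C * ‖f‖ ^ 2) ^ (p / 2)) := by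
    refine dense_toLp (P := fun f : L2 V => ∫⁻ t : ℝ, eLpNorm (U t f) (ENNReal.ofReal q) volume ^ p ≤
      ENNReal.ofReal ((C * ‖f‖ ^ 2) ^ (p / 2))) ?_ hS f
    refine IsSeqClosed.isClosed fun g f hg hgf => ?_
    have h1 : ∀ t, eLpNorm (U t f) (ENNReal.ofReal q) volume ^ p ≤
        liminf (fun n => eLpNorm (U t (g n)) (ENNReal.ofReal q) volume ^ p) atTop := by
      intro t
      exact eLpNorm_rpow_le_liminf _ hp0.le (((U t).continuous.tendsto f).comp hgf)
    refine (lintegral_mono h1).trans ((lintegral_liminf_le fun k => ?_).trans ?_)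
    · exact (measurable_eLpNorm_U _ (continuous_U_apply (g k))).pow_const p
    · refine (liminf_le_liminf (Eventually.of_forall hg)).trans (le_of_eq (Tendsto.liminf_eq ?_))
      refine ENNReal.tendsto_ofReal (Tendsto.rpow_const ?_ (Or.inr (by positivity)))
      exact (hgf.norm.pow 2).const_mul C
  refine (ENNReal.rpow_le_rpow hL (by positivity)).trans (le_of_eq ?_)
  rw [ENNReal.ofReal_rpow_of_nonneg (by positivity) (by positivity), ← ofReal_norm, ← ENNReal.ofReal_mul (by positivity),
    ← Real.rpow_mul (by positivity), show p / 2 * (1 / p) = 1 / 2 by field_simp,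
    Real.mul_rpow hC (by positivity), ← Real.rpow_natCast, ← Real.rpow_mul (by positivity)]
  norm_num

end StrichartzHomogeneous

section GaussianSmoothing

variable {V : Type*} [NormedAddCommGroup V] [InnerProductSpace ℝ V] [FiniteDimensional ℝ V]
  [MeasurableSpace V] [BorelSpace V]

theorem enorm_mul_enorm_le (a b k : ℝ≥0∞) : a * b * k ≤ 2⁻¹ * (a ^ 2 * k) + 2⁻¹ * (b ^ 2 * k) := by
  rw [← mul_assoc, ← mul_assoc, ← add_mul, ← mul_add]
  refine mul_le_mul_left ?_ k
  rcases eq_or_ne a ⊤ with rfl | ha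
  · simp [ENNReal.mul_top]
  rcases eq_or_ne b ⊤ with rfl | hb
  · simp [ENNReal.mul_top]
  lift a to NNReal using ha
  lift b to NNReal using hb
  have h2 : (2⁻¹ : ℝ≥0∞) = ((2⁻¹ : NNReal) : ℝ≥0∞) := by simp
  rw [h2]
  norm_cast
  rw [← NNReal.coe_le_coe]
  push_cast
  nlinarith [sq_nonneg ((a : ℝ) - b)]

/-- A Schur-type bound for a quadratic form whose kernel is dominated by a symmetric one. -/
theorem lintegral_enorm_integral_sq_le {X : Type*} [MeasurableSpace X] {ν : Measure X} [SFinite ν]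
    {e : V → X → ℂ} (he : Measurable (Function.uncurry e)) {m : X → ℝ} (hm : Integrable (fun z => m z ^ 2) ν)
    (hem : ∀ ξ z, ‖e ξ z‖ ≤ m z) {Φ : V → ℂ} (hΦ : Integrable Φ) (hΦc : Measurable Φ) {k : V → V → ℝ≥0∞}
    (hk : Measurable (Function.uncurry k)) (hsymm : ∀ ξ η, k ξ η = k η ξ)
    (hK : ∀ ξ η, ‖∫ z, e ξ z * conj (e η z) ∂ν‖ₑ ≤ k ξ η) :
    ∫⁻ z, ‖∫ ξ, e ξ z * Φ ξ‖ₑ ^ 2 ∂ν ≤ ∫⁻ ξ, ‖Φ ξ‖ₑ ^ 2 * ∫⁻ η, k ξ η := by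
  set S : X → ℂ := fun z => ∫ ξ, e ξ z * Φ ξ with hS
  have hSm : StronglyMeasurable S := by
    refine StronglyMeasurable.integral_prod_right' (f := fun p : X × V => e p.2 p.1 * Φ p.2) ?_
    exact ((he.comp measurable_swap).mul (hΦc.comp measurable_snd)).stronglyMeasurable
  have hF : Integrable (Function.uncurry fun z (w : V × V) => e w.1 z * Φ w.1 * conj (e w.2 z * Φ w.2))
      (ν.prod ((volume : Measure V).prod volume)) := by
    have h1 : Integrable (fun w : V × V => ‖Φ w.1‖ * ‖Φ w.2‖) ((volume : Measure V).prod volume) := hΦ.norm.mul_prod hΦ.norm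
    refine (hm.mul_prod h1).mono' ?_ (Eventually.of_forall fun p => ?_)
    · refine Measurable.aestronglyMeasurable ?_
      have e1 : Measurable fun p : X × V × V => e p.2.1 p.1 :=
        he.comp (measurable_snd.fst.prodMk measurable_fst)
      have e2 : Measurable fun p : X × V × V => e p.2.2 p.1 :=
        he.comp (measurable_snd.snd.prodMk measurable_fst)
      exact (e1.mul (hΦc.comp measurable_snd.fst)).mul
        (Complex.continuous_conj.measurable.comp (e2.mul (hΦc.comp measurable_snd.snd)))
    · simp only [Function.uncurry, norm_mul, RCLike.norm_conj]
      have := mul_le_mul (hem p.2.1 p.1) (hem p.2.2 p.1) (norm_nonneg _) ((norm_nonneg _).trans (hem p.2.1 p.1))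
      calc ‖e p.2.1 p.1‖ * ‖Φ p.2.1‖ * (‖e p.2.2 p.1‖ * ‖Φ p.2.2‖)
          = (‖e p.2.1 p.1‖ * ‖e p.2.2 p.1‖) * (‖Φ p.2.1‖ * ‖Φ p.2.2‖) := by ring
        _ ≤ (m p.1 * m p.1) * (‖Φ p.2.1‖ * ‖Φ p.2.2‖) := by gcongr
        _ = _ := by ring
  have hSS : ∀ z, ∫ w : V × V, e w.1 z * Φ w.1 * conj (e w.2 z * Φ w.2) ∂((volume : Measure V).prod volume)
      = ((‖S z‖ ^ 2 : ℝ) : ℂ) := by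
    intro z
    rw [integral_prod_mul (fun ξ => e ξ z * Φ ξ) (fun η => conj (e η z * Φ η)), integral_conj, Complex.mul_conj']
    push_cast; rfl
  have hint : Integrable (fun z => ‖S z‖ ^ 2) ν := by
    have := hF.integral_prod_left
    simp only [Function.uncurry] at this
    simp_rw [hSS] at this
    exact (this.re).congr (Eventually.of_forall fun z => RCLike.ofReal_re (K := ℂ) _)
  have h0 : ∫⁻ z, ‖S z‖ₑ ^ 2 ∂ν = ‖∫ z, ((‖S z‖ ^ 2 : ℝ) : ℂ) ∂ν‖ₑ := by
    rw [integral_complex_ofReal, ← ofReal_norm, Complex.norm_real, Real.norm_of_nonneg (integral_nonneg fun _ => by positivity),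
      ofReal_integral_eq_lintegral_ofReal hint (Eventually.of_forall fun _ => by positivity)]
    refine lintegral_congr fun z => ?_
    rw [ENNReal.ofReal_pow (norm_nonneg _), ofReal_norm]
  rw [h0]
  simp_rw [← hSS]
  rw [integral_integral_swap hF]
  refine (enorm_integral_le_lintegral_enorm _).trans ?_
  have h1 : ∀ w : V × V, ‖∫ z, e w.1 z * Φ w.1 * conj (e w.2 z * Φ w.2) ∂ν‖ₑ ≤
      2⁻¹ * (‖Φ w.1‖ₑ ^ 2 * k w.1 w.2) + 2⁻¹ * (‖Φ w.2‖ₑ ^ 2 * k w.1 w.2) := by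
    intro w
    have : ∀ z, e w.1 z * Φ w.1 * conj (e w.2 z * Φ w.2) = (Φ w.1 * conj (Φ w.2)) * (e w.1 z * conj (e w.2 z)) := by
      intro z; rw [map_mul]; ring
    simp_rw [this]
    rw [integral_const_mul, enorm_mul, enorm_mul, RCLike.enorm_conj]
    exact (mul_le_mul_right (hK _ _) _).trans (enorm_mul_enorm_le _ _ _)
  refine (lintegral_mono h1).trans ?_
  have mk1 : Measurable fun w : V × V => ‖Φ w.1‖ₑ ^ 2 * k w.1 w.2 := ((hΦc.comp measurable_fst).enorm.pow_const 2).mul hk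
  have mk2 : Measurable fun w : V × V => ‖Φ w.2‖ₑ ^ 2 * k w.1 w.2 := ((hΦc.comp measurable_snd).enorm.pow_const 2).mul hk
  rw [lintegral_add_left (mk1.const_mul _), lintegral_const_mul _ mk1, lintegral_const_mul _ mk2,
    lintegral_prod _ mk1.aemeasurable, lintegral_prod_symm _ mk2.aemeasurable]
  have e1 : ∀ ξ, ∫⁻ η, ‖Φ ξ‖ₑ ^ 2 * k ξ η = ‖Φ ξ‖ₑ ^ 2 * ∫⁻ η, k ξ η := fun ξ =>
    lintegral_const_mul _ (hk.comp measurable_prodMk_left)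
  have e2 : ∀ ξ, ∫⁻ η, ‖Φ ξ‖ₑ ^ 2 * k η ξ = ‖Φ ξ‖ₑ ^ 2 * ∫⁻ η, k ξ η := fun ξ => by
    rw [← e1]; exact lintegral_congr fun η => by rw [hsymm]
  simp only [e1, e2]
  rw [← add_mul, ENNReal.inv_two_add_inv_two, one_mul]

/-- The Fourier transform of the Gaussian `exp (-a‖x‖²)`. -/
noncomputable def gk (a : ℝ) (ζ : V) : ℝ :=
  (Real.pi / a) ^ (Module.finrank ℝ V / 2 : ℝ) * Real.exp (-(Real.pi ^ 2 * ‖ζ‖ ^ 2 / a))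

theorem gk_nonneg {a : ℝ} (ha : 0 < a) (ζ : V) : 0 ≤ gk a ζ := by unfold gk; positivity

theorem continuous_gk (a : ℝ) : Continuous (gk a : V → ℝ) := by unfold gk; fun_prop

theorem integral_gauss {a : ℝ} (ha : 0 < a) (ζ : V) :
    ∫ x : V, Complex.exp (-(a : ℂ) * ‖x‖ ^ 2 + 2 * Real.pi * Complex.I * (inner ℝ ζ x : ℝ)) = (gk a ζ : ℂ) := by
  rw [GaussianFourier.integral_cexp_neg_mul_sq_norm_add (by simpa using ha), gk]
  push_cast
  rw [Complex.ofReal_cpow (by positivity)]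
  push_cast
  congr 2
  have : (a : ℂ) ≠ 0 := by exact_mod_cast ha.ne'
  field_simp
  rw [Complex.I_sq]; ring

/-- The Gaussian-weighted plane wave attached to the frequency `ξ`. -/
noncomputable def wave (a ε : ℝ) (ξ : V) (z : ℝ × V) : ℂ :=
  (Real.exp (-(ε * z.1 ^ 2 + a * ‖z.2‖ ^ 2) / 2) : ℂ) * (Complex.exp (2 * Real.pi * Complex.I * (inner ℝ ξ z.2 : ℝ)) * sym z.1 ξ)

theorem norm_wave (a ε : ℝ) (ξ : V) (z : ℝ × V) : ‖wave a ε ξ z‖ = Real.exp (-(ε * z.1 ^ 2 + a * ‖z.2‖ ^ 2) / 2) := by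
  rw [wave, norm_mul, norm_mul, norm_sym, Complex.norm_real, Real.norm_of_nonneg (by positivity), Complex.norm_exp]
  simp

theorem continuous_wave (a ε : ℝ) : Continuous (Function.uncurry (wave a ε : V → ℝ × V → ℂ)) := by
  have h : Continuous fun p : V × ℝ × V => sym p.2.1 p.1 := continuous_sym.comp (continuous_snd.fst.prodMk continuous_fst)
  unfold wave Function.uncurry
  fun_prop

theorem integral_wave {a ε : ℝ} (ha : 0 < a) (hε : 0 < ε) (ξ η : V) :
    ∫ z, wave a ε ξ z * conj (wave a ε η z) = ((gk ε (2 * Real.pi * (‖η‖ ^ 2 - ‖ξ‖ ^ 2)) * gk a (ξ - η) : ℝ) : ℂ) := by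
  have : ∀ z : ℝ × V, wave a ε ξ z * conj (wave a ε η z) =
      Complex.exp (-(ε : ℂ) * ‖z.1‖ ^ 2 + 2 * Real.pi * Complex.I * (inner ℝ (2 * Real.pi * (‖η‖ ^ 2 - ‖ξ‖ ^ 2)) z.1 : ℝ)) *
      Complex.exp (-(a : ℂ) * ‖z.2‖ ^ 2 + 2 * Real.pi * Complex.I * (inner ℝ (ξ - η) z.2 : ℝ)) := by
    intro z
    have hz : (‖z.1‖ : ℂ) ^ 2 = (z.1 : ℂ) ^ 2 := by
      rw [← Complex.ofReal_pow, Real.norm_eq_abs, sq_abs, Complex.ofReal_pow]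
    simp only [wave, sym, map_mul, Complex.conj_ofReal, ← Complex.exp_conj, Complex.ofReal_exp, ← Complex.exp_add, hz,
      Complex.conj_I, inner_sub_left, map_ofNat, map_add]
    congr 1
    push_cast
    simp only [RCLike.inner_apply, conj_trivial, ← Complex.ofReal_pow, map_mul, map_ofNat]
    push_cast
    ring
  simp_rw [this]
  rw [Measure.volume_eq_prod, integral_prod_mul (fun s : ℝ => Complex.exp (-(ε : ℂ) * ‖s‖ ^ 2 + 2 * Real.pi * Complex.I * (inner ℝ (2 * Real.pi * (‖η‖ ^ 2 - ‖ξ‖ ^ 2)) s : ℝ)))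
    (fun x : V => Complex.exp (-(a : ℂ) * ‖x‖ ^ 2 + 2 * Real.pi * Complex.I * (inner ℝ (ξ - η) x : ℝ))),
    integral_gauss hε, integral_gauss ha]
  push_cast; rfl

/-- The weighted space-time `L²` norm of the free evolution, bounded on the Fourier side. -/
theorem lintegral_gauss_uS_le {a ε : ℝ} (ha : 0 < a) (hε : 0 < ε) (φ : 𝓢(V, ℂ)) :
    ∫⁻ s : ℝ, ∫⁻ x, ENNReal.ofReal (Real.exp (-(ε * s ^ 2 + a * ‖x‖ ^ 2))) * ‖uS s φ x‖ₑ ^ 2 ≤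
      ∫⁻ ξ, ‖𝓕 φ ξ‖ₑ ^ 2 * ∫⁻ η, ENNReal.ofReal (gk ε (2 * Real.pi * (‖η‖ ^ 2 - ‖ξ‖ ^ 2)) * gk a (ξ - η)) := by
  have hm : Integrable (fun z : ℝ × V => Real.exp (-(ε * z.1 ^ 2 + a * ‖z.2‖ ^ 2) / 2) ^ 2) := by
    have h1 : Integrable (fun s : ℝ => Real.exp (-ε * s ^ 2)) := integrable_exp_neg_mul_sq hε
    have h2 : Integrable (fun x : V => Real.exp (-a * ‖x‖ ^ 2)) := by
      have := (GaussianFourier.integrable_cexp_neg_mul_sq_norm_add (b := (a : ℂ)) (by simpa using ha) 0 (0 : V)).norm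
      refine this.congr (Eventually.of_forall fun x => ?_)
      simp only [Complex.norm_exp]
      congr 1
      simp [← Complex.ofReal_pow]
    refine (h1.mul_prod h2).congr (Eventually.of_forall fun z => ?_)
    simp only
    rw [← Real.exp_add, ← Real.exp_nat_mul]; congr 1; push_cast; ring
  have := lintegral_enorm_integral_sq_le (e := wave a ε) (continuous_wave a ε).measurable hm (fun ξ z => (norm_wave a ε ξ z).le)
    (𝓕 φ).integrable (𝓕 φ).continuous.measurable
    (k := fun ξ η => ENNReal.ofReal (gk ε (2 * Real.pi * (‖η‖ ^ 2 - ‖ξ‖ ^ 2)) * gk a (ξ - η))) ?_ ?_ ?_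
  · refine le_trans (le_of_eq ?_) this
    rw [Measure.volume_eq_prod, lintegral_prod]
    · refine lintegral_congr fun s => lintegral_congr fun x => ?_
      simp only [wave]
      have e : ∀ ξ : V, (Real.exp (-(ε * s ^ 2 + a * ‖x‖ ^ 2) / 2) : ℂ) * (Complex.exp (2 * Real.pi * Complex.I * (inner ℝ ξ x : ℝ)) * sym s ξ) * 𝓕 φ ξ
        = (Real.exp (-(ε * s ^ 2 + a * ‖x‖ ^ 2) / 2) : ℂ) * (Complex.exp (2 * Real.pi * Complex.I * (inner ℝ ξ x : ℝ)) * (sym s ξ * 𝓕 φ ξ)) := fun ξ => by ring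
      simp_rw [e]
      rw [integral_const_mul, ← uS_apply, enorm_mul, mul_pow, ← ofReal_norm ((Real.exp _ : ℝ) : ℂ), Complex.norm_real, Real.norm_of_nonneg (by positivity),
        ← ENNReal.ofReal_pow (by positivity), ← Real.exp_nat_mul]
      congr 3; push_cast; ring
    · refine Measurable.aemeasurable ?_
      refine (Measurable.enorm (StronglyMeasurable.measurable ?_)).pow_const 2
      refine StronglyMeasurable.integral_prod_right' (f := fun p : (ℝ × V) × V => wave a ε p.2 p.1 * 𝓕 φ p.2) ?_
      exact (((continuous_wave a ε).comp continuous_swap).mul ((𝓕 φ).continuous.comp continuous_snd)).stronglyMeasurable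
  · refine Measurable.ennreal_ofReal (Continuous.measurable ?_)
    have := continuous_gk (V := V) a
    have := continuous_gk (V := ℝ) ε
    fun_prop
  · intro ξ η
    simp only [gk, norm_sub_rev ξ η]
    congr 4
    rw [norm_mul, norm_sub_rev, ← norm_mul]
  · intro ξ η
    rw [integral_wave ha hε, ← ofReal_norm, Complex.norm_real,
      Real.norm_of_nonneg (mul_nonneg (gk_nonneg hε _) (gk_nonneg ha _))]

end GaussianSmoothing

section KatoKernel

variable {V : Type*} [NormedAddCommGroup V] [InnerProductSpace ℝ V] [FiniteDimensional ℝ V]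
  [MeasurableSpace V] [BorelSpace V]

theorem norm_sq_gauss_param {a : ℝ} (ha : 0 < a) (s : ℝ) :
    Complex.normSq ((Real.pi ^ 2 / a : ℝ) - (4 * Real.pi ^ 2 * s : ℝ) * Complex.I) = (Real.pi ^ 2 / a) ^ 2 * (1 + (4 * a * s) ^ 2) := by
  rw [Complex.normSq_apply]
  simp only [Complex.sub_re, Complex.sub_im, Complex.ofReal_re, Complex.ofReal_im, Complex.re_ofReal_mul, Complex.im_ofReal_mul, Complex.I_re, Complex.I_im]
  field_simp; ring

/-- Modulus of the Gaussian average of the Schrödinger phase around the frequency `ξ`. -/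
theorem norm_integral_gk_sym_le (hd : 3 ≤ Module.finrank ℝ V) {a : ℝ} (ha : 0 < a) (s : ℝ) (ξ : V) :
    ‖∫ η : V, Complex.exp (((4 * Real.pi ^ 2 * s * (‖η‖ ^ 2 - ‖ξ‖ ^ 2) : ℝ) : ℂ) * Complex.I) * gk a (ξ - η)‖ ≤
      (1 + (4 * a * s) ^ 2) ^ (-(3 / 2) / 2 : ℝ) *
        Real.exp (-(Real.pi ^ 2 * ‖ξ‖ ^ 2 / a * (4 * a * s) ^ 2 / (1 + (4 * a * s) ^ 2))) := by
  set b : ℂ := (Real.pi ^ 2 / a : ℝ) - (4 * Real.pi ^ 2 * s : ℝ) * Complex.I with hb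
  set c : ℂ := ((8 * Real.pi ^ 2 * s : ℝ) : ℂ) * Complex.I with hc
  set w : ℝ := 1 + (4 * a * s) ^ 2 with hw
  have hw1 : 1 ≤ w := by simp only [hw]; nlinarith [sq_nonneg (4 * a * s)]
  have hbre : b.re = Real.pi ^ 2 / a := by
    rw [hb, Complex.sub_re, Complex.re_ofReal_mul, Complex.I_re, Complex.ofReal_re]; ring
  have hb0 : 0 < b.re := by rw [hbre]; positivity
  have hbn : b ≠ 0 := fun h => by rw [h] at hb0; simp at hb0
  have hns : Complex.normSq b = (Real.pi ^ 2 / a) ^ 2 * w := norm_sq_gauss_param ha s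
  have hnb : ‖b‖ = Real.pi ^ 2 / a * w ^ (1 / 2 : ℝ) := by
    rw [Complex.norm_def, hns, Real.sqrt_mul (by positivity), Real.sqrt_sq (by positivity), Real.sqrt_eq_rpow]
  rw [← integral_add_left_eq_self _ ξ]
  have e : ∀ ζ : V, Complex.exp (((4 * Real.pi ^ 2 * s * (‖ξ + ζ‖ ^ 2 - ‖ξ‖ ^ 2) : ℝ) : ℂ) * Complex.I) * gk a (ξ - (ξ + ζ)) =
      (((Real.pi / a) ^ (Module.finrank ℝ V / 2 : ℝ) : ℝ) : ℂ) * Complex.exp (-b * ‖ζ‖ ^ 2 + c * (inner ℝ ξ ζ : ℝ)) := by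
    intro ζ
    rw [gk, sub_add_cancel_left, norm_neg, Complex.ofReal_mul ((Real.pi / a) ^ (Module.finrank ℝ V / 2 : ℝ)), mul_left_comm, Complex.ofReal_exp, ← Complex.exp_add, norm_add_sq_real]
    congr 2
    rw [hb, hc]; push_cast; ring
  simp_rw [e]
  rw [integral_const_mul, GaussianFourier.integral_cexp_neg_mul_sq_norm_add hb0, norm_mul, norm_mul, Complex.norm_real,
    Real.norm_of_nonneg (by positivity), Complex.norm_exp]
  have h1 : ‖((Real.pi : ℂ) / b) ^ (Module.finrank ℝ V / 2 : ℂ)‖ = (Real.pi / ‖b‖) ^ (Module.finrank ℝ V / 2 : ℝ) := by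
    have : (Module.finrank ℝ V / 2 : ℂ) = ((Module.finrank ℝ V / 2 : ℝ) : ℂ) := by push_cast; rfl
    rw [this, Complex.norm_cpow_real, norm_div, Complex.norm_real, Real.norm_of_nonneg Real.pi_pos.le]
  have h2 : (c ^ 2 * ‖ξ‖ ^ 2 / (4 * b)).re = -(Real.pi ^ 2 * ‖ξ‖ ^ 2 / a * (4 * a * s) ^ 2 / w) := by
    have : c ^ 2 * ‖ξ‖ ^ 2 / (4 * b) = ((-(16 * Real.pi ^ 4 * s ^ 2 * ‖ξ‖ ^ 2) : ℝ) : ℂ) * b⁻¹ := by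
      rw [hc, mul_pow, Complex.I_sq]; push_cast; field_simp; ring
    rw [this, Complex.re_ofReal_mul, Complex.inv_re, hbre, hns]
    field_simp
    ring
  rw [h1, h2, ← mul_assoc, ← Real.mul_rpow (by positivity) (by positivity)]
  refine mul_le_mul_of_nonneg_right ?_ (by positivity)
  have h3 : Real.pi / a * (Real.pi / ‖b‖) = w ^ (-(1 / 2) : ℝ) := by
    rw [hnb, Real.rpow_neg (by positivity)]; field_simp
  rw [h3, ← Real.rpow_mul (by positivity)]
  refine Real.rpow_le_rpow_of_exponent_le hw1 ?_
  have : (3 : ℝ) ≤ Module.finrank ℝ V := by exact_mod_cast hd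
  linarith

theorem exp_phase_le {m v : ℝ} : (1 + v ^ 2) ^ (-(3 / 2) / 2 : ℝ) * Real.exp (-(m ^ 2 * v ^ 2 / (1 + v ^ 2))) ≤
    Real.exp (-(m ^ 2 / 2) * v ^ 2) + Real.exp (-(m ^ 2 / 2)) * (1 + ‖v‖ ^ 2) ^ (-(3 / 2) / 2 : ℝ) := by
  rw [Real.norm_eq_abs, sq_abs]
  have hv : 0 ≤ v ^ 2 := sq_nonneg v
  rcases le_total (v ^ 2) 1 with h | h
  · refine le_add_of_le_of_nonneg ?_ (by positivity)
    have h1 : (1 + v ^ 2) ^ (-(3 / 2) / 2 : ℝ) ≤ 1 := Real.rpow_le_one_of_one_le_of_nonpos (by linarith) (by norm_num)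
    have h2 : Real.exp (-(m ^ 2 * v ^ 2 / (1 + v ^ 2))) ≤ Real.exp (-(m ^ 2 / 2) * v ^ 2) := by
      refine Real.exp_le_exp.2 ?_
      rw [neg_mul]
      refine neg_le_neg ?_
      rw [le_div_iff₀ (by positivity)]
      nlinarith [mul_nonneg (sq_nonneg m) hv]
    calc _ ≤ 1 * Real.exp (-(m ^ 2 / 2) * v ^ 2) := by gcongr
      _ = _ := one_mul _
  · refine le_add_of_nonneg_of_le (by positivity) ?_
    rw [mul_comm]
    refine mul_le_mul_of_nonneg_right (Real.exp_le_exp.2 (neg_le_neg ?_)) (by positivity)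
    rw [le_div_iff₀ (by positivity)]
    nlinarith [mul_nonneg (sq_nonneg m) (sub_nonneg.2 h)]

/-- High-frequency bound for the smoothing kernel. -/
theorem lintegral_kernel_le_inv_norm (hd : 3 ≤ Module.finrank ℝ V) : ∃ C : ℝ, 0 ≤ C ∧ ∀ (a ε : ℝ), 0 < a → 0 < ε → ∀ ξ : V, ξ ≠ 0 →
    ∫⁻ η, ENNReal.ofReal (gk ε (2 * Real.pi * (‖η‖ ^ 2 - ‖ξ‖ ^ 2)) * gk a (ξ - η)) ≤
      ENNReal.ofReal (C * (‖ξ‖⁻¹ * a ^ (-(1 / 2) : ℝ))) := by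
  set C₀ : ℝ := ∫ v : ℝ, (1 + ‖v‖ ^ 2) ^ (-(3 / 2) / 2 : ℝ) with hC₀
  have hC₀0 : 0 ≤ C₀ := integral_nonneg fun _ => by positivity
  have hi0 : Integrable (fun v : ℝ => (1 + ‖v‖ ^ 2) ^ (-(3 / 2) / 2 : ℝ)) :=
    integrable_rpow_neg_one_add_norm_sq (by simp; norm_num)
  refine ⟨Real.sqrt (2 * Real.pi) + C₀, by positivity, fun a ε ha hε ξ hξ => ?_⟩
  have hξ0 : 0 < ‖ξ‖ := norm_pos_iff.2 hξ
  have hga : Integrable (fun η : V => gk a (ξ - η)) := by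
    have : Integrable (gk a : V → ℝ) := by
      unfold gk
      refine Integrable.const_mul ?_ _
      have := (GaussianFourier.integrable_cexp_neg_mul_sq_norm_add (b := ((Real.pi ^ 2 / a : ℝ) : ℂ)) (by simp only [Complex.ofReal_re]; positivity) 0 (0 : V)).norm
      refine this.congr (Eventually.of_forall fun x => ?_)
      simp only [Complex.norm_exp]
      congr 1
      simp [← Complex.ofReal_pow]; ring
    exact this.comp_sub_left ξ
  set L : V → ℝ → ℂ := fun η s => Complex.exp (-(ε : ℂ) * ‖s‖ ^ 2 + 2 * Real.pi * Complex.I * (inner ℝ (2 * Real.pi * (‖η‖ ^ 2 - ‖ξ‖ ^ 2)) s : ℝ)) * gk a (ξ - η) with hL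
  have hLn : ∀ η s, ‖L η s‖ = gk a (ξ - η) * Real.exp (-ε * s ^ 2) := by
    intro η s
    rw [hL]
    simp only [norm_mul, Complex.norm_exp, Complex.norm_real, Real.norm_of_nonneg (gk_nonneg ha _)]
    rw [mul_comm]; congr 2
    simp [← Complex.ofReal_pow]
  have hLc : Continuous (Function.uncurry L) := by
    have := continuous_gk (V := V) a
    rw [hL]; fun_prop
  have hLi : Integrable (Function.uncurry L) ((volume : Measure V).prod volume) :=
    (hga.mul_prod (integrable_exp_neg_mul_sq hε)).mono' hLc.aestronglyMeasurable
      (Eventually.of_forall fun p => (hLn p.1 p.2).le)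
  have h0 : ∀ η, ∫ s, L η s = ((gk ε (2 * Real.pi * (‖η‖ ^ 2 - ‖ξ‖ ^ 2)) * gk a (ξ - η) : ℝ) : ℂ) := by
    intro η
    rw [hL]; simp only
    rw [integral_mul_const, integral_gauss hε]; push_cast; rfl
  have hint : Integrable fun η => gk ε (2 * Real.pi * (‖η‖ ^ 2 - ‖ξ‖ ^ 2)) * gk a (ξ - η) := by
    have := hLi.integral_prod_left
    simp only [Function.uncurry] at this
    simp_rw [h0] at this
    exact (this.re).congr (Eventually.of_forall fun z => RCLike.ofReal_re (K := ℂ) _)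
  have hnn : ∀ η, 0 ≤ gk ε (2 * Real.pi * (‖η‖ ^ 2 - ‖ξ‖ ^ 2)) * gk a (ξ - η) := fun η => mul_nonneg (gk_nonneg hε _) (gk_nonneg ha _)
  rw [← ofReal_integral_eq_lintegral_ofReal hint (Eventually.of_forall hnn)]
  refine ENNReal.ofReal_le_ofReal ?_
  have h1 : ((∫ η, gk ε (2 * Real.pi * (‖η‖ ^ 2 - ‖ξ‖ ^ 2)) * gk a (ξ - η) : ℝ) : ℂ) = ∫ s, ∫ η, L η s := by
    rw [← integral_integral_swap hLi]
    simp_rw [h0]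
    rw [integral_complex_ofReal]
  set m : ℝ := Real.pi * ‖ξ‖ * a ^ (-(1 / 2) : ℝ) with hm
  have hm0 : 0 < m := by positivity
  have hm2 : m ^ 2 = Real.pi ^ 2 * ‖ξ‖ ^ 2 / a := by
    rw [hm, mul_pow, mul_pow, ← Real.rpow_natCast (a ^ _), ← Real.rpow_mul ha.le]
    norm_num
    rw [Real.rpow_neg_one, div_eq_mul_inv]
  have h2 : ∀ s, ‖∫ η, L η s‖ ≤ Real.exp (-(m ^ 2 / 2) * (4 * a * s) ^ 2) +
      Real.exp (-(m ^ 2 / 2)) * (1 + ‖4 * a * s‖ ^ 2) ^ (-(3 / 2) / 2 : ℝ) := by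
    intro s
    have e : ∀ η, L η s = ((Real.exp (-ε * s ^ 2) : ℝ) : ℂ) *
        (Complex.exp (((4 * Real.pi ^ 2 * s * (‖η‖ ^ 2 - ‖ξ‖ ^ 2) : ℝ) : ℂ) * Complex.I) * gk a (ξ - η)) := by
      intro η
      rw [hL]; simp only
      rw [← mul_assoc, Complex.ofReal_exp, ← Complex.exp_add]
      congr 2
      rw [← Complex.ofReal_pow, Real.norm_eq_abs, sq_abs]
      simp only [RCLike.inner_apply, conj_trivial]
      push_cast; ring
    simp_rw [e]
    rw [integral_const_mul, norm_mul, Complex.norm_real, Real.norm_of_nonneg (by positivity)]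
    have hle := norm_integral_gk_sym_le hd ha s ξ
    rw [← hm2] at hle
    replace hle := hle.trans exp_phase_le
    refine le_trans ?_ hle
    refine mul_le_of_le_one_left (norm_nonneg _) (Real.exp_le_one_iff.2 ?_)
    nlinarith [sq_nonneg s]
  have h4a : (4 * a) ≠ 0 := by positivity
  have hg1 : Integrable fun v : ℝ => Real.exp (-(m ^ 2 / 2) * v ^ 2) := integrable_exp_neg_mul_sq (by positivity)
  have hg : Integrable fun v : ℝ => Real.exp (-(m ^ 2 / 2) * v ^ 2) + Real.exp (-(m ^ 2 / 2)) * (1 + ‖v‖ ^ 2) ^ (-(3 / 2) / 2 : ℝ) :=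
    hg1.add (hi0.const_mul _)
  have h3 := norm_integral_le_of_norm_le (hg.comp_mul_left' h4a) (Eventually.of_forall h2)
  rw [← h1, Complex.norm_real, Real.norm_of_nonneg (integral_nonneg hnn), Measure.integral_comp_mul_left
    (fun v : ℝ => Real.exp (-(m ^ 2 / 2) * v ^ 2) + Real.exp (-(m ^ 2 / 2)) * (1 + ‖v‖ ^ 2) ^ (-(3 / 2) / 2 : ℝ)),
    integral_add hg1 (hi0.const_mul _), integral_const_mul, integral_gaussian, smul_eq_mul, abs_of_nonneg (by positivity)] at h3
  refine h3.trans ?_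
  have h5 : Real.sqrt (Real.pi / (m ^ 2 / 2)) = Real.sqrt (2 * Real.pi) * m⁻¹ := by
    rw [show Real.pi / (m ^ 2 / 2) = (2 * Real.pi) / m ^ 2 by field_simp, Real.sqrt_div (by positivity), Real.sqrt_sq hm0.le]; rfl
  have h6 : Real.exp (-(m ^ 2 / 2)) ≤ m⁻¹ := by
    rw [Real.exp_neg]
    refine inv_anti₀ hm0 ?_
    have := Real.add_one_le_exp (m ^ 2 / 2)
    nlinarith [sq_nonneg (m - 1)]
  have h7 : (4 * a)⁻¹ * m⁻¹ ≤ ‖ξ‖⁻¹ * a ^ (-(1 / 2) : ℝ) := by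
    have e : (4 * a)⁻¹ * m⁻¹ = (4 * Real.pi)⁻¹ * (‖ξ‖⁻¹ * a ^ (-(1 / 2) : ℝ)) := by
      rw [hm, mul_inv, mul_inv, mul_inv, mul_inv, ← Real.rpow_neg ha.le]
      have : a ^ (- -(1 / 2) : ℝ) = a * a ^ (-(1 / 2) : ℝ) := by
        rw [← Real.rpow_one_add' ha.le (by norm_num)]; norm_num
      rw [this]; field_simp
    rw [e]
    refine mul_le_of_le_one_left (by positivity) (inv_le_one_of_one_le₀ ?_)
    have := Real.pi_gt_three
    linarith
  rw [h5]
  calc (4 * a)⁻¹ * (Real.sqrt (2 * Real.pi) * m⁻¹ + Real.exp (-(m ^ 2 / 2)) * C₀)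
      ≤ (4 * a)⁻¹ * (Real.sqrt (2 * Real.pi) * m⁻¹ + m⁻¹ * C₀) := by gcongr
    _ = (Real.sqrt (2 * Real.pi) + C₀) * ((4 * a)⁻¹ * m⁻¹) := by ring
    _ ≤ _ := by gcongr

end KatoKernel

section LowFrequency

variable {V : Type*} [NormedAddCommGroup V] [InnerProductSpace ℝ V] [FiniteDimensional ℝ V]
  [MeasurableSpace V] [BorelSpace V]

theorem one_add_div_rpow_mul_exp_le {m v ε : ℝ} (hm : 0 ≤ m) (hε : 0 < ε) :
    (1 + |v| / Real.sqrt ε) ^ m * Real.exp (-(Real.pi ^ 2 * (2 * Real.pi * v) ^ 2 / ε)) ≤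
      Real.exp (m ^ 2) * Real.exp (-ε⁻¹ * v ^ 2) := by
  set w : ℝ := |v| / Real.sqrt ε with hw
  have hw0 : 0 ≤ w := by positivity
  have hw2 : v ^ 2 / ε = w ^ 2 := by rw [hw, div_pow, sq_abs, Real.sq_sqrt hε.le]
  have h1 : (1 + w) ^ m ≤ Real.exp (w * m) := by
    rw [Real.exp_mul]
    exact Real.rpow_le_rpow (by positivity) (by linarith [Real.add_one_le_exp w]) hm
  refine (mul_le_mul_of_nonneg_right h1 (Real.exp_nonneg _)).trans ?_
  rw [← Real.exp_add, ← Real.exp_add]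
  refine Real.exp_le_exp.2 ?_
  have e1 : Real.pi ^ 2 * (2 * Real.pi * v) ^ 2 / ε = 4 * Real.pi ^ 4 * w ^ 2 := by rw [← hw2]; ring
  have e2 : -ε⁻¹ * v ^ 2 = -w ^ 2 := by rw [← hw2]; ring
  rw [e1, e2]
  have hpi : (1 : ℝ) ≤ Real.pi ^ 4 := one_le_pow₀ (by linarith [Real.pi_gt_three])
  nlinarith [sq_nonneg (w - m), sq_nonneg w]

theorem lintegral_gk_sphere_le (hd : 3 ≤ Module.finrank ℝ V) : ∃ C : ℝ, 0 ≤ C ∧ ∀ (ε c A : ℝ), 0 < ε → c ^ 2 ≤ A → Real.sqrt ε ≤ A →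
    ∫⁻ η : V, ENNReal.ofReal (gk ε (2 * Real.pi * (‖η‖ ^ 2 - c ^ 2))) ≤
      ENNReal.ofReal (C * A ^ (Module.finrank ℝ V / 2 - 1 : ℝ)) := by
  set m : ℝ := Module.finrank ℝ V / 2 - 1 with hm
  have hd' : (3 : ℝ) ≤ Module.finrank ℝ V := by exact_mod_cast hd
  have hm0 : 0 < m := by linarith
  have : Nontrivial V := Module.nontrivial_of_finrank_pos (R := ℝ) (by omega)
  set B : ℝ := Module.finrank ℝ V * (volume : Measure V).real (Metric.ball 0 1) with hB
  have hB0 : 0 ≤ B := by positivity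
  refine ⟨B * (Real.exp (m ^ 2) * Real.pi), by positivity, fun ε c A hε hcA hεA => ?_⟩
  have hse : 0 < Real.sqrt ε := Real.sqrt_pos.2 hε
  have hA : 0 < A := hse.trans_le hεA
  set H : ℝ → ℝ := fun v => A ^ m * Real.exp (m ^ 2) * (Real.pi / ε) ^ (1 / 2 : ℝ) * Real.exp (-ε⁻¹ * v ^ 2) with hH
  have hHi : Integrable H := (integrable_exp_neg_mul_sq (inv_pos.2 hε)).const_mul _
  have hHt : ∫ v, H v = A ^ m * Real.exp (m ^ 2) * Real.pi := by
    rw [hH, integral_const_mul, integral_gaussian, ← Real.sqrt_eq_rpow, mul_assoc, ← Real.sqrt_mul (by positivity)]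
    congr 1
    rw [show Real.pi / ε * (Real.pi / ε⁻¹) = Real.pi ^ 2 by field_simp, Real.sqrt_sq Real.pi_pos.le]
  have hinj : Set.InjOn (fun y : ℝ => y ^ 2 - c ^ 2) (Set.Ioi 0) := by
    intro x hx y hy hxy
    have : x ^ 2 = y ^ 2 := by simpa using hxy
    exact (pow_left_inj₀ (le_of_lt hx) (le_of_lt hy) two_ne_zero).1 this
  have hder : ∀ y ∈ Set.Ioi (0 : ℝ), HasDerivWithinAt (fun y : ℝ => y ^ 2 - c ^ 2) (2 * y) (Set.Ioi 0) y := by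
    intro y _
    have := ((hasDerivAt_pow 2 y).sub_const (c ^ 2)).hasDerivWithinAt (s := Set.Ioi 0)
    simpa using this
  set F : ℝ → ℝ := fun y => gk ε (2 * Real.pi * (y ^ 2 - c ^ 2)) with hF
  have hFn : ∀ y, 0 ≤ F y := fun y => gk_nonneg hε _
  have hFc : Continuous F := by
    have := continuous_gk (V := ℝ) ε
    rw [hF]; fun_prop
  have hle : ∀ y ∈ Set.Ioi (0 : ℝ), y ^ (Module.finrank ℝ V - 1) • F y ≤ |2 * y| • H (y ^ 2 - c ^ 2) := by
    intro y hy
    have hy : 0 < y := hy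
    set v := y ^ 2 - c ^ 2 with hv
    have e1 : y ^ (Module.finrank ℝ V - 1) = y * (y ^ 2) ^ m := by
      have h2 : ((Module.finrank ℝ V - 1 : ℕ) : ℝ) = 1 + 2 * m := by
        rw [Nat.cast_sub (by omega)]; push_cast; rw [hm]; ring
      rw [← Real.rpow_natCast, h2, Real.rpow_add hy, Real.rpow_one, Real.rpow_mul hy.le]
      norm_cast
    have e2 : (y ^ 2) ^ m ≤ A ^ m * (1 + |v| / Real.sqrt ε) ^ m := by
      rw [← Real.mul_rpow hA.le (by positivity)]
      refine Real.rpow_le_rpow (by positivity) ?_ hm0.le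
      have h3 : |v| ≤ A * (|v| / Real.sqrt ε) := by
        rw [mul_div_assoc', le_div_iff₀ hse, mul_comm]
        exact mul_le_mul_of_nonneg_right hεA (abs_nonneg v)
      have h4 := le_abs_self v
      nlinarith
    have e3 : F y = (Real.pi / ε) ^ (1 / 2 : ℝ) * Real.exp (-(Real.pi ^ 2 * (2 * Real.pi * v) ^ 2 / ε)) := by
      simp only [hF, gk, Module.finrank_self, Nat.cast_one, Real.norm_eq_abs, sq_abs, hv]
    have e4 := one_add_div_rpow_mul_exp_le (v := v) hm0.le hε
    rw [smul_eq_mul, smul_eq_mul, abs_of_pos (by positivity), e1, e3, hH]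
    simp only
    calc y * (y ^ 2) ^ m * ((Real.pi / ε) ^ (1 / 2 : ℝ) * Real.exp (-(Real.pi ^ 2 * (2 * Real.pi * v) ^ 2 / ε)))
        ≤ y * (A ^ m * (1 + |v| / Real.sqrt ε) ^ m) * ((Real.pi / ε) ^ (1 / 2 : ℝ) * Real.exp (-(Real.pi ^ 2 * (2 * Real.pi * v) ^ 2 / ε))) := by gcongr
      _ = y * A ^ m * (Real.pi / ε) ^ (1 / 2 : ℝ) * ((1 + |v| / Real.sqrt ε) ^ m * Real.exp (-(Real.pi ^ 2 * (2 * Real.pi * v) ^ 2 / ε))) := by ring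
      _ ≤ y * A ^ m * (Real.pi / ε) ^ (1 / 2 : ℝ) * (Real.exp (m ^ 2) * Real.exp (-ε⁻¹ * v ^ 2)) := by gcongr
      _ ≤ 2 * (y * A ^ m * (Real.pi / ε) ^ (1 / 2 : ℝ) * (Real.exp (m ^ 2) * Real.exp (-ε⁻¹ * v ^ 2))) := by
          have : 0 ≤ y * A ^ m * (Real.pi / ε) ^ (1 / 2 : ℝ) * (Real.exp (m ^ 2) * Real.exp (-ε⁻¹ * v ^ 2)) := by positivity
          linarith
      _ = _ := by ring
  have hRi : IntegrableOn (fun y => |2 * y| • H (y ^ 2 - c ^ 2)) (Set.Ioi 0) :=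
    (integrableOn_image_iff_integrableOn_abs_deriv_smul measurableSet_Ioi hder hinj H).1 hHi.integrableOn
  have hLi : IntegrableOn (fun y => y ^ (Module.finrank ℝ V - 1) • F y) (Set.Ioi 0) := by
    refine Integrable.mono' hRi (by fun_prop) ?_
    refine (ae_restrict_mem measurableSet_Ioi).mono fun y hy => ?_
    rw [Real.norm_of_nonneg (smul_nonneg (pow_nonneg (le_of_lt hy) _) (hFn y))]
    exact hle y hy
  have hFi : Integrable (fun x : V => F ‖x‖) := (integrable_fun_norm_addHaar volume).2 hLi
  rw [← ofReal_integral_eq_lintegral_ofReal hFi (Eventually.of_forall fun _ => hFn _), integral_fun_norm_addHaar volume F,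
    nsmul_eq_mul, smul_eq_mul, ← mul_assoc, ← hB, mul_assoc B]
  refine ENNReal.ofReal_le_ofReal (mul_le_mul_of_nonneg_left ?_ hB0)
  calc _ ≤ ∫ y in Set.Ioi (0 : ℝ), |2 * y| • H (y ^ 2 - c ^ 2) := setIntegral_mono_on hLi hRi measurableSet_Ioi hle
    _ = ∫ v in (fun y : ℝ => y ^ 2 - c ^ 2) '' Set.Ioi 0, H v :=
        (integral_image_eq_integral_abs_deriv_smul measurableSet_Ioi hder hinj H).symm
    _ ≤ ∫ v, H v := setIntegral_le_integral hHi (Eventually.of_forall fun v => by simp only [hH, Pi.zero_apply]; positivity)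
    _ = _ := by rw [hHt]; ring

theorem lintegral_gk {a : ℝ} (ha : 0 < a) (ξ : V) : ∫⁻ η : V, ENNReal.ofReal (gk a (ξ - η)) = 1 := by
  rw [lintegral_sub_left_eq_self (fun η : V => ENNReal.ofReal (gk a η)) ξ]
  have h0 := integral_gauss (V := V) ha
  have hp : 0 < Real.pi ^ 2 / a := by positivity
  have hi := (GaussianFourier.integral_rexp_neg_mul_sq_norm (V := V) hp)
  have e : ∀ η : V, gk a η = (Real.pi / a) ^ (Module.finrank ℝ V / 2 : ℝ) * Real.exp (-(Real.pi ^ 2 / a) * ‖η‖ ^ 2) := by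
    intro η; rw [gk]; congr 2; ring
  have hint : Integrable fun η : V => Real.exp (-(Real.pi ^ 2 / a) * ‖η‖ ^ 2) := by
    by_contra h
    rw [integral_undef h] at hi
    exact absurd hi (ne_of_lt (by positivity))
  simp_rw [e]
  rw [← ofReal_integral_eq_lintegral_ofReal (hint.const_mul _) (Eventually.of_forall fun η => by
      simp only [Pi.zero_apply]; positivity),
    integral_const_mul, hi, ← Real.mul_rpow (by positivity) (by positivity)]
  rw [show Real.pi / a * (Real.pi / (Real.pi ^ 2 / a)) = 1 by field_simp, Real.one_rpow, ENNReal.ofReal_one]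

theorem lintegral_Ioi_rpow {r A : ℝ} (hr : r < -1) (hA : 0 < A) :
    ∫⁻ a in Set.Ioi A, ENNReal.ofReal (a ^ r) = ENNReal.ofReal (-A ^ (r + 1) / (r + 1)) := by
  rw [← integral_Ioi_rpow_of_lt hr hA, ofReal_integral_eq_lintegral_ofReal (integrableOn_Ioi_rpow_of_lt hr hA)]
  refine (ae_restrict_mem measurableSet_Ioi).mono fun y hy => ?_
  have : 0 < y := hA.trans hy
  simp only [Pi.zero_apply]; positivity

/-- Low-frequency bound for the smoothing kernel averaged over all scales. -/
theorem lintegral_scale_kernel_le (hd : 3 ≤ Module.finrank ℝ V) : ∃ C : ℝ, 0 ≤ C ∧ ∀ ε : ℝ, 0 < ε → ∀ ξ : V, ξ ≠ 0 →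
    ∫⁻ a in Set.Ioi (0 : ℝ), ∫⁻ η, ENNReal.ofReal (gk ε (2 * Real.pi * (‖η‖ ^ 2 - ‖ξ‖ ^ 2)) * gk a (ξ - η)) ≤ ENNReal.ofReal C := by
  obtain ⟨C₁, hC₁, h₁⟩ := lintegral_kernel_le_inv_norm (V := V) hd
  obtain ⟨C₂, hC₂, h₂⟩ := lintegral_gk_sphere_le (V := V) hd
  set m : ℝ := Module.finrank ℝ V / 2 - 1 with hm
  have hd' : (3 : ℝ) ≤ Module.finrank ℝ V := by exact_mod_cast hd
  have hm0 : 0 < m := by linarith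
  set P : ℝ := Real.pi ^ (Module.finrank ℝ V / 2 : ℝ) with hP
  refine ⟨(2 * C₁ + Real.sqrt Real.pi) + P * C₂ / m, by positivity, fun ε hε ξ hξ => ?_⟩
  have hξ0 : 0 < ‖ξ‖ := norm_pos_iff.2 hξ
  have hse : 0 < Real.sqrt ε := Real.sqrt_pos.2 hε
  set A : ℝ := max (‖ξ‖ ^ 2) (Real.sqrt ε) with hA
  have hA0 : 0 < A := hse.trans_le (le_max_right _ _)
  rw [← Set.Ioc_union_Ioi_eq_Ioi hA0.le, lintegral_union measurableSet_Ioi Set.Ioc_disjoint_Ioi_same,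
    ENNReal.ofReal_add (by positivity) (by positivity)]
  refine add_le_add ?_ ?_
  · rcases le_total (Real.sqrt ε) (‖ξ‖ ^ 2) with h | h
    · have hA' : A = ‖ξ‖ ^ 2 := max_eq_left h
      calc _ ≤ ∫⁻ a in Set.Ioc 0 A, ENNReal.ofReal (C₁ * ‖ξ‖⁻¹) * ENNReal.ofReal (a ^ (-(1 / 2) : ℝ)) := by
            refine setLIntegral_mono' measurableSet_Ioc fun a ha => ?_
            rw [← ENNReal.ofReal_mul (by positivity), mul_assoc]
            exact h₁ a ε ha.1 hε ξ hξ
        _ = ENNReal.ofReal (2 * C₁) := by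
            rw [lintegral_const_mul' _ _ ENNReal.ofReal_ne_top, lintegral_Ioc_rpow (by norm_num) hA0.le,
              ← ENNReal.ofReal_mul (by positivity), hA',
              show (-(1 / 2) + 1 : ℝ) = 1 / 2 by norm_num, ← Real.sqrt_eq_rpow, Real.sqrt_sq hξ0.le]
            congr 1
            field_simp
        _ ≤ _ := ENNReal.ofReal_le_ofReal (le_add_of_nonneg_right (by positivity))
    · have hA' : A = Real.sqrt ε := max_eq_right h
      calc _ ≤ ∫⁻ a in Set.Ioc 0 A, ENNReal.ofReal ((Real.pi / ε) ^ (1 / 2 : ℝ)) := by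
            refine setLIntegral_mono' measurableSet_Ioc fun a ha => ?_
            calc _ ≤ ∫⁻ η, ENNReal.ofReal ((Real.pi / ε) ^ (1 / 2 : ℝ)) * ENNReal.ofReal (gk a (ξ - η)) := by
                  refine lintegral_mono fun η => ?_
                  rw [← ENNReal.ofReal_mul (by positivity)]
                  refine ENNReal.ofReal_le_ofReal (mul_le_mul_of_nonneg_right ?_ (gk_nonneg ha.1 _))
                  simp only [gk, Module.finrank_self, Nat.cast_one]
                  refine mul_le_of_le_one_right (by positivity) (Real.exp_le_one_iff.2 (neg_nonpos.2 (by positivity)))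
              _ = _ := by rw [lintegral_const_mul' _ _ ENNReal.ofReal_ne_top, lintegral_gk ha.1, mul_one]
        _ = ENNReal.ofReal (Real.sqrt Real.pi) := by
            rw [setLIntegral_const, Real.volume_Ioc, sub_zero, ← ENNReal.ofReal_mul (by positivity), hA', ← Real.sqrt_eq_rpow,
              ← Real.sqrt_mul (by positivity), div_mul_cancel₀ _ hε.ne']
        _ ≤ _ := ENNReal.ofReal_le_ofReal (le_add_of_nonneg_left (by positivity))
  · calc _ ≤ ∫⁻ a in Set.Ioi A, ENNReal.ofReal (P * (C₂ * A ^ m)) * ENNReal.ofReal (a ^ (-(m + 1))) := by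
          refine setLIntegral_mono' measurableSet_Ioi fun a ha => ?_
          have ha0 : 0 < a := hA0.trans ha
          calc _ ≤ ∫⁻ η, ENNReal.ofReal (P * a ^ (-(m + 1))) * ENNReal.ofReal (gk ε (2 * Real.pi * (‖η‖ ^ 2 - ‖ξ‖ ^ 2))) := by
                refine lintegral_mono fun η => ?_
                rw [← ENNReal.ofReal_mul (by positivity), mul_comm]
                refine ENNReal.ofReal_le_ofReal (mul_le_mul_of_nonneg_right ?_ (gk_nonneg hε _))
                rw [gk, Real.div_rpow (by positivity) ha0.le, Real.rpow_neg ha0.le, ← div_eq_mul_inv,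
                  show m + 1 = (Module.finrank ℝ V / 2 : ℝ) by rw [hm]; ring]
                refine mul_le_of_le_one_right (by positivity) (Real.exp_le_one_iff.2 (neg_nonpos.2 (by positivity)))
            _ ≤ ENNReal.ofReal (P * a ^ (-(m + 1))) * ENNReal.ofReal (C₂ * A ^ m) := by
                rw [lintegral_const_mul' _ _ ENNReal.ofReal_ne_top]
                gcongr
                exact h₂ ε ‖ξ‖ A hε (le_max_left _ _) (le_max_right _ _)
            _ = _ := by
                rw [← ENNReal.ofReal_mul (by positivity), ← ENNReal.ofReal_mul (by positivity)]; congr 1; ring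
      _ = _ := by
          rw [lintegral_const_mul' _ _ ENNReal.ofReal_ne_top, lintegral_Ioi_rpow (by linarith) hA0,
            ← ENNReal.ofReal_mul (by positivity)]
          congr 1
          have : A ^ m * A ^ (-m) = 1 := by rw [← Real.rpow_add hA0]; simp
          rw [show -(m + 1) + 1 = -m by ring, neg_div_neg_eq, mul_div_assoc', mul_assoc, mul_assoc, this, mul_one]

end LowFrequency

section LocalSmoothing

variable {V : Type*} [NormedAddCommGroup V] [InnerProductSpace ℝ V] [FiniteDimensional ℝ V]
  [MeasurableSpace V] [BorelSpace V]

theorem lintegral_enorm_sq_toLp (φ : 𝓢(V, ℂ)) : ∫⁻ x, ‖φ x‖ₑ ^ 2 = ‖φ.toLp 2 volume‖ₑ ^ 2 := by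
  rw [SchwartzMap.toLp, Lp.enorm_toLp, eLpNorm_eq_lintegral_rpow_enorm_toReal (by norm_num) (by norm_num)]
  simp only [ENNReal.toReal_ofNat, ENNReal.rpow_ofNat, one_div]
  rw [← ENNReal.rpow_two, ← ENNReal.rpow_mul]
  norm_num

theorem lintegral_enorm_sq_fourier (φ : 𝓢(V, ℂ)) : ∫⁻ ξ, ‖𝓕 φ ξ‖ₑ ^ 2 = ‖φ.toLp 2 volume‖ₑ ^ 2 := by
  rw [lintegral_enorm_sq_toLp (𝓕 φ), ← ofReal_norm, norm_fourier_toL2_eq, ofReal_norm]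

theorem lintegral_exp_scale {b : ℝ} (hb : 0 < b) :
    ∫⁻ a in Set.Ioi (0 : ℝ), ENNReal.ofReal (Real.exp (-b * a)) = ENNReal.ofReal b⁻¹ := by
  rw [← ofReal_integral_eq_lintegral_ofReal (integrableOn_exp_mul_Ioi (neg_lt_zero.2 hb) 0) (Eventually.of_forall fun _ => Real.exp_nonneg _),
    integral_exp_mul_Ioi (neg_lt_zero.2 hb)]
  simp [div_neg, neg_div]

/-- Weighted space-time bounds for the free evolution reduce to bounds on the averaged Gaussian kernel. -/
theorem lintegral_weight_uS_le (R : V → ℝ≥0∞)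
    (hR : ∀ ε : ℝ, 0 < ε → ∀ ξ : V, ξ ≠ 0 → ∫⁻ a in Set.Ioi (0 : ℝ), ENNReal.ofReal (Real.exp (-a)) *
      ∫⁻ η, ENNReal.ofReal (gk ε (2 * Real.pi * (‖η‖ ^ 2 - ‖ξ‖ ^ 2)) * gk a (ξ - η)) ≤ R ξ) [Nontrivial V] (φ : 𝓢(V, ℂ)) :
    ∫⁻ s : ℝ, ∫⁻ x, ENNReal.ofReal ((1 + ‖x‖ ^ 2)⁻¹) * ‖uS s φ x‖ₑ ^ 2 ≤ ∫⁻ ξ, ‖𝓕 φ ξ‖ₑ ^ 2 * R ξ := by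
  have hum : Measurable fun z : ℝ × V => ‖uS z.1 φ z.2‖ₑ ^ 2 :=
    (continuous_uS_apply φ).measurable.enorm.pow_const 2
  set G : ℝ → ℝ≥0∞ := fun s => ∫⁻ x, ENNReal.ofReal ((1 + ‖x‖ ^ 2)⁻¹) * ‖uS s φ x‖ₑ ^ 2 with hG
  have hGm : Measurable G := by
    refine Measurable.lintegral_prod_right' (f := fun z : ℝ × V => ENNReal.ofReal ((1 + ‖z.2‖ ^ 2)⁻¹) * ‖uS z.1 φ z.2‖ₑ ^ 2) ?_
    exact (by fun_prop : Measurable fun z : ℝ × V => ENNReal.ofReal ((1 + ‖z.2‖ ^ 2)⁻¹)).mul hum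
  have key : ∀ ε : ℝ, 0 < ε → ∫⁻ s : ℝ, ENNReal.ofReal (Real.exp (-(ε * s ^ 2))) * G s ≤ ∫⁻ ξ, ‖𝓕 φ ξ‖ₑ ^ 2 * R ξ := by
    intro ε hε
    set Q : ℝ → V → ℝ≥0∞ := fun a ξ => ∫⁻ η, ENNReal.ofReal (gk ε (2 * Real.pi * (‖η‖ ^ 2 - ‖ξ‖ ^ 2)) * gk a (ξ - η)) with hQ
    have hQm : Measurable (Function.uncurry Q) := by
      have h1 := (continuous_gk (V := ℝ) ε).measurable
      refine Measurable.lintegral_prod_right' (f := fun z : (ℝ × V) × V =>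
        ENNReal.ofReal (gk ε (2 * Real.pi * (‖z.2‖ ^ 2 - ‖z.1.2‖ ^ 2)) * gk z.1.1 (z.1.2 - z.2))) ?_
      refine ENNReal.measurable_ofReal.comp (Measurable.mul (h1.comp (by fun_prop)) ?_)
      unfold gk
      fun_prop
    set f : ℝ → ℝ → V → ℝ≥0∞ := fun a s x => ENNReal.ofReal (Real.exp (-a)) *
      (ENNReal.ofReal (Real.exp (-(ε * s ^ 2 + a * ‖x‖ ^ 2))) * ‖uS s φ x‖ₑ ^ 2) with hf
    have hfm : Measurable fun z : (ℝ × ℝ) × V => f z.1.1 z.1.2 z.2 := by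
      have h2 : Measurable fun z : (ℝ × ℝ) × V => ‖uS z.1.2 φ z.2‖ₑ ^ 2 :=
        hum.comp (g := fun z : ℝ × V => ‖uS z.1 φ z.2‖ₑ ^ 2) (f := fun z : (ℝ × ℝ) × V => (z.1.2, z.2)) (by fun_prop)
      exact (by fun_prop : Measurable fun z : (ℝ × ℝ) × V => ENNReal.ofReal (Real.exp (-z.1.1))).mul
        ((by fun_prop : Measurable fun z : (ℝ × ℝ) × V => ENNReal.ofReal (Real.exp (-(ε * z.1.2 ^ 2 + z.1.1 * ‖z.2‖ ^ 2)))).mul h2)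
    have e1 : ∫⁻ s : ℝ, ENNReal.ofReal (Real.exp (-(ε * s ^ 2))) * G s = ∫⁻ a in Set.Ioi (0 : ℝ), ∫⁻ s, ∫⁻ x, f a s x := by
      rw [lintegral_lintegral_swap]
      · refine lintegral_congr fun s => ?_
        rw [lintegral_lintegral_swap]
        · rw [hG, ← lintegral_const_mul' _ _ ENNReal.ofReal_ne_top]
          refine lintegral_congr fun x => ?_
          have h3 : ∀ a, f a s x = ENNReal.ofReal (Real.exp (-(1 + ‖x‖ ^ 2) * a)) *
              (ENNReal.ofReal (Real.exp (-(ε * s ^ 2))) * ‖uS s φ x‖ₑ ^ 2) := by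
            intro a
            simp only [hf]
            rw [← mul_assoc, ← mul_assoc, ← ENNReal.ofReal_mul (Real.exp_nonneg _), ← ENNReal.ofReal_mul (Real.exp_nonneg _),
              ← Real.exp_add, ← Real.exp_add]
            congr 3; ring
          simp_rw [h3]
          rw [lintegral_mul_const _ (by fun_prop), lintegral_exp_scale (by positivity)]
          ring
        · exact (hfm.comp (f := fun z : ℝ × V => ((z.1, s), z.2)) (by fun_prop)).aemeasurable
      · exact (Measurable.lintegral_prod_right' (f := fun z : (ℝ × ℝ) × V => f z.1.1 z.1.2 z.2) hfm).aemeasurable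
    rw [e1]
    calc _ ≤ ∫⁻ a in Set.Ioi (0 : ℝ), ∫⁻ ξ, ENNReal.ofReal (Real.exp (-a)) * (‖𝓕 φ ξ‖ₑ ^ 2 * Q a ξ) := by
          refine setLIntegral_mono' measurableSet_Ioi fun a ha => ?_
          simp only [hf]
          simp_rw [lintegral_const_mul' _ _ (ENNReal.ofReal_ne_top (r := Real.exp (-a)))]
          gcongr
          exact lintegral_gauss_uS_le ha hε φ
      _ = ∫⁻ ξ, ‖𝓕 φ ξ‖ₑ ^ 2 * ∫⁻ a in Set.Ioi (0 : ℝ), ENNReal.ofReal (Real.exp (-a)) * Q a ξ := by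
          rw [lintegral_lintegral_swap]
          · refine lintegral_congr fun ξ => ?_
            rw [← lintegral_const_mul' _ _ (by simp)]
            refine lintegral_congr fun a => by ring
          · have h4 : Measurable fun z : ℝ × V => ‖𝓕 φ z.2‖ₑ ^ 2 :=
              ((𝓕 φ).continuous.measurable.enorm.pow_const 2).comp measurable_snd
            exact ((by fun_prop : Measurable fun z : ℝ × V => ENNReal.ofReal (Real.exp (-z.1))).mul (h4.mul hQm)).aemeasurable
      _ ≤ _ := by
          refine lintegral_mono_ae ?_
          have : ∀ᵐ ξ : V, ξ ≠ 0 := by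
            rw [ae_iff]; simp
          filter_upwards [this] with ξ hξ
          gcongr
          exact hR ε hε ξ hξ
  have hlim : ∀ s, Tendsto (fun k : ℕ => ENNReal.ofReal (Real.exp (-(1 / ((k : ℝ) + 1) * s ^ 2))) * G s) atTop (𝓝 (G s)) := by
    intro s
    have h5 : Tendsto (fun k : ℕ => Real.exp (-(1 / ((k : ℝ) + 1) * s ^ 2))) atTop (𝓝 1) := by
      have := (Real.continuous_exp.tendsto _).comp ((tendsto_one_div_add_atTop_nhds_zero_nat (𝕜 := ℝ)).mul_const (s ^ 2)).neg
      simpa [Function.comp_def] using this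
    have h6 := ENNReal.Tendsto.mul_const (b := G s) (ENNReal.tendsto_ofReal h5) (Or.inl (by simp))
    simpa using h6
  calc ∫⁻ s, G s = ∫⁻ s, liminf (fun k : ℕ => ENNReal.ofReal (Real.exp (-(1 / ((k : ℝ) + 1) * s ^ 2))) * G s) atTop :=
        lintegral_congr fun s => (hlim s).liminf_eq.symm
    _ ≤ liminf (fun k : ℕ => ∫⁻ s, ENNReal.ofReal (Real.exp (-(1 / ((k : ℝ) + 1) * s ^ 2))) * G s) atTop :=
        lintegral_liminf_le fun k => (by fun_prop : Measurable fun s : ℝ => ENNReal.ofReal (Real.exp (-(1 / ((k : ℝ) + 1) * s ^ 2)))).mul hGm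
    _ ≤ _ := liminf_le_of_le (by isBoundedDefault) fun b hb => by
        obtain ⟨k, hk⟩ := hb.exists
        exact hk.trans (key _ (by positivity))

/-- Local smoothing: a weighted space-time norm gains half a derivative. -/
theorem lintegral_weight_uS_le_inv_norm (hd : 3 ≤ Module.finrank ℝ V) : ∃ C : ℝ, 0 ≤ C ∧ ∀ φ : 𝓢(V, ℂ),
    ∫⁻ s : ℝ, ∫⁻ x, ENNReal.ofReal ((1 + ‖x‖ ^ 2)⁻¹) * ‖uS s φ x‖ₑ ^ 2 ≤ ∫⁻ ξ, ‖𝓕 φ ξ‖ₑ ^ 2 * ENNReal.ofReal (C * ‖ξ‖⁻¹) := by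
  have : Nontrivial V := Module.nontrivial_of_finrank_pos (R := ℝ) (by omega)
  obtain ⟨C, hC, h⟩ := lintegral_kernel_le_inv_norm (V := V) hd
  have hi := Real.GammaIntegral_convergent (s := 1 / 2) (by norm_num)
  set G : ℝ := ∫ a in Set.Ioi (0 : ℝ), Real.exp (-a) * a ^ (1 / 2 - 1 : ℝ) with hG
  have hpos : ∀ a ∈ Set.Ioi (0 : ℝ), 0 ≤ Real.exp (-a) * a ^ (1 / 2 - 1 : ℝ) := fun a ha => by
    have : 0 < a := ha
    positivity
  have hG0 : 0 ≤ G := setIntegral_nonneg measurableSet_Ioi hpos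
  refine ⟨C * G, by positivity, fun φ => lintegral_weight_uS_le _ (fun ε hε ξ hξ => ?_) φ⟩
  calc _ ≤ ∫⁻ a in Set.Ioi (0 : ℝ), ENNReal.ofReal (C * ‖ξ‖⁻¹) * ENNReal.ofReal (Real.exp (-a) * a ^ (1 / 2 - 1 : ℝ)) := by
        refine setLIntegral_mono' measurableSet_Ioi fun a ha => ?_
        refine (mul_le_mul_right (h a ε ha hε ξ hξ) _).trans_eq ?_
        rw [← ENNReal.ofReal_mul (by positivity), ← ENNReal.ofReal_mul (by positivity)]
        congr 1
        norm_num
        ring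
    _ = _ := by
        rw [lintegral_const_mul' _ _ ENNReal.ofReal_ne_top, ← ofReal_integral_eq_lintegral_ofReal hi
          ((ae_restrict_mem measurableSet_Ioi).mono hpos), ← ENNReal.ofReal_mul (by positivity)]
        congr 1; ring

/-- The weight `⟨x⟩⁻¹` makes the free evolution square integrable in space-time. -/
theorem lintegral_weight_uS_le_norm (hd : 3 ≤ Module.finrank ℝ V) : ∃ C : ℝ, 0 ≤ C ∧ ∀ φ : 𝓢(V, ℂ),
    ∫⁻ s : ℝ, ∫⁻ x, ENNReal.ofReal ((1 + ‖x‖ ^ 2)⁻¹) * ‖uS s φ x‖ₑ ^ 2 ≤ ENNReal.ofReal C * ‖φ.toLp 2 volume‖ₑ ^ 2 := by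
  have : Nontrivial V := Module.nontrivial_of_finrank_pos (R := ℝ) (by omega)
  obtain ⟨C, hC, h⟩ := lintegral_scale_kernel_le (V := V) hd
  refine ⟨C, hC, fun φ => (lintegral_weight_uS_le (fun _ => ENNReal.ofReal C) (fun ε hε ξ hξ => ?_) φ).trans ?_⟩
  · refine le_trans (setLIntegral_mono' measurableSet_Ioi fun a ha => ?_) (h ε hε ξ hξ)
    refine mul_le_of_le_one_left (zero_le (a := _)) ?_
    rw [ENNReal.ofReal_le_one, Real.exp_le_one_iff]
    exact neg_nonpos.2 (le_of_lt ha)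
  · rw [lintegral_mul_const' _ _ ENNReal.ofReal_ne_top, lintegral_enorm_sq_fourier, mul_comm]

theorem lintegral_sym_sub_one_le (ξ : V) (hξ : ξ ≠ 0) :
    ∫⁻ τ in Set.Ioc (0 : ℝ) 1, ENNReal.ofReal (τ ^ (-(3 / 2) : ℝ)) * ‖sym τ ξ - 1‖ₑ ^ 2 ≤ ENNReal.ofReal (18 * Real.pi * ‖ξ‖) := by
  have hξ0 : 0 < ‖ξ‖ := norm_pos_iff.2 hξ
  set L : ℝ := 2 * Real.pi * ‖ξ‖ with hL
  have hL0 : 0 < L := by positivity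
  have hs1 : ∀ τ, ‖sym τ ξ - 1‖ₑ ^ 2 ≤ ENNReal.ofReal (L ^ 4 * τ ^ 2) := by
    intro τ
    have h := Real.norm_exp_I_mul_ofReal_sub_one_le (x := -(4 * Real.pi ^ 2 * τ * ‖ξ‖ ^ 2))
    rw [mul_comm Complex.I] at h
    rw [← ofReal_norm, ← ENNReal.ofReal_pow (norm_nonneg _)]
    refine ENNReal.ofReal_le_ofReal ((pow_le_pow_left₀ (norm_nonneg _) h 2).trans_eq ?_)
    rw [Real.norm_eq_abs, sq_abs, hL]; ring
  have hs2 : ∀ τ, ‖sym τ ξ - 1‖ₑ ^ 2 ≤ ENNReal.ofReal 4 := by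
    intro τ
    rw [← ofReal_norm, ← ENNReal.ofReal_pow (norm_nonneg _)]
    refine ENNReal.ofReal_le_ofReal ?_
    have := norm_sub_le (sym τ ξ) 1
    rw [norm_sym, norm_one] at this
    nlinarith [norm_nonneg (sym τ ξ - 1)]
  have hA : 0 < (L ^ 2)⁻¹ := by positivity
  calc _ ≤ ∫⁻ τ in Set.Ioi (0 : ℝ), ENNReal.ofReal (τ ^ (-(3 / 2) : ℝ)) * ‖sym τ ξ - 1‖ₑ ^ 2 :=
        lintegral_mono_set Set.Ioc_subset_Ioi_self
    _ = (∫⁻ τ in Set.Ioc (0 : ℝ) (L ^ 2)⁻¹, ENNReal.ofReal (τ ^ (-(3 / 2) : ℝ)) * ‖sym τ ξ - 1‖ₑ ^ 2) +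
        ∫⁻ τ in Set.Ioi (L ^ 2)⁻¹, ENNReal.ofReal (τ ^ (-(3 / 2) : ℝ)) * ‖sym τ ξ - 1‖ₑ ^ 2 := by
        rw [← Set.Ioc_union_Ioi_eq_Ioi hA.le, lintegral_union measurableSet_Ioi Set.Ioc_disjoint_Ioi_same]
    _ ≤ (∫⁻ τ in Set.Ioc (0 : ℝ) (L ^ 2)⁻¹, ENNReal.ofReal (L ^ 4) * ENNReal.ofReal (τ ^ (1 / 2 : ℝ))) +
        ∫⁻ τ in Set.Ioi (L ^ 2)⁻¹, ENNReal.ofReal 4 * ENNReal.ofReal (τ ^ (-(3 / 2) : ℝ)) := by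
        refine add_le_add (setLIntegral_mono' measurableSet_Ioc fun τ hτ => ?_) (setLIntegral_mono' measurableSet_Ioi fun τ hτ => ?_)
        · have h0 : 0 < τ := hτ.1
          refine (mul_le_mul_right (hs1 τ) _).trans_eq ?_
          rw [← ENNReal.ofReal_mul (by positivity), ← ENNReal.ofReal_mul (by positivity)]
          congr 1
          have : τ ^ (1 / 2 : ℝ) = τ ^ (-(3 / 2) : ℝ) * τ ^ 2 := by
            rw [← Real.rpow_natCast, ← Real.rpow_add h0]; norm_num
          rw [this]; ring
        · rw [mul_comm]
          exact mul_le_mul_left (hs2 τ) _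
    _ = ENNReal.ofReal (L ^ 4 * ((L ^ 2)⁻¹ ^ (1 / 2 + 1 : ℝ) / (1 / 2 + 1)) + 4 * (-(L ^ 2)⁻¹ ^ (-(3 / 2) + 1 : ℝ) / (-(3 / 2) + 1))) := by
        have hneg : -(L ^ 2)⁻¹ ^ (-(3 / 2) + 1 : ℝ) / (-(3 / 2) + 1) = 2 * (L ^ 2)⁻¹ ^ (-(3 / 2) + 1 : ℝ) := by
          norm_num; ring
        rw [lintegral_const_mul' _ _ ENNReal.ofReal_ne_top, lintegral_const_mul' _ _ ENNReal.ofReal_ne_top,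
          lintegral_Ioc_rpow (by norm_num) hA.le, lintegral_Ioi_rpow (by norm_num) hA, hneg,
          ← ENNReal.ofReal_mul (by positivity), ← ENNReal.ofReal_mul (by positivity), ENNReal.ofReal_add (by positivity) (by positivity)]
    _ ≤ _ := by
        refine ENNReal.ofReal_le_ofReal ?_
        have e1 : (L ^ 2)⁻¹ ^ (1 / 2 + 1 : ℝ) = (L ^ 3)⁻¹ := by
          rw [Real.inv_rpow (by positivity), ← Real.rpow_natCast, ← Real.rpow_mul hL0.le]; norm_num
        have e2 : (L ^ 2)⁻¹ ^ (-(3 / 2) + 1 : ℝ) = L := by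
          rw [Real.inv_rpow (by positivity), ← Real.rpow_natCast, ← Real.rpow_mul hL0.le, ← Real.rpow_neg hL0.le]; norm_num
        rw [e1, e2]
        have e3 : L ^ 4 * ((L ^ 3)⁻¹ / (1 / 2 + 1)) + 4 * (-L / (-(3 / 2) + 1)) = 26 / 3 * L := by
          field_simp; norm_num
        rw [e3, hL]
        have : 0 < Real.pi * ‖ξ‖ := by positivity
        nlinarith

/-- Quarter-order time regularity of the weighted free evolution. -/
theorem lintegral_weight_uS_diff_le (hd : 3 ≤ Module.finrank ℝ V) : ∃ C : ℝ, 0 ≤ C ∧ ∀ φ : 𝓢(V, ℂ),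
    ∫⁻ τ in Set.Ioc (0 : ℝ) 1, ENNReal.ofReal (τ ^ (-(3 / 2) : ℝ)) *
      ∫⁻ s : ℝ, ∫⁻ x, ENNReal.ofReal ((1 + ‖x‖ ^ 2)⁻¹) * ‖uS (s + τ) φ x - uS s φ x‖ₑ ^ 2 ≤
      ENNReal.ofReal C * ‖φ.toLp 2 volume‖ₑ ^ 2 := by
  have : Nontrivial V := Module.nontrivial_of_finrank_pos (R := ℝ) (by omega)
  obtain ⟨C, hC, h⟩ := lintegral_weight_uS_le_inv_norm (V := V) hd
  refine ⟨C * (18 * Real.pi), by positivity, fun φ => ?_⟩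
  have h1 : ∀ τ : ℝ, ∫⁻ s : ℝ, ∫⁻ x, ENNReal.ofReal ((1 + ‖x‖ ^ 2)⁻¹) * ‖uS (s + τ) φ x - uS s φ x‖ₑ ^ 2 ≤
      ∫⁻ ξ, ‖sym τ ξ - 1‖ₑ ^ 2 * (‖𝓕 φ ξ‖ₑ ^ 2 * ENNReal.ofReal (C * ‖ξ‖⁻¹)) := by
    intro τ
    refine (le_of_eq ?_).trans ((h (uS τ φ - φ)).trans_eq ?_)
    · refine lintegral_congr fun s => lintegral_congr fun x => ?_
      rw [map_sub, uS_add, sub_apply]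
    · refine lintegral_congr fun ξ => ?_
      have : 𝓕 (uS τ φ - φ) ξ = (sym τ ξ - 1) * 𝓕 φ ξ := by
        have e : 𝓕 (uS τ φ - φ) = 𝓕 (uS τ φ) - 𝓕 φ := map_sub (fourierCLM ℂ 𝓢(V, ℂ)) _ _
        rw [e, sub_apply, fourier_uS]; ring
      rw [this, enorm_mul, mul_pow, mul_assoc]
  calc _ ≤ ∫⁻ τ in Set.Ioc (0 : ℝ) 1, ∫⁻ ξ, ENNReal.ofReal (τ ^ (-(3 / 2) : ℝ)) *
          (‖sym τ ξ - 1‖ₑ ^ 2 * (‖𝓕 φ ξ‖ₑ ^ 2 * ENNReal.ofReal (C * ‖ξ‖⁻¹))) := by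
        refine lintegral_mono fun τ => ?_
        simp only
        rw [lintegral_const_mul' _ _ ENNReal.ofReal_ne_top]
        gcongr
        exact h1 τ
    _ = ∫⁻ ξ, (∫⁻ τ in Set.Ioc (0 : ℝ) 1, ENNReal.ofReal (τ ^ (-(3 / 2) : ℝ)) * ‖sym τ ξ - 1‖ₑ ^ 2) *
          (‖𝓕 φ ξ‖ₑ ^ 2 * ENNReal.ofReal (C * ‖ξ‖⁻¹)) := by
        rw [lintegral_lintegral_swap]
        · refine lintegral_congr fun ξ => ?_
          rw [← lintegral_mul_const' _ _ (ENNReal.mul_ne_top (by simp) ENNReal.ofReal_ne_top)]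
          refine lintegral_congr fun τ => by ring
        · have h2 : Measurable fun z : ℝ × V => ‖𝓕 φ z.2‖ₑ ^ 2 :=
            ((𝓕 φ).continuous.measurable.enorm.pow_const 2).comp measurable_snd
          have h3 : Measurable fun z : ℝ × V => ‖sym z.1 z.2 - 1‖ₑ ^ 2 := by
            have := continuous_sym (V := V)
            exact (Continuous.measurable (by fun_prop : Continuous fun z : ℝ × V => sym z.1 z.2 - 1)).enorm.pow_const 2
          exact ((by fun_prop : Measurable fun z : ℝ × V => ENNReal.ofReal (z.1 ^ (-(3 / 2) : ℝ))).mul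
            (h3.mul (h2.mul (by fun_prop)))).aemeasurable
    _ ≤ ∫⁻ ξ, ENNReal.ofReal (C * (18 * Real.pi)) * ‖𝓕 φ ξ‖ₑ ^ 2 := by
        refine lintegral_mono_ae ?_
        have : ∀ᵐ ξ : V, ξ ≠ 0 := by rw [ae_iff]; simp
        filter_upwards [this] with ξ hξ
        have hξ0 : 0 < ‖ξ‖ := norm_pos_iff.2 hξ
        refine (mul_le_mul_left (lintegral_sym_sub_one_le ξ hξ) _).trans_eq ?_
        rw [mul_left_comm, ← ENNReal.ofReal_mul (by positivity), mul_comm]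
        congr 2; field_simp
    _ = _ := by rw [lintegral_const_mul' _ _ ENNReal.ofReal_ne_top, lintegral_enorm_sq_fourier]

end LocalSmoothing

section FractionalDuality

theorem sq_lintegral_mul_le {α : Type*} [MeasurableSpace α] {μ : Measure α} {f g : α → ℝ≥0∞}
    (hf : AEMeasurable f μ) (hg : AEMeasurable g μ) :
    (∫⁻ a, f a * g a ∂μ) ^ 2 ≤ (∫⁻ a, f a ^ 2 ∂μ) * ∫⁻ a, g a ^ 2 ∂μ := by
  have h := ENNReal.lintegral_mul_le_Lp_mul_Lq μ Real.HolderConjugate.two_two hf hg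
  refine (pow_le_pow_left₀ (zero_le (a := _)) h 2).trans_eq ?_
  rw [mul_pow, ← ENNReal.rpow_two, ← ENNReal.rpow_two, ← ENNReal.rpow_mul, ← ENNReal.rpow_mul]
  simp

theorem continuous_fourier_of_integrable {w : ℝ → ℂ} (h1 : Integrable w) : Continuous (𝓕 w) :=
  VectorFourier.fourierIntegral_continuous Real.continuous_fourierChar
    (by exact continuous_inner) h1

theorem lintegral_fourier_sq_le {w : ℝ → ℂ} (h1 : Integrable w) (h2 : MemLp w 2) :
    ∫⁻ ν, ‖𝓕 w ν‖ₑ ^ 2 ≤ ∫⁻ s, ‖w s‖ₑ ^ 2 := by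
  have hc := continuous_fourier_of_integrable h1
  have h : (𝓕 (h2.toLp w) : L2 ℝ) =ᵐ[volume] 𝓕 w := by
    refine ae_eq_of_schwartz ((Lp.memLp _).locallyIntegrable (by norm_num)) hc.locallyIntegrable fun ψ _ => ?_
    rw [← inner_toLp]
    have e0 : ψ.toLp 2 volume = 𝓕 ((𝓕⁻ ψ).toLp 2 volume) := by
      rw [SchwartzMap.toLp_fourier_eq]; simp
    rw [e0, Lp.inner_fourier_eq, inner_toLp]
    have e1 : ∫ x, conj ((𝓕⁻ ψ) x) * (h2.toLp w : ℝ → ℂ) x = ∫ x, ∫ ν, conj (ψ ν) * (Complex.exp (((-2 * Real.pi * x * ν : ℝ) : ℂ) * Complex.I) * w x) := by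
      refine integral_congr_ae ?_
      filter_upwards [h2.coeFn_toLp] with x hx
      rw [hx, fourierInv_coe, Real.fourierInv_eq', ← integral_conj, ← integral_mul_const]
      refine integral_congr_ae (Eventually.of_forall fun ν => ?_)
      simp only [smul_eq_mul, map_mul, ← Complex.exp_conj, Complex.conj_ofReal, Complex.conj_I, RCLike.inner_apply, conj_trivial]
      rw [show ((2 * Real.pi * (x * ν) : ℝ) : ℂ) * -Complex.I = ((-2 * Real.pi * x * ν : ℝ) : ℂ) * Complex.I by push_cast; ring]
      ring
    rw [e1, integral_integral_swap]
    · refine integral_congr_ae (Eventually.of_forall fun ν => ?_)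
      simp only
      rw [integral_const_mul, Real.fourier_real_eq_integral_exp_smul]
      rfl
    · refine (h1.norm.mul_prod ψ.integrable.norm).mono' ?_ (Eventually.of_forall fun z => ?_)
      · have hψ := ψ.continuous
        have a1 : Continuous fun z : ℝ × ℝ => conj (ψ z.2) := by fun_prop
        have a2 : Continuous fun z : ℝ × ℝ => Complex.exp (((-2 * Real.pi * z.1 * z.2 : ℝ) : ℂ) * Complex.I) := by fun_prop
        exact a1.aestronglyMeasurable.mul (a2.aestronglyMeasurable.mul h1.1.comp_fst)
      · simp only [Function.uncurry, norm_mul, RCLike.norm_conj, Complex.norm_exp_ofReal_mul_I, one_mul]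
        exact le_of_eq (mul_comm _ _)
  have e2 : ∀ f : L2 ℝ, ∫⁻ s, ‖f s‖ₑ ^ 2 = ‖f‖ₑ ^ 2 := by
    intro f
    rw [← ENNReal.rpow_two, Lp.enorm_def, eLpNorm_eq_lintegral_rpow_enorm_toReal (by norm_num) (by norm_num), ← ENNReal.rpow_mul]
    simp
  calc _ = ∫⁻ ν, ‖(𝓕 (h2.toLp w) : L2 ℝ) ν‖ₑ ^ 2 := lintegral_congr_ae (h.mono fun ν hν => by simp only [hν])
    _ = ‖h2.toLp w‖ₑ ^ 2 := by rw [e2, ← ofReal_norm, Lp.norm_fourier_eq, ofReal_norm]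
    _ = _ := by
        rw [← e2]
        exact lintegral_congr_ae (h2.coeFn_toLp.mono fun ν hν => by simp only [hν])
    _ ≤ _ := le_rfl

/-- The time-frequency multiplier of `⟨∂_s⟩^{1/4}` (in the normalisation `λ = 2πν`). -/
noncomputable def quarterSym (ν : ℝ) : ℂ := ((1 + (2 * Real.pi * ν) ^ 2) ^ (1 / 8 : ℝ) : ℝ)

theorem quarterSym_hasTemperateGrowth : quarterSym.HasTemperateGrowth := by
  have h1 := Function.hasTemperateGrowth_one_add_norm_sq_rpow (H := ℝ) (1 / 8)
  have h2 : Function.HasTemperateGrowth fun ν : ℝ => 2 * Real.pi * ν :=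
    ((2 * Real.pi) • ContinuousLinearMap.id ℝ ℝ).hasTemperateGrowth
  have h3 := Complex.ofRealCLM.hasTemperateGrowth.comp (h1.comp h2)
  convert h3 using 1
  ext ν
  simp [quarterSym]

noncomputable def quarterD : 𝓢(ℝ, ℂ) →L[ℂ] 𝓢(ℝ, ℂ) := fourierMultiplierCLM ℂ quarterSym

theorem quarterD_apply (f : 𝓢(ℝ, ℂ)) (s : ℝ) :
    quarterD f s = ∫ ν, Complex.exp (((2 * Real.pi * (s * ν) : ℝ) : ℂ) * Complex.I) * (quarterSym ν * 𝓕 f ν) := by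
  rw [quarterD, fourierMultiplierCLM_apply, fourierInv_coe, Real.fourierInv_eq']
  refine integral_congr_ae (Eventually.of_forall fun ν => ?_)
  simp only
  rw [smulLeftCLM_apply_apply quarterSym_hasTemperateGrowth, smul_eq_mul, smul_eq_mul]
  simp [mul_comm]

/-- Squared inhomogeneous `H^{1/4}`-type norm by difference quotients. -/
noncomputable def sobQ (w : ℝ → ℂ) : ℝ≥0∞ :=
  (∫⁻ s, ‖w s‖ₑ ^ 2) + ∫⁻ τ in Set.Ioc (0 : ℝ) 1, ENNReal.ofReal (τ ^ (-(3 / 2) : ℝ)) * ∫⁻ s, ‖w (s + τ) - w s‖ₑ ^ 2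

theorem quarterSym_sq_le (ν : ℝ) : ‖quarterSym ν‖ₑ ^ 2 ≤ ENNReal.ofReal 12 * (1 +
    ∫⁻ τ in Set.Ioc (0 : ℝ) 1, ENNReal.ofReal (τ ^ (-(3 / 2) : ℝ)) * ‖Complex.exp (((2 * Real.pi * (τ * ν) : ℝ) : ℂ) * Complex.I) - 1‖ₑ ^ 2) := by
  set L : ℝ := |2 * Real.pi * ν| with hL
  have hL0 : 0 ≤ L := abs_nonneg _
  have e1 : ‖quarterSym ν‖ₑ ^ 2 = ENNReal.ofReal ((1 + L ^ 2) ^ (1 / 4 : ℝ)) := by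
    rw [quarterSym, ← ofReal_norm, ← ENNReal.ofReal_pow (norm_nonneg _), Complex.norm_real, Real.norm_of_nonneg (by positivity),
      ← Real.rpow_natCast, ← Real.rpow_mul (by positivity), hL, sq_abs]
    norm_num
  rw [e1]
  rcases le_total L 1 with h | h
  · have h1 : (1 + L ^ 2) ^ (1 / 4 : ℝ) ≤ 12 := by
      calc (1 + L ^ 2) ^ (1 / 4 : ℝ) ≤ (1 + L ^ 2) ^ (1 : ℝ) :=
            Real.rpow_le_rpow_of_exponent_le (by nlinarith) (by norm_num)
        _ ≤ 12 := by rw [Real.rpow_one]; nlinarith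
    exact (ENNReal.ofReal_le_ofReal h1).trans (le_mul_of_one_le_right (zero_le (a := _)) le_self_add)
  · have hLp : 0 < L := by linarith
    refine le_trans ?_ (mul_le_mul_right le_add_self _)
    have h2 : ∫⁻ τ in Set.Ioc (0 : ℝ) L⁻¹, ENNReal.ofReal (L ^ 2 / 4) * ENNReal.ofReal (τ ^ (1 / 2 : ℝ)) ≤
        ∫⁻ τ in Set.Ioc (0 : ℝ) 1, ENNReal.ofReal (τ ^ (-(3 / 2) : ℝ)) * ‖Complex.exp (((2 * Real.pi * (τ * ν) : ℝ) : ℂ) * Complex.I) - 1‖ₑ ^ 2 := by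
      refine le_trans ?_ (lintegral_mono_set (Set.Ioc_subset_Ioc_right (inv_le_one_of_one_le₀ h)))
      refine setLIntegral_mono' measurableSet_Ioc fun τ hτ => ?_
      have hτ0 : 0 < τ := hτ.1
      have hτL : τ * L ≤ 1 := by
        have := mul_le_mul_of_nonneg_right hτ.2 hL0
        rwa [inv_mul_cancel₀ hLp.ne'] at this
      have h3 : (τ * L / 2) ^ 2 ≤ ‖Complex.exp (((2 * Real.pi * (τ * ν) : ℝ) : ℂ) * Complex.I) - 1‖ ^ 2 := by
        rw [mul_comm _ Complex.I, Complex.norm_exp_I_mul_ofReal_sub_one, Real.norm_eq_abs, sq_abs]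
        have e2 : Real.sin (2 * Real.pi * (τ * ν) / 2) ^ 2 = Real.sin (τ * L / 2) ^ 2 := by
          rw [hL]
          rcases abs_cases (2 * Real.pi * ν) with ⟨h', _⟩ | ⟨h', _⟩
          · rw [h']; congr 2; ring
          · rw [h', show τ * -(2 * Real.pi * ν) / 2 = -(2 * Real.pi * (τ * ν) / 2) by ring, Real.sin_neg, neg_sq]
        rw [mul_pow, e2]
        have h4 := Real.mul_le_sin (x := τ * L / 2) (by positivity) (by linarith [Real.pi_gt_three])
        have h5 : 1 / 2 ≤ 2 / Real.pi := by
          rw [div_le_div_iff₀ (by norm_num) Real.pi_pos]; linarith [Real.pi_lt_four]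
        have h6 : 1 / 2 * (τ * L / 2) ≤ Real.sin (τ * L / 2) := (mul_le_mul_of_nonneg_right h5 (by positivity)).trans h4
        have h7 : 0 ≤ 1 / 2 * (τ * L / 2) := by positivity
        nlinarith
      rw [← ofReal_norm, ← ENNReal.ofReal_pow (norm_nonneg _), ← ENNReal.ofReal_mul (by positivity), ← ENNReal.ofReal_mul (by positivity)]
      refine ENNReal.ofReal_le_ofReal ?_
      have e3 : τ ^ (1 / 2 : ℝ) = τ ^ (-(3 / 2) : ℝ) * τ ^ 2 := by
        rw [← Real.rpow_natCast, ← Real.rpow_add hτ0]; norm_num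
      rw [e3]
      calc L ^ 2 / 4 * (τ ^ (-(3 / 2) : ℝ) * τ ^ 2) = τ ^ (-(3 / 2) : ℝ) * (τ * L / 2) ^ 2 := by ring
        _ ≤ _ := by gcongr
    refine le_trans ?_ (mul_le_mul_right h2 _)
    rw [lintegral_const_mul' _ _ ENNReal.ofReal_ne_top, lintegral_Ioc_rpow (by norm_num) (by positivity),
      ← ENNReal.ofReal_mul (by positivity), ← ENNReal.ofReal_mul (by positivity)]
    refine ENNReal.ofReal_le_ofReal ?_
    set y : ℝ := L ^ (1 / 2 : ℝ) with hy
    have hy0 : 0 < y := by positivity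
    have hy2 : y ^ 2 = L := by rw [hy, ← Real.rpow_natCast, ← Real.rpow_mul hL0]; norm_num
    have e4 : L⁻¹ ^ (1 / 2 + 1 : ℝ) = (y ^ 3)⁻¹ := by
      rw [Real.inv_rpow hL0, hy, ← Real.rpow_natCast, ← Real.rpow_mul hL0]; norm_num
    have e5 : (1 + L ^ 2) ^ (1 / 4 : ℝ) ≤ 2 * y := by
      calc (1 + L ^ 2) ^ (1 / 4 : ℝ) ≤ ((2 * y) ^ 4) ^ (1 / 4 : ℝ) := by
            refine Real.rpow_le_rpow (by positivity) ?_ (by norm_num)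
            rw [show (2 * y) ^ 4 = 16 * (y ^ 2) ^ 2 by ring, hy2]; nlinarith
        _ = 2 * y := by
            rw [← Real.rpow_natCast, ← Real.rpow_mul (by positivity)]; norm_num
    rw [e4, ← hy2]
    rw [← hy2] at e5
    refine e5.trans (le_of_eq ?_)
    field_simp; norm_num

theorem fourier_comp_add (w : ℝ → ℂ) (τ ν : ℝ) :
    𝓕 (fun s => w (s + τ)) ν = Complex.exp (((2 * Real.pi * (τ * ν) : ℝ) : ℂ) * Complex.I) * 𝓕 w ν := by
  rw [Real.fourier_real_eq_integral_exp_smul, Real.fourier_real_eq_integral_exp_smul, ← integral_const_mul,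
    ← integral_add_right_eq_self (fun s => Complex.exp (((2 * Real.pi * (τ * ν) : ℝ) : ℂ) * Complex.I) * _) τ]
  refine integral_congr_ae (Eventually.of_forall fun s => ?_)
  simp only [smul_eq_mul]
  rw [← mul_assoc, ← Complex.exp_add]
  congr 2; push_cast; ring

theorem fourier_comp_add_sub {w : ℝ → ℂ} (h1 : Integrable w) (τ ν : ℝ) :
    𝓕 (fun s => w (s + τ) - w s) ν = (Complex.exp (((2 * Real.pi * (τ * ν) : ℝ) : ℂ) * Complex.I) - 1) * 𝓕 w ν := by
  rw [sub_mul, one_mul, ← fourier_comp_add]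
  simp only [Real.fourier_real_eq_integral_exp_smul, smul_sub]
  refine integral_sub ?_ ?_
  · refine ((h1.comp_add_right τ).bdd_mul (c := 1) (Continuous.aestronglyMeasurable (by fun_prop)) (Eventually.of_forall fun s => ?_))
    exact (Complex.norm_exp_ofReal_mul_I _).le
  · refine (h1.bdd_mul (c := 1) (Continuous.aestronglyMeasurable (by fun_prop)) (Eventually.of_forall fun s => ?_))
    exact (Complex.norm_exp_ofReal_mul_I _).le

theorem lintegral_quarterSym_fourier_le {w : ℝ → ℂ} (h1 : Integrable w) (h2 : MemLp w 2) :
    ∫⁻ ν, (‖quarterSym ν‖ₑ * ‖𝓕 w ν‖ₑ) ^ 2 ≤ ENNReal.ofReal 12 * sobQ w := by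
  have hc := continuous_fourier_of_integrable h1
  calc ∫⁻ ν, (‖quarterSym ν‖ₑ * ‖𝓕 w ν‖ₑ) ^ 2
      ≤ ∫⁻ ν, ENNReal.ofReal 12 * (‖𝓕 w ν‖ₑ ^ 2 + ∫⁻ τ in Set.Ioc (0 : ℝ) 1, ENNReal.ofReal (τ ^ (-(3 / 2) : ℝ)) *
          ‖𝓕 (fun s => w (s + τ) - w s) ν‖ₑ ^ 2) := by
        refine lintegral_mono fun ν => ?_
        rw [mul_pow]
        refine (mul_le_mul_left (quarterSym_sq_le ν) _).trans_eq ?_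
        rw [mul_assoc, add_mul, one_mul, ← lintegral_mul_const' _ _ (by simp)]
        congr 2
        refine lintegral_congr fun τ => ?_
        rw [fourier_comp_add_sub h1, enorm_mul, mul_pow, mul_assoc]
    _ = ENNReal.ofReal 12 * ((∫⁻ ν, ‖𝓕 w ν‖ₑ ^ 2) + ∫⁻ τ in Set.Ioc (0 : ℝ) 1, ENNReal.ofReal (τ ^ (-(3 / 2) : ℝ)) *
          ∫⁻ ν, ‖𝓕 (fun s => w (s + τ) - w s) ν‖ₑ ^ 2) := by
        rw [lintegral_const_mul' _ _ ENNReal.ofReal_ne_top, lintegral_add_left (by exact hc.measurable.enorm.pow_const 2), lintegral_lintegral_swap]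
        · congr 2
          refine lintegral_congr fun τ => ?_
          rw [lintegral_const_mul' _ _ ENNReal.ofReal_ne_top]
        · have hcont : Continuous fun z : ℝ × ℝ => (Complex.exp (((2 * Real.pi * (z.2 * z.1) : ℝ) : ℂ) * Complex.I) - 1) * 𝓕 w z.1 :=
            (by fun_prop : Continuous fun z : ℝ × ℝ => Complex.exp (((2 * Real.pi * (z.2 * z.1) : ℝ) : ℂ) * Complex.I) - 1).mul (hc.comp continuous_fst)
          have hmeas : Measurable fun z : ℝ × ℝ => ENNReal.ofReal (z.2 ^ (-(3 / 2) : ℝ)) *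
              ‖(Complex.exp (((2 * Real.pi * (z.2 * z.1) : ℝ) : ℂ) * Complex.I) - 1) * 𝓕 w z.1‖ₑ ^ 2 :=
            (measurable_snd.pow_const _).ennreal_ofReal.mul (hcont.measurable.enorm.pow_const 2)
          simp only [fourier_comp_add_sub h1]
          exact hmeas.aemeasurable
    _ ≤ _ := by
        rw [sobQ]
        refine mul_le_mul_right (add_le_add (lintegral_fourier_sq_le h1 h2) (lintegral_mono fun τ => mul_le_mul_right ?_ _)) _
        exact lintegral_fourier_sq_le ((h1.comp_add_right τ).sub h1)
          ((h2.comp_measurePreserving (measurePreserving_add_right volume τ)).sub h2)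

/-- Duality between `⟨∂_s⟩^{1/4}` and the difference-quotient norm. -/
theorem enorm_integral_quarterD_sq_le (f : 𝓢(ℝ, ℂ)) {w : ℝ → ℂ} (h1 : Integrable w) (h2 : MemLp w 2) :
    ‖∫ s, conj (w s) * quarterD f s‖ₑ ^ 2 ≤ ENNReal.ofReal 12 * (∫⁻ s, ‖f s‖ₑ ^ 2) * sobQ w := by
  have hm : Continuous fun ν => quarterSym ν * 𝓕 f ν := 
    quarterSym_hasTemperateGrowth.1.continuous.mul (𝓕 f).continuous
  have hi : Integrable fun ν => quarterSym ν * 𝓕 f ν := by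
    have := (smulLeftCLM ℂ quarterSym (𝓕 f)).integrable (μ := volume)
    refine this.congr (Eventually.of_forall fun ν => ?_)
    simp only
    rw [smulLeftCLM_apply_apply quarterSym_hasTemperateGrowth, smul_eq_mul]
  have e1 : ∫ s, conj (w s) * quarterD f s = ∫ ν, conj (𝓕 w ν) * (quarterSym ν * 𝓕 f ν) := by
    calc _ = ∫ s, ∫ ν, conj (w s) * (Complex.exp (((2 * Real.pi * (s * ν) : ℝ) : ℂ) * Complex.I) * (quarterSym ν * 𝓕 f ν)) := by
          simp_rw [quarterD_apply, integral_const_mul]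
      _ = ∫ ν, ∫ s, conj (w s) * (Complex.exp (((2 * Real.pi * (s * ν) : ℝ) : ℂ) * Complex.I) * (quarterSym ν * 𝓕 f ν)) := by
          rw [integral_integral_swap]
          refine (h1.norm.mul_prod hi.norm).mono' ?_ (Eventually.of_forall fun z => ?_)
          · have a2 : Continuous fun z : ℝ × ℝ => Complex.exp (((2 * Real.pi * (z.1 * z.2) : ℝ) : ℂ) * Complex.I) * (quarterSym z.2 * 𝓕 f z.2) :=
              (by fun_prop : Continuous fun z : ℝ × ℝ => Complex.exp (((2 * Real.pi * (z.1 * z.2) : ℝ) : ℂ) * Complex.I)).mul (hm.comp continuous_snd)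
            exact (Complex.continuous_conj.comp_aestronglyMeasurable h1.1.comp_fst).mul a2.aestronglyMeasurable
          · simp only [Function.uncurry]
            rw [norm_mul, norm_mul (Complex.exp _), RCLike.norm_conj, Complex.norm_exp_ofReal_mul_I, one_mul]
      _ = _ := by
          refine integral_congr_ae (Eventually.of_forall fun ν => ?_)
          simp only
          rw [Real.fourier_real_eq_integral_exp_smul, ← integral_conj, ← integral_mul_const]
          refine integral_congr_ae (Eventually.of_forall fun s => ?_)
          simp only [smul_eq_mul, map_mul, ← Complex.exp_conj, Complex.conj_ofReal, Complex.conj_I]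
          rw [show ((-2 * Real.pi * s * ν : ℝ) : ℂ) * -Complex.I = ((2 * Real.pi * (s * ν) : ℝ) : ℂ) * Complex.I by push_cast; ring]
          ring
  have hc := continuous_fourier_of_integrable h1
  have hq : Continuous quarterSym := quarterSym_hasTemperateGrowth.1.continuous
  rw [e1]
  calc _ ≤ (∫⁻ ν, (‖quarterSym ν‖ₑ * ‖𝓕 w ν‖ₑ) * ‖𝓕 f ν‖ₑ) ^ 2 := by
        refine pow_le_pow_left₀ (zero_le (a := _)) ((enorm_integral_le_lintegral_enorm _).trans_eq ?_) 2
        refine lintegral_congr fun ν => ?_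
        rw [enorm_mul, enorm_mul, ← ofReal_norm (conj (𝓕 w ν)), RCLike.norm_conj, ofReal_norm]; ring
    _ ≤ (∫⁻ ν, (‖quarterSym ν‖ₑ * ‖𝓕 w ν‖ₑ) ^ 2) * ∫⁻ ν, ‖𝓕 f ν‖ₑ ^ 2 :=
        sq_lintegral_mul_le (hq.measurable.enorm.mul hc.measurable.enorm).aemeasurable (𝓕 f).continuous.measurable.enorm.aemeasurable
    _ ≤ ENNReal.ofReal 12 * sobQ w * ∫⁻ s, ‖f s‖ₑ ^ 2 := by
        rw [lintegral_enorm_sq_fourier, lintegral_enorm_sq_toLp]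
        exact mul_le_mul_left (lintegral_quarterSym_fourier_le h1 h2) _
    _ = _ := by ring

end FractionalDuality

section Slices

variable {V : Type*} [NormedAddCommGroup V] [InnerProductSpace ℝ V] [FiniteDimensional ℝ V]
  [MeasurableSpace V] [BorelSpace V]

theorem hasTemperateGrowth_prodMk (x : V) : Function.HasTemperateGrowth fun s : ℝ => (s, x) := by
  have h : (fun s : ℝ => (s, x)) = fun s => ContinuousLinearMap.inl ℝ ℝ V s + (0, x) := by
    ext s <;> simp
  rw [h]
  exact (ContinuousLinearMap.inl ℝ ℝ V).hasTemperateGrowth.add (.const _)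

/-- The time slice `s ↦ g (s, x)`. -/
noncomputable def slice (g : 𝓢(ℝ × V, ℂ)) (x : V) : 𝓢(ℝ, ℂ) :=
  compCLM ℂ (hasTemperateGrowth_prodMk x) ⟨1, 1, fun s => by
    rw [one_mul, pow_one]
    linarith [norm_fst_le (s, x)]⟩ g

@[simp] theorem slice_apply (g : 𝓢(ℝ × V, ℂ)) (x : V) (s : ℝ) : slice g x s = g (s, x) := rfl

theorem norm_iteratedFDeriv_slice_le (g : 𝓢(ℝ × V, ℂ)) (x : V) (l : ℕ) (s : ℝ) :
    ‖iteratedFDeriv ℝ l (slice g x) s‖ ≤ ‖iteratedFDeriv ℝ l g (s, x)‖ := by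
  have h : (slice g x : ℝ → ℂ) = (fun z => g (z + (0, x))) ∘ ContinuousLinearMap.inl ℝ ℝ V := by
    ext s; simp
  have hg : ContDiff ℝ l (fun z => g (z + (0, x))) := (g.smooth l).comp (contDiff_id.add contDiff_const)
  rw [h, ContinuousLinearMap.iteratedFDeriv_comp_right _ hg _ le_rfl, iteratedFDeriv_comp_add_right]
  refine (ContinuousMultilinearMap.norm_compContinuousLinearMap_le _ _).trans ?_
  have e : ContinuousLinearMap.inl ℝ ℝ V s + (0, x) = (s, x) := by simp
  rw [e]
  refine mul_le_of_le_one_right (norm_nonneg _) ?_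
  exact Finset.prod_le_one (fun _ _ => norm_nonneg _) fun _ _ => ContinuousLinearMap.norm_inl_le_one ℝ ℝ V

theorem seminorm_slice_le (g : 𝓢(ℝ × V, ℂ)) (k l M : ℕ) :
    ∃ C : ℝ, 0 ≤ C ∧ ∀ x, (1 + ‖x‖) ^ M * SchwartzMap.seminorm ℂ k l (slice g x) ≤ C := by
  set C : ℝ := 2 ^ (k + M) * ((Finset.Iic (k + M, l)).sup fun m => SchwartzMap.seminorm ℂ m.1 m.2) g with hC
  have hC0 : 0 ≤ C := mul_nonneg (by positivity) (apply_nonneg _ _)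
  refine ⟨C, hC0, fun x => ?_⟩
  have hx : 0 < (1 + ‖x‖) ^ M := by positivity
  rw [mul_comm, ← le_div_iff₀ hx]
  refine seminorm_le_bound ℂ k l _ (div_nonneg hC0 hx.le) fun s => ?_
  rw [le_div_iff₀ hx]
  have h1 := one_add_le_sup_seminorm_apply (𝕜 := ℂ) (m := (k + M, l)) le_rfl le_rfl g (s, x)
  have h2 := norm_iteratedFDeriv_slice_le g x l s
  have h3 : ‖s‖ ^ k ≤ (1 + ‖(s, x)‖) ^ k := by
    refine pow_le_pow_left₀ (norm_nonneg _) ?_ k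
    linarith [norm_fst_le (s, x)]
  have h4 : (1 + ‖x‖) ^ M ≤ (1 + ‖(s, x)‖) ^ M := by
    refine pow_le_pow_left₀ (by positivity) ?_ M
    linarith [norm_snd_le (s, x)]
  calc ‖s‖ ^ k * ‖iteratedFDeriv ℝ l (slice g x) s‖ * (1 + ‖x‖) ^ M
      ≤ (1 + ‖(s, x)‖) ^ k * ‖iteratedFDeriv ℝ l g (s, x)‖ * (1 + ‖(s, x)‖) ^ M := by gcongr
    _ = (1 + ‖(s, x)‖) ^ (k + M) * ‖iteratedFDeriv ℝ l g (s, x)‖ := by rw [pow_add]; ring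
    _ ≤ _ := h1

theorem norm_quarterD_slice_le (g : 𝓢(ℝ × V, ℂ)) (M : ℕ) :
    ∃ C : ℝ, 0 ≤ C ∧ ∀ s x, ‖quarterD (slice g x) s‖ ≤ C * (1 + s ^ 2)⁻¹ * ((1 + ‖x‖) ^ M)⁻¹ := by
  have hw := schwartz_withSeminorms ℂ ℝ ℂ
  let q : Seminorm ℂ 𝓢(ℝ, ℂ) := (SchwartzMap.seminorm ℂ 0 0 + SchwartzMap.seminorm ℂ 2 0).comp quarterD.toLinearMap
  have hq : Continuous q := by
    have h0 := (hw.continuous_seminorm (0, 0)).comp quarterD.continuous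
    have h2 := (hw.continuous_seminorm (2, 0)).comp quarterD.continuous
    exact h0.add h2
  obtain ⟨S, C, -, hqC⟩ := Seminorm.bound_of_continuous hw q hq
  choose D hD0 hD using fun i : ℕ × ℕ => seminorm_slice_le g i.1 i.2 M
  have hS0 : 0 ≤ ∑ i ∈ S, D i := Finset.sum_nonneg fun i _ => hD0 i
  refine ⟨C * ∑ i ∈ S, D i, by positivity, fun s x => ?_⟩
  have hx : 0 < (1 + ‖x‖) ^ M := by positivity
  have h1 : (S.sup (schwartzSeminormFamily ℂ ℝ ℂ)) (slice g x) ≤ (∑ i ∈ S, D i) * ((1 + ‖x‖) ^ M)⁻¹ := by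
    refine Seminorm.finset_sup_apply_le (by positivity) fun i hi => ?_
    rw [← div_eq_mul_inv, le_div_iff₀ hx, mul_comm]
    exact (hD i x).trans (Finset.single_le_sum (fun i _ => hD0 i) hi)
  have h2 : q (slice g x) ≤ C * ((∑ i ∈ S, D i) * ((1 + ‖x‖) ^ M)⁻¹) :=
    (hqC (slice g x)).trans (mul_le_mul_of_nonneg_left h1 C.2)
  have h3 : (1 + s ^ 2) * ‖quarterD (slice g x) s‖ ≤ q (slice g x) := by
    have a0 := le_seminorm ℂ 0 0 (quarterD (slice g x)) s
    have a2 := le_seminorm ℂ 2 0 (quarterD (slice g x)) s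
    rw [norm_iteratedFDeriv_zero] at a0 a2
    rw [Real.norm_eq_abs, sq_abs] at a2
    have : q (slice g x) = SchwartzMap.seminorm ℂ 0 0 (quarterD (slice g x)) + SchwartzMap.seminorm ℂ 2 0 (quarterD (slice g x)) := rfl
    rw [this]
    linarith
  have h4 : 0 < 1 + s ^ 2 := by positivity
  calc ‖quarterD (slice g x) s‖ = (1 + s ^ 2)⁻¹ * ((1 + s ^ 2) * ‖quarterD (slice g x) s‖) := by field_simp
    _ ≤ (1 + s ^ 2)⁻¹ * (C * ((∑ i ∈ S, D i) * ((1 + ‖x‖) ^ M)⁻¹)) := by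
        have := h3.trans h2
        gcongr
    _ = _ := by ring

theorem measurable_quarterD_slice (g : 𝓢(ℝ × V, ℂ)) :
    Measurable fun z : ℝ × V => quarterD (slice g z.2) z.1 := by
  have hg := g.continuous
  have h1 : StronglyMeasurable fun z : ℝ × V => 𝓕 (slice g z.2) z.1 := by
    have hc : Continuous fun w : (ℝ × V) × ℝ => Complex.exp (((-2 * Real.pi * w.2 * w.1.1 : ℝ) : ℂ) * Complex.I) • g (w.2, w.1.2) := by
      fun_prop
    have := hc.stronglyMeasurable.integral_prod_right' (ν := (volume : Measure ℝ))
    convert this using 2 with z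
    rw [fourier_coe, Real.fourier_real_eq_integral_exp_smul]
    simp
  have hq : Continuous quarterSym := quarterSym_hasTemperateGrowth.1.continuous
  have hc : Continuous fun w : (ℝ × V) × ℝ => Complex.exp (((2 * Real.pi * (w.1.1 * w.2) : ℝ) : ℂ) * Complex.I) * quarterSym w.2 := by
    fun_prop
  have h2 : Measurable fun w : (ℝ × V) × ℝ => (w.2, w.1.2) := by fun_prop
  have h3 := (hc.stronglyMeasurable.mul (h1.comp_measurable h2)).integral_prod_right' (ν := (volume : Measure ℝ))
  convert h3.measurable using 2 with z
  rw [quarterD_apply]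
  simp [mul_assoc]

/-- The source term `⟨x⟩^{-1} ⟨∂_s⟩^{1/4} g`. -/
noncomputable def src (g : 𝓢(ℝ × V, ℂ)) (s : ℝ) (x : V) : ℂ :=
  (((1 + ‖x‖ ^ 2) ^ (-(1 : ℝ) / 2) : ℝ) : ℂ) * quarterD (slice g x) s

theorem continuous_weight : Continuous fun x : V => (1 + ‖x‖ ^ 2) ^ (-(1 : ℝ) / 2) :=
  Continuous.rpow_const (by fun_prop) fun x => Or.inl (by positivity)

theorem weight_nonneg (x : V) : 0 ≤ (1 + ‖x‖ ^ 2) ^ (-(1 : ℝ) / 2) := by positivity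

theorem weight_le_one (x : V) : (1 + ‖x‖ ^ 2) ^ (-(1 : ℝ) / 2) ≤ 1 :=
  Real.rpow_le_one_of_one_le_of_nonpos (by nlinarith [sq_nonneg ‖x‖]) (by norm_num)

theorem measurable_src (g : 𝓢(ℝ × V, ℂ)) : Measurable fun z : ℝ × V => src g z.1 z.2 :=
  (Complex.measurable_ofReal.comp (continuous_weight.measurable.comp measurable_snd)).mul (measurable_quarterD_slice g)

theorem continuous_src_left (g : 𝓢(ℝ × V, ℂ)) (x : V) : Continuous fun s => src g s x :=
  continuous_const.mul (quarterD (slice g x)).continuous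

/-- Integrable majorant in the space variable. -/
noncomputable def maj (x : V) : ℝ := (1 + ‖x‖ ^ 2) ^ (-(Module.finrank ℝ V + 1 : ℝ) / 2)

theorem maj_nonneg (x : V) : 0 ≤ maj x := by unfold maj; positivity

theorem maj_le_one (x : V) : maj x ≤ 1 := by
  refine Real.rpow_le_one_of_one_le_of_nonpos (by nlinarith [sq_nonneg ‖x‖]) ?_
  have : (0 : ℝ) ≤ Module.finrank ℝ V := by positivity
  linarith

theorem integrable_maj : Integrable (maj : V → ℝ) :=
  integrable_rpow_neg_one_add_norm_sq (by linarith)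

theorem norm_src_le (g : 𝓢(ℝ × V, ℂ)) : ∃ C : ℝ, 0 ≤ C ∧ ∀ s x, ‖src g s x‖ ≤ C * (1 + s ^ 2)⁻¹ * maj x := by
  obtain ⟨C, hC0, hC⟩ := norm_quarterD_slice_le g (Module.finrank ℝ V + 1)
  refine ⟨C, hC0, fun s x => ?_⟩
  have h1 : ((1 + ‖x‖) ^ (Module.finrank ℝ V + 1))⁻¹ ≤ maj x := by
    rw [maj, neg_div, Real.rpow_neg (by positivity)]
    refine inv_anti₀ (by positivity) ?_
    calc (1 + ‖x‖ ^ 2) ^ ((Module.finrank ℝ V + 1 : ℝ) / 2)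
        ≤ ((1 + ‖x‖) ^ 2) ^ ((Module.finrank ℝ V + 1 : ℝ) / 2) := by
          refine Real.rpow_le_rpow (by positivity) (by nlinarith [norm_nonneg x]) (by positivity)
      _ = _ := by
          rw [← Real.rpow_natCast, ← Real.rpow_natCast, ← Real.rpow_mul (by positivity)]
          congr 1; push_cast; ring
  rw [src, norm_mul, Complex.norm_real, Real.norm_of_nonneg (weight_nonneg x)]
  calc _ ≤ 1 * (C * (1 + s ^ 2)⁻¹ * ((1 + ‖x‖) ^ (Module.finrank ℝ V + 1))⁻¹) :=
        mul_le_mul (weight_le_one x) (hC s x) (norm_nonneg _) zero_le_one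
    _ ≤ _ := by rw [one_mul]; gcongr

theorem integrable_src (g : 𝓢(ℝ × V, ℂ)) (s : ℝ) : Integrable (src g s) := by
  obtain ⟨C, -, hC⟩ := norm_src_le g
  exact (integrable_maj.const_mul (C * (1 + s ^ 2)⁻¹)).mono'
    ((measurable_src g).comp measurable_prodMk_left).aestronglyMeasurable (Eventually.of_forall (hC s))

theorem memLp_src (g : 𝓢(ℝ × V, ℂ)) (s : ℝ) : MemLp (src g s) 2 := by
  obtain ⟨C, hC0, hC⟩ := norm_src_le g
  have hm : AEStronglyMeasurable (src g s) volume := ((measurable_src g).comp measurable_prodMk_left).aestronglyMeasurable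
  rw [memLp_two_iff_integrable_sq_norm hm]
  refine (integrable_maj.const_mul ((C * (1 + s ^ 2)⁻¹) ^ 2)).mono' (hm.norm.pow 2) (Eventually.of_forall fun x => ?_)
  rw [Real.norm_of_nonneg (by positivity)]
  calc ‖src g s x‖ ^ 2 ≤ (C * (1 + s ^ 2)⁻¹ * maj x) ^ 2 := pow_le_pow_left₀ (norm_nonneg _) (hC s x) 2
    _ = (C * (1 + s ^ 2)⁻¹) ^ 2 * (maj x * maj x) := by ring
    _ ≤ (C * (1 + s ^ 2)⁻¹) ^ 2 * (maj x * 1) := by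
        have := maj_le_one x
        have := maj_nonneg x
        gcongr
    _ = _ := by ring

/-- The source term as an `L²`-valued function of time. -/
noncomputable def srcL2 (g : 𝓢(ℝ × V, ℂ)) (s : ℝ) : L2 V := (memLp_src g s).toLp (src g s)

theorem norm_srcL2_le (g : 𝓢(ℝ × V, ℂ)) : ∃ C : ℝ, 0 ≤ C ∧ ∀ s, ‖srcL2 g s‖ ≤ C * (1 + s ^ 2)⁻¹ := by
  obtain ⟨C, hC0, hC⟩ := norm_src_le g
  set I : ℝ := ∫ x : V, maj x
  have hI : 0 ≤ I := integral_nonneg maj_nonneg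
  refine ⟨C * Real.sqrt I, by positivity, fun s => ?_⟩
  refine (sq_le_sq₀ (norm_nonneg _) (by positivity)).1 ?_
  rw [norm_sq_L2]
  have e : ∫ x, ‖srcL2 g s x‖ ^ 2 = ∫ x, ‖src g s x‖ ^ 2 :=
    integral_congr_ae ((memLp_src g s).coeFn_toLp.mono fun x hx => by simp only [srcL2, hx])
  rw [e]
  calc ∫ x, ‖src g s x‖ ^ 2 ≤ ∫ x, (C * (1 + s ^ 2)⁻¹) ^ 2 * maj x := by
        refine integral_mono_of_nonneg (Eventually.of_forall fun x => by positivity) (integrable_maj.const_mul _) (Eventually.of_forall fun x => ?_)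
        calc ‖src g s x‖ ^ 2 ≤ (C * (1 + s ^ 2)⁻¹ * maj x) ^ 2 := pow_le_pow_left₀ (norm_nonneg _) (hC s x) 2
          _ = (C * (1 + s ^ 2)⁻¹) ^ 2 * (maj x * maj x) := by ring
          _ ≤ (C * (1 + s ^ 2)⁻¹) ^ 2 * (maj x * 1) := by
              have := maj_le_one x
              have := maj_nonneg x
              gcongr
          _ = _ := by ring
    _ = (C * Real.sqrt I * (1 + s ^ 2)⁻¹) ^ 2 := by
        rw [integral_const_mul, mul_pow, mul_pow, mul_pow, Real.sq_sqrt hI]; ring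

theorem continuous_srcL2 (g : 𝓢(ℝ × V, ℂ)) : Continuous (srcL2 g) := by
  obtain ⟨C, hC0, hC⟩ := norm_src_le g
  rw [continuous_iff_continuousAt]
  intro t₀
  rw [ContinuousAt, tendsto_iff_norm_sub_tendsto_zero]
  have hC' : ∀ s x, ‖src g s x‖ ≤ C * maj x := fun s x => by
    refine (hC s x).trans ?_
    have h1 : (1 + s ^ 2)⁻¹ ≤ 1 := inv_le_one_of_one_le₀ (by nlinarith [sq_nonneg s])
    have := maj_nonneg x
    calc C * (1 + s ^ 2)⁻¹ * maj x ≤ C * 1 * maj x := by gcongr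
      _ = _ := by ring
  have hm : ∀ s, AEStronglyMeasurable (src g s) volume := fun s =>
    ((measurable_src g).comp measurable_prodMk_left).aestronglyMeasurable
  have hc : Tendsto (fun t => ∫ x, ‖src g t x - src g t₀ x‖ ^ 2) (𝓝 t₀) (𝓝 (∫ _ : V, (0 : ℝ))) := by
    refine tendsto_integral_filter_of_dominated_convergence (fun x => (2 * C) ^ 2 * maj x) (Eventually.of_forall fun t => ((hm t).sub (hm t₀)).norm.pow 2)
      (Eventually.of_forall fun t => Eventually.of_forall fun x => ?_) (integrable_maj.const_mul _) (Eventually.of_forall fun x => ?_)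
    · rw [Real.norm_of_nonneg (by positivity)]
      have h1 := maj_le_one x
      have h0 := maj_nonneg x
      calc ‖src g t x - src g t₀ x‖ ^ 2 ≤ (2 * C * maj x) ^ 2 := by
            refine pow_le_pow_left₀ (norm_nonneg _) ((norm_sub_le _ _).trans ?_) 2
            linarith [hC' t x, hC' t₀ x]
        _ = (2 * C) ^ 2 * (maj x * maj x) := by ring
        _ ≤ (2 * C) ^ 2 * (maj x * 1) := by gcongr
        _ = _ := by ring
    · have := ((((continuous_src_left g x).tendsto t₀).sub_const (src g t₀ x)).norm.pow 2)
      simpa using this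
  have h1 := hc.sqrt
  simp only [integral_zero, Real.sqrt_zero] at h1
  refine h1.congr fun t => ?_
  rw [← Real.sqrt_sq (norm_nonneg (_ - _)), srcL2, srcL2, ← MemLp.toLp_sub, norm_sq_L2]
  congr 1
  refine integral_congr_ae ?_
  filter_upwards [((memLp_src g t).sub (memLp_src g t₀)).coeFn_toLp] with x hx
  rw [hx]; rfl

end Slices

section Pieces

variable {V : Type*} [NormedAddCommGroup V] [InnerProductSpace ℝ V] [FiniteDimensional ℝ V]
  [MeasurableSpace V] [BorelSpace V]

/-- The function which on the `k`-th interval `(t k, t (k+1)]` is the `k`-th piece `u k`. -/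
noncomputable def pieced (t : ℕ → ℝ) (N : ℕ) (u : ℕ → ℝ → ℂ) (s : ℝ) : ℂ :=
  ∑ k ∈ Finset.range N, (Set.Ioc (t k) (t (k + 1))).indicator (u k) s

theorem pieced_eq {t : ℕ → ℝ} (ht : Monotone t) {N : ℕ} (u : ℕ → ℝ → ℂ) {s : ℝ} {k : ℕ} (hk : k ∈ Finset.range N)
    (hs : s ∈ Set.Ioc (t k) (t (k + 1))) : pieced t N u s = u k s := by
  rw [pieced, Finset.sum_eq_single_of_mem k hk, Set.indicator_of_mem hs]
  intro j _ hjk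
  refine Set.indicator_of_notMem (fun hj => ?_) _
  rcases lt_or_gt_of_ne hjk with h | h
  · exact absurd (hj.2.trans (ht (by omega : j + 1 ≤ k))) (not_le.2 hs.1)
  · exact absurd (hs.2.trans (ht (by omega : k + 1 ≤ j))) (not_le.2 hj.1)

theorem pieced_eq_zero {t : ℕ → ℝ} {N : ℕ} (u : ℕ → ℝ → ℂ) {s : ℝ}
    (hs : ∀ k ∈ Finset.range N, s ∉ Set.Ioc (t k) (t (k + 1))) : pieced t N u s = 0 :=
  Finset.sum_eq_zero fun k hk => Set.indicator_of_notMem (hs k hk) _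

theorem enorm_pieced_sq_le {t : ℕ → ℝ} (ht : Monotone t) (N : ℕ) (u : ℕ → ℝ → ℂ) (s : ℝ) :
    ‖pieced t N u s‖ₑ ^ 2 ≤ ∑ k ∈ Finset.range N, ‖u k s‖ₑ ^ 2 := by
  by_cases h : ∀ k ∈ Finset.range N, s ∉ Set.Ioc (t k) (t (k + 1))
  · simp [pieced_eq_zero u h]
  · push Not at h
    obtain ⟨k, hk, hs⟩ := h
    rw [pieced_eq ht u hk hs]
    exact Finset.single_le_sum (f := fun k => ‖u k s‖ₑ ^ 2) (fun _ _ => zero_le (a := _)) hk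

theorem enorm_sub_sq_le (a b : ℂ) : ‖a - b‖ₑ ^ 2 ≤ 2 * ‖a‖ₑ ^ 2 + 2 * ‖b‖ₑ ^ 2 := by
  have h : ‖a - b‖ ^ 2 ≤ 2 * ‖a‖ ^ 2 + 2 * ‖b‖ ^ 2 := by
    have := pow_le_pow_left₀ (norm_nonneg _) (norm_sub_le a b) 2
    nlinarith [sq_nonneg (‖a‖ - ‖b‖)]
  simp only [← ofReal_norm]
  rw [← ENNReal.ofReal_pow (norm_nonneg _), ← ENNReal.ofReal_pow (norm_nonneg _), ← ENNReal.ofReal_pow (norm_nonneg _)]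
  refine (ENNReal.ofReal_le_ofReal h).trans_eq ?_
  rw [ENNReal.ofReal_add (by positivity) (by positivity), ENNReal.ofReal_mul (by norm_num), ENNReal.ofReal_mul (by norm_num)]
  simp

theorem enorm_pieced_sub_sq_le {t : ℕ → ℝ} (ht : Monotone t) (N : ℕ) (u : ℕ → ℝ → ℂ) (s : ℝ) {τ : ℝ} (hτ : 0 < τ) :
    ‖pieced t N u (s + τ) - pieced t N u s‖ₑ ^ 2 ≤ ∑ k ∈ Finset.range N, (‖u k (s + τ) - u k s‖ₑ ^ 2 +
      2 * (Set.Ioc (t k) (t k + τ)).indicator (fun r => ‖u k r‖ₑ ^ 2) (s + τ) +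
      2 * (Set.Ioc (t (k + 1) - τ) (t (k + 1))).indicator (fun r => ‖u k r‖ₑ ^ 2) s) := by
  rw [Finset.sum_add_distrib, Finset.sum_add_distrib]
  set S₁ := ∑ k ∈ Finset.range N, ‖u k (s + τ) - u k s‖ₑ ^ 2
  set S₂ := ∑ k ∈ Finset.range N, 2 * (Set.Ioc (t k) (t k + τ)).indicator (fun r => ‖u k r‖ₑ ^ 2) (s + τ)
  set S₃ := ∑ k ∈ Finset.range N, 2 * (Set.Ioc (t (k + 1) - τ) (t (k + 1))).indicator (fun r => ‖u k r‖ₑ ^ 2) s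
  have b₂ : ∀ k ∈ Finset.range N, s + τ ∈ Set.Ioc (t k) (t (k + 1)) → s ∉ Set.Ioc (t k) (t (k + 1)) →
      2 * ‖u k (s + τ)‖ₑ ^ 2 ≤ S₂ := by
    intro k hk h1 h2
    have h3 : s ≤ t k := by
      by_contra h
      exact h2 ⟨not_le.1 h, by linarith [h1.2]⟩
    have h4 : s + τ ∈ Set.Ioc (t k) (t k + τ) := ⟨h1.1, by linarith⟩
    have := Finset.single_le_sum (f := fun k => 2 * (Set.Ioc (t k) (t k + τ)).indicator (fun r => ‖u k r‖ₑ ^ 2) (s + τ))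
      (fun _ _ => zero_le (a := _)) hk
    rwa [Set.indicator_of_mem h4] at this
  have b₃ : ∀ k ∈ Finset.range N, s ∈ Set.Ioc (t k) (t (k + 1)) → s + τ ∉ Set.Ioc (t k) (t (k + 1)) →
      2 * ‖u k s‖ₑ ^ 2 ≤ S₃ := by
    intro k hk h1 h2
    have h3 : t (k + 1) < s + τ := by
      by_contra h
      exact h2 ⟨by linarith [h1.1], not_lt.1 h⟩
    have h4 : s ∈ Set.Ioc (t (k + 1) - τ) (t (k + 1)) := ⟨by linarith, h1.2⟩
    have := Finset.single_le_sum (f := fun k => 2 * (Set.Ioc (t (k + 1) - τ) (t (k + 1))).indicator (fun r => ‖u k r‖ₑ ^ 2) s)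
      (fun _ _ => zero_le (a := _)) hk
    rwa [Set.indicator_of_mem h4] at this
  by_cases h : ∀ k ∈ Finset.range N, s ∉ Set.Ioc (t k) (t (k + 1)) <;>
    by_cases h' : ∀ k ∈ Finset.range N, s + τ ∉ Set.Ioc (t k) (t (k + 1))
  · simp [pieced_eq_zero u h, pieced_eq_zero u h']
  · push Not at h'
    obtain ⟨k, hk, hs⟩ := h'
    rw [pieced_eq_zero u h, pieced_eq ht u hk hs, sub_zero]
    calc ‖u k (s + τ)‖ₑ ^ 2 ≤ 2 * ‖u k (s + τ)‖ₑ ^ 2 := le_mul_of_one_le_left (zero_le (a := _)) (by norm_num)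
      _ ≤ S₂ := b₂ k hk hs (h k hk)
      _ ≤ S₁ + S₂ + S₃ := le_add_right le_add_self
  · push Not at h
    obtain ⟨k, hk, hs⟩ := h
    rw [pieced_eq_zero u h', pieced_eq ht u hk hs, zero_sub, enorm_neg]
    calc ‖u k s‖ₑ ^ 2 ≤ 2 * ‖u k s‖ₑ ^ 2 := le_mul_of_one_le_left (zero_le (a := _)) (by norm_num)
      _ ≤ S₃ := b₃ k hk hs (h' k hk)
      _ ≤ S₁ + S₂ + S₃ := le_add_self
  · push Not at h h'
    obtain ⟨j, hj, hsj⟩ := h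
    obtain ⟨k, hk, hsk⟩ := h'
    rw [pieced_eq ht u hj hsj, pieced_eq ht u hk hsk]
    by_cases hjs : s + τ ∈ Set.Ioc (t j) (t (j + 1))
    · rw [← pieced_eq ht u hk hsk, pieced_eq ht u hj hjs]
      exact (Finset.single_le_sum (f := fun k => ‖u k (s + τ) - u k s‖ₑ ^ 2) (fun _ _ => zero_le (a := _)) hj).trans
        (le_add_right le_self_add)
    · have hks : s ∉ Set.Ioc (t k) (t (k + 1)) := by
        intro hks
        by_cases hjk : j = k
        · exact hjs (hjk ▸ hsk)
        · rcases lt_or_gt_of_ne hjk with h | h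
          · exact absurd (hsj.2.trans (ht (by omega : j + 1 ≤ k))) (not_le.2 hks.1)
          · exact absurd (hks.2.trans (ht (by omega : k + 1 ≤ j))) (not_le.2 hsj.1)
      calc _ ≤ 2 * ‖u k (s + τ)‖ₑ ^ 2 + 2 * ‖u j s‖ₑ ^ 2 := enorm_sub_sq_le _ _
        _ ≤ S₂ + S₃ := add_le_add (b₂ k hk hsk hks) (b₃ j hj hsj hjs)
        _ ≤ S₁ + S₂ + S₃ := by rw [add_assoc]; exact le_add_self

/-- The piecewise free evolution. -/
noncomputable def pw (t : ℕ → ℝ) (N : ℕ) (φ : ℕ → 𝓢(V, ℂ)) (x : V) : ℝ → ℂ :=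
  pieced t N fun k s => uS s (φ k) x

theorem measurable_pw (t : ℕ → ℝ) (N : ℕ) (φ : ℕ → 𝓢(V, ℂ)) : Measurable fun z : ℝ × V => pw t N φ z.2 z.1 := by
  unfold pw pieced
  refine Finset.measurable_fun_sum _ fun k _ => ?_
  have h : (fun z : ℝ × V => (Set.Ioc (t k) (t (k + 1))).indicator (fun s => uS s (φ k) z.2) z.1) =
      (Prod.fst ⁻¹' Set.Ioc (t k) (t (k + 1))).indicator (fun z : ℝ × V => uS z.1 (φ k) z.2) := by
    ext z; simp only [Set.indicator, Set.mem_preimage]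
  rw [h]
  exact (continuous_uS_apply (φ k)).measurable.indicator (measurable_fst measurableSet_Ioc)

/-- The squared weight `⟨x⟩^{-2}`. -/
noncomputable def wt (x : V) : ℝ≥0∞ := ENNReal.ofReal ((1 + ‖x‖ ^ 2)⁻¹)

theorem measurable_wt : Measurable (wt : V → ℝ≥0∞) := by
  unfold wt; fun_prop

theorem wt_le_one (x : V) : wt x ≤ 1 := by
  rw [wt, ← ENNReal.ofReal_one]
  exact ENNReal.ofReal_le_ofReal (inv_le_one_of_one_le₀ (by nlinarith [sq_nonneg ‖x‖]))

theorem wt_ne_top (x : V) : wt x ≠ ⊤ := ENNReal.ofReal_ne_top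

theorem lintegral_wt_uS_le (φ : 𝓢(V, ℂ)) (s : ℝ) :
    ∫⁻ x, wt x * ‖uS s φ x‖ₑ ^ 2 ≤ ‖φ.toLp 2 volume‖ₑ ^ 2 := by
  calc _ ≤ ∫⁻ x, ‖uS s φ x‖ₑ ^ 2 := lintegral_mono fun x => mul_le_of_le_one_left (zero_le (a := _)) (wt_le_one x)
    _ = _ := by rw [lintegral_enorm_sq_toLp, ← ofReal_norm, norm_toLp_uS, ofReal_norm]

theorem setLIntegral_sub_mul_self (C : ℝ≥0∞) (hC : C ≠ ⊤) :
    ∫⁻ τ in Set.Ioc (0 : ℝ) 1, ENNReal.ofReal (τ ^ (-(3 / 2) : ℝ)) * (2 * (ENNReal.ofReal τ * C)) = 4 * C := by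
  calc _ = ∫⁻ τ in Set.Ioc (0 : ℝ) 1, (2 * C) * ENNReal.ofReal (τ ^ (-(1 / 2) : ℝ)) := by
        refine setLIntegral_congr_fun measurableSet_Ioc fun τ hτ => ?_
        have e : τ ^ (-(1 / 2) : ℝ) = τ ^ (-(3 / 2) : ℝ) * τ := by
          rw [← Real.rpow_add_one hτ.1.ne']; norm_num
        rw [e, ENNReal.ofReal_mul (Real.rpow_nonneg hτ.1.le _)]; ring
    _ = 4 * C := by
        rw [lintegral_const_mul' _ _ (ENNReal.mul_ne_top (by norm_num) hC), lintegral_Ioc_rpow (by norm_num) zero_le_one]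
        norm_num
        ring

theorem lintegral_indicator_wt_le (φ : 𝓢(V, ℂ)) (a b : ℝ) :
    ∫⁻ s, ∫⁻ x, wt x * (Set.Ioc a b).indicator (fun r => ‖uS r φ x‖ₑ ^ 2) s ≤ ENNReal.ofReal (b - a) * ‖φ.toLp 2 volume‖ₑ ^ 2 := by
  calc _ ≤ ∫⁻ s, (Set.Ioc a b).indicator (fun _ => ‖φ.toLp 2 volume‖ₑ ^ 2) s := by
        refine lintegral_mono fun s => ?_
        by_cases hs : s ∈ Set.Ioc a b
        · simp only [Set.indicator_of_mem hs]
          exact lintegral_wt_uS_le φ s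
        · simp [Set.indicator_of_notMem hs]
    _ = _ := by
        rw [lintegral_indicator measurableSet_Ioc, lintegral_const]
        simp [mul_comm]

theorem measurable_uS_enorm (φ : 𝓢(V, ℂ)) : Measurable fun z : ℝ × V => ‖uS z.1 φ z.2‖ₑ ^ 2 :=
  (continuous_uS_apply φ).measurable.enorm.pow_const 2

theorem measurable_uS_indicator (φ : 𝓢(V, ℂ)) (a b : ℝ) :
    Measurable fun z : ℝ × V => (Set.Ioc a b).indicator (fun r => ‖uS r φ z.2‖ₑ ^ 2) z.1 := by
  have h : (fun z : ℝ × V => (Set.Ioc a b).indicator (fun r => ‖uS r φ z.2‖ₑ ^ 2) z.1) =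
      (Prod.fst ⁻¹' Set.Ioc a b).indicator (fun z : ℝ × V => ‖uS z.1 φ z.2‖ₑ ^ 2) := by
    ext z; simp only [Set.indicator, Set.mem_preimage]
  rw [h]
  exact (measurable_uS_enorm φ).indicator (measurable_fst measurableSet_Ioc)

theorem measurable_pw_swap (t : ℕ → ℝ) (N : ℕ) (φ : ℕ → 𝓢(V, ℂ)) : Measurable fun z : V × ℝ => pw t N φ z.1 z.2 := by
  have h : Measurable fun z : V × ℝ => (z.2, z.1) := by fun_prop
  exact ((measurable_pw t N φ).comp h :)

theorem measurable_pw_diff (t : ℕ → ℝ) (N : ℕ) (φ : ℕ → 𝓢(V, ℂ)) :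
    Measurable fun z : (ℝ × ℝ) × V => ‖pw t N φ z.2 (z.1.2 + z.1.1) - pw t N φ z.2 z.1.2‖ₑ ^ 2 := by
  have mpw := measurable_pw t N φ
  have a1 : Measurable fun z : (ℝ × ℝ) × V => (z.1.2 + z.1.1, z.2) := by fun_prop
  have a2 : Measurable fun z : (ℝ × ℝ) × V => (z.1.2, z.2) := by fun_prop
  have b1 := mpw.comp a1
  have b2 := mpw.comp a2
  exact ((b1.sub b2).enorm.pow_const 2 :)

theorem measurable_pw_frac (t : ℕ → ℝ) (N : ℕ) (φ : ℕ → 𝓢(V, ℂ)) :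
    Measurable fun z : V × ℝ => ENNReal.ofReal (z.2 ^ (-(3 / 2) : ℝ)) * ∫⁻ s, ‖pw t N φ z.1 (s + z.2) - pw t N φ z.1 s‖ₑ ^ 2 := by
  have mdiff := measurable_pw_diff t N φ
  refine (measurable_snd.pow_const _).ennreal_ofReal.mul ?_
  have a3 : Measurable fun z : (V × ℝ) × ℝ => ((z.1.2, z.2), z.1.1) := by fun_prop
  have b3 := mdiff.comp a3
  have b4 := b3.lintegral_prod_right' (ν := (volume : Measure ℝ))
  exact b4

theorem lintegral_lintegral_finsetSum {α β : Type*} [MeasurableSpace α] [MeasurableSpace β] {μ : Measure α} {ν : Measure β} [SFinite ν]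
    (S : Finset ℕ) {f : ℕ → α → β → ℝ≥0∞} (hf : ∀ k, Measurable fun z : α × β => f k z.1 z.2) :
    ∫⁻ a, ∫⁻ b, ∑ k ∈ S, f k a b ∂ν ∂μ = ∑ k ∈ S, ∫⁻ a, ∫⁻ b, f k a b ∂ν ∂μ := by
  rw [← lintegral_finsetSum _ fun k _ => (hf k).lintegral_prod_right']
  refine lintegral_congr fun s => ?_
  exact lintegral_finsetSum _ fun k _ => (hf k).comp measurable_prodMk_left

theorem lintegral_add_two_mul {α : Type*} [MeasurableSpace α] {μ : Measure α} {f g h : α → ℝ≥0∞} (hf : Measurable f) (hg : Measurable g) :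
    ∫⁻ a, (f a + 2 * g a + 2 * h a) ∂μ = (∫⁻ a, f a ∂μ) + 2 * (∫⁻ a, g a ∂μ) + 2 * ∫⁻ a, h a ∂μ := by
  rw [lintegral_add_left (f := fun a => f a + 2 * g a) (hf.add (hg.const_mul 2)), lintegral_add_left hf,
    lintegral_const_mul' _ _ (by norm_num), lintegral_const_mul' _ _ (by norm_num)]

theorem lintegral_lintegral_add_two_mul {α β : Type*} [MeasurableSpace α] [MeasurableSpace β] {μ : Measure α} {ν : Measure β} [SFinite ν]
    {f g h : α → β → ℝ≥0∞} (hf : Measurable fun z : α × β => f z.1 z.2) (hg : Measurable fun z : α × β => g z.1 z.2) :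
    ∫⁻ a, ∫⁻ b, (f a b + 2 * g a b + 2 * h a b) ∂ν ∂μ =
      (∫⁻ a, ∫⁻ b, f a b ∂ν ∂μ) + 2 * (∫⁻ a, ∫⁻ b, g a b ∂ν ∂μ) + 2 * ∫⁻ a, ∫⁻ b, h a b ∂ν ∂μ := by
  have i1 : ∀ a, ∫⁻ b, (f a b + 2 * g a b + 2 * h a b) ∂ν = (∫⁻ b, f a b ∂ν) + 2 * (∫⁻ b, g a b ∂ν) + 2 * ∫⁻ b, h a b ∂ν := fun a =>
    lintegral_add_two_mul (f := f a) (g := g a) (hf.comp measurable_prodMk_left) (hg.comp measurable_prodMk_left)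
  simp_rw [i1]
  exact lintegral_add_two_mul hf.lintegral_prod_right' hg.lintegral_prod_right'

theorem lintegral_wt_pw_le {C₁ : ℝ}
    (h₁ : ∀ φ : 𝓢(V, ℂ), ∫⁻ s : ℝ, ∫⁻ x, wt x * ‖uS s φ x‖ₑ ^ 2 ≤ ENNReal.ofReal C₁ * ‖φ.toLp 2 volume‖ₑ ^ 2)
    {t : ℕ → ℝ} (ht : Monotone t) (N : ℕ) (φ : ℕ → 𝓢(V, ℂ)) :
    ∫⁻ x, wt x * ∫⁻ s, ‖pw t N φ x s‖ₑ ^ 2 ≤ ∑ k ∈ Finset.range N, ENNReal.ofReal C₁ * ‖(φ k).toLp 2 volume‖ₑ ^ 2 := by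
  calc _ = ∫⁻ x, ∫⁻ s, wt x * ‖pw t N φ x s‖ₑ ^ 2 := by
        refine lintegral_congr fun x => ?_
        rw [lintegral_const_mul' _ _ (wt_ne_top x)]
    _ = ∫⁻ s, ∫⁻ x, wt x * ‖pw t N φ x s‖ₑ ^ 2 := by
        refine lintegral_lintegral_swap (Measurable.aemeasurable ?_)
        have m := (measurable_pw_swap t N φ).enorm.pow_const 2
        have m' := (measurable_wt (V := V)).comp (measurable_fst : Measurable (Prod.fst : V × ℝ → V))
        exact (m'.mul m :)
    _ ≤ ∫⁻ s, ∫⁻ x, ∑ k ∈ Finset.range N, wt x * ‖uS s (φ k) x‖ₑ ^ 2 := by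
        refine lintegral_mono fun s => lintegral_mono fun x => ?_
        simp only [← Finset.mul_sum]
        exact mul_le_mul_right (enorm_pieced_sq_le ht N _ s) _
    _ = ∑ k ∈ Finset.range N, ∫⁻ s, ∫⁻ x, wt x * ‖uS s (φ k) x‖ₑ ^ 2 := by
        have m : ∀ k, Measurable fun z : ℝ × V => wt z.2 * ‖uS z.1 (φ k) z.2‖ₑ ^ 2 := fun k =>
          (measurable_wt.comp measurable_snd).mul (measurable_uS_enorm (φ k))
        exact lintegral_lintegral_finsetSum _ m
    _ ≤ _ := Finset.sum_le_sum fun k _ => h₁ (φ k)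

theorem lintegral_wt_pw_diff_le {t : ℕ → ℝ} (ht : Monotone t) (N : ℕ) (φ : ℕ → 𝓢(V, ℂ)) {τ : ℝ} (hτ0 : 0 < τ) :
    ∫⁻ s, ∫⁻ x, wt x * ‖pw t N φ x (s + τ) - pw t N φ x s‖ₑ ^ 2 ≤
      ∑ k ∈ Finset.range N, ((∫⁻ s, ∫⁻ x, wt x * ‖uS (s + τ) (φ k) x - uS s (φ k) x‖ₑ ^ 2) +
        2 * (ENNReal.ofReal τ * ‖(φ k).toLp 2 volume‖ₑ ^ 2) +
        2 * (ENNReal.ofReal τ * ‖(φ k).toLp 2 volume‖ₑ ^ 2)) := by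
  have m1 : ∀ k, Measurable fun z : ℝ × V => wt z.2 * ‖uS (z.1 + τ) (φ k) z.2 - uS z.1 (φ k) z.2‖ₑ ^ 2 := fun k => by
    have a5 : Measurable fun z : ℝ × V => (z.1 + τ, z.2) := by fun_prop
    have hu := (continuous_uS_apply (φ k)).measurable
    exact (measurable_wt.comp measurable_snd).mul (((hu.comp a5).sub hu).enorm.pow_const 2)
  have m3 : ∀ k, Measurable fun z : ℝ × V => wt z.2 * (Set.Ioc (t (k + 1) - τ) (t (k + 1))).indicator (fun r => ‖uS r (φ k) z.2‖ₑ ^ 2) z.1 := fun k =>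
    (measurable_wt.comp measurable_snd).mul (measurable_uS_indicator (φ k) _ _)
  have m2 : ∀ k, Measurable fun z : ℝ × V => wt z.2 * (Set.Ioc (t k) (t k + τ)).indicator (fun r => ‖uS r (φ k) z.2‖ₑ ^ 2) (z.1 + τ) := fun k => by
    have a5 : Measurable fun z : ℝ × V => (z.1 + τ, z.2) := by fun_prop
    exact (measurable_wt.comp measurable_snd).mul ((measurable_uS_indicator (φ k) _ _).comp a5)
  calc _ ≤ ∫⁻ s, ∫⁻ x, ∑ k ∈ Finset.range N, (wt x * ‖uS (s + τ) (φ k) x - uS s (φ k) x‖ₑ ^ 2 +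
        2 * (wt x * (Set.Ioc (t k) (t k + τ)).indicator (fun r => ‖uS r (φ k) x‖ₑ ^ 2) (s + τ)) +
        2 * (wt x * (Set.Ioc (t (k + 1) - τ) (t (k + 1))).indicator (fun r => ‖uS r (φ k) x‖ₑ ^ 2) s)) := by
        refine lintegral_mono fun s => lintegral_mono fun x => ?_
        refine (mul_le_mul_right (enorm_pieced_sub_sq_le ht N _ s hτ0) _).trans_eq ?_
        rw [Finset.mul_sum]
        refine Finset.sum_congr rfl fun k _ => ?_
        ring
    _ = ∑ k ∈ Finset.range N, ((∫⁻ s, ∫⁻ x, wt x * ‖uS (s + τ) (φ k) x - uS s (φ k) x‖ₑ ^ 2) +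
        2 * (∫⁻ s, ∫⁻ x, wt x * (Set.Ioc (t k) (t k + τ)).indicator (fun r => ‖uS r (φ k) x‖ₑ ^ 2) (s + τ)) +
        2 * (∫⁻ s, ∫⁻ x, wt x * (Set.Ioc (t (k + 1) - τ) (t (k + 1))).indicator (fun r => ‖uS r (φ k) x‖ₑ ^ 2) s)) := by
        have mm : ∀ k, Measurable fun z : ℝ × V => wt z.2 * ‖uS (z.1 + τ) (φ k) z.2 - uS z.1 (φ k) z.2‖ₑ ^ 2 +
            2 * (wt z.2 * (Set.Ioc (t k) (t k + τ)).indicator (fun r => ‖uS r (φ k) z.2‖ₑ ^ 2) (z.1 + τ)) +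
            2 * (wt z.2 * (Set.Ioc (t (k + 1) - τ) (t (k + 1))).indicator (fun r => ‖uS r (φ k) z.2‖ₑ ^ 2) z.1) := fun k =>
          ((m1 k).add ((m2 k).const_mul 2)).add ((m3 k).const_mul 2)
        exact (lintegral_lintegral_finsetSum _ mm).trans (Finset.sum_congr rfl fun k _ => lintegral_lintegral_add_two_mul (m1 k) (m2 k))
    _ ≤ _ := by
        refine Finset.sum_le_sum fun k _ => add_le_add (add_le_add le_rfl ?_) ?_
        · refine mul_le_mul_right ?_ _
          rw [lintegral_add_right_eq_self (fun s => ∫⁻ x, wt x * (Set.Ioc (t k) (t k + τ)).indicator (fun r => ‖uS r (φ k) x‖ₑ ^ 2) s) τ]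
          refine (lintegral_indicator_wt_le (φ k) _ _).trans_eq ?_
          rw [add_sub_cancel_left]
        · refine mul_le_mul_right ((lintegral_indicator_wt_le (φ k) _ _).trans_eq ?_) _
          rw [show t (k + 1) - (t (k + 1) - τ) = τ by ring]

theorem lintegral_wt_pw_frac_le {C₂ : ℝ} (h₂ : ∀ φ : 𝓢(V, ℂ), ∫⁻ τ in Set.Ioc (0 : ℝ) 1, ENNReal.ofReal (τ ^ (-(3 / 2) : ℝ)) *
      ∫⁻ s : ℝ, ∫⁻ x, wt x * ‖uS (s + τ) φ x - uS s φ x‖ₑ ^ 2 ≤ ENNReal.ofReal C₂ * ‖φ.toLp 2 volume‖ₑ ^ 2)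
    {t : ℕ → ℝ} (ht : Monotone t) (N : ℕ) (φ : ℕ → 𝓢(V, ℂ)) :
    ∫⁻ x, wt x * ∫⁻ τ in Set.Ioc (0 : ℝ) 1, ENNReal.ofReal (τ ^ (-(3 / 2) : ℝ)) * ∫⁻ s, ‖pw t N φ x (s + τ) - pw t N φ x s‖ₑ ^ 2 ≤
      ∑ k ∈ Finset.range N, (ENNReal.ofReal C₂ + 4 + 4) * ‖(φ k).toLp 2 volume‖ₑ ^ 2 := by
  calc _ = ∫⁻ x, ∫⁻ τ in Set.Ioc (0 : ℝ) 1, wt x * (ENNReal.ofReal (τ ^ (-(3 / 2) : ℝ)) * ∫⁻ s, ‖pw t N φ x (s + τ) - pw t N φ x s‖ₑ ^ 2) := by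
        refine lintegral_congr fun x => ?_
        rw [lintegral_const_mul' _ _ (wt_ne_top x)]
    _ = ∫⁻ τ in Set.Ioc (0 : ℝ) 1, ∫⁻ x, wt x * (ENNReal.ofReal (τ ^ (-(3 / 2) : ℝ)) * ∫⁻ s, ‖pw t N φ x (s + τ) - pw t N φ x s‖ₑ ^ 2) := by
        refine lintegral_lintegral_swap (Measurable.aemeasurable ?_)
        exact (measurable_wt.comp measurable_fst).mul (measurable_pw_frac t N φ)
    _ = ∫⁻ τ in Set.Ioc (0 : ℝ) 1, ENNReal.ofReal (τ ^ (-(3 / 2) : ℝ)) * ∫⁻ s, ∫⁻ x, wt x * ‖pw t N φ x (s + τ) - pw t N φ x s‖ₑ ^ 2 := by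
        refine lintegral_congr fun τ => ?_
        rw [← lintegral_const_mul' _ _ ENNReal.ofReal_ne_top]
        have m : Measurable fun z : V × ℝ => wt z.1 * ‖pw t N φ z.1 (z.2 + τ) - pw t N φ z.1 z.2‖ₑ ^ 2 := by
          have a4 : Measurable fun z : V × ℝ => ((τ, z.2), z.1) := by fun_prop
          have m' := (measurable_pw_diff t N φ).comp a4
          exact (measurable_wt.comp measurable_fst).mul m'
        calc _ = ∫⁻ x, ENNReal.ofReal (τ ^ (-(3 / 2) : ℝ)) * ∫⁻ s, wt x * ‖pw t N φ x (s + τ) - pw t N φ x s‖ₑ ^ 2 := by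
              refine lintegral_congr fun x => ?_
              rw [lintegral_const_mul' _ _ (wt_ne_top x)]; ring
          _ = _ := by
              rw [lintegral_const_mul' _ _ ENNReal.ofReal_ne_top, lintegral_const_mul' _ _ ENNReal.ofReal_ne_top,
                lintegral_lintegral_swap m.aemeasurable]
    _ ≤ ∫⁻ τ in Set.Ioc (0 : ℝ) 1, ∑ k ∈ Finset.range N, (ENNReal.ofReal (τ ^ (-(3 / 2) : ℝ)) * (∫⁻ s, ∫⁻ x, wt x * ‖uS (s + τ) (φ k) x - uS s (φ k) x‖ₑ ^ 2) +
          ENNReal.ofReal (τ ^ (-(3 / 2) : ℝ)) * (2 * (ENNReal.ofReal τ * ‖(φ k).toLp 2 volume‖ₑ ^ 2)) +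
          ENNReal.ofReal (τ ^ (-(3 / 2) : ℝ)) * (2 * (ENNReal.ofReal τ * ‖(φ k).toLp 2 volume‖ₑ ^ 2))) := by
        refine setLIntegral_mono' measurableSet_Ioc fun τ hτ => ?_
        have hτ0 : 0 < τ := hτ.1
        simp only [← mul_add, ← Finset.mul_sum]
        refine mul_le_mul_right ?_ _
        exact lintegral_wt_pw_diff_le ht N φ hτ0
    _ = ∑ k ∈ Finset.range N, ((∫⁻ τ in Set.Ioc (0 : ℝ) 1, ENNReal.ofReal (τ ^ (-(3 / 2) : ℝ)) * (∫⁻ s, ∫⁻ x, wt x * ‖uS (s + τ) (φ k) x - uS s (φ k) x‖ₑ ^ 2)) +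
          4 * ‖(φ k).toLp 2 volume‖ₑ ^ 2 + 4 * ‖(φ k).toLp 2 volume‖ₑ ^ 2) := by
        have hp : Measurable fun τ : ℝ => ENNReal.ofReal (τ ^ (-(3 / 2) : ℝ)) := (measurable_id.pow_const _).ennreal_ofReal
        have c2 : ∀ k, Measurable fun τ : ℝ => ENNReal.ofReal (τ ^ (-(3 / 2) : ℝ)) * (2 * (ENNReal.ofReal τ * ‖(φ k).toLp 2 volume‖ₑ ^ 2)) := fun k =>
          hp.mul ((ENNReal.measurable_ofReal.mul_const _).const_mul _)
        have c1 : ∀ k, Measurable fun τ : ℝ => ENNReal.ofReal (τ ^ (-(3 / 2) : ℝ)) * (∫⁻ s, ∫⁻ x, wt x * ‖uS (s + τ) (φ k) x - uS s (φ k) x‖ₑ ^ 2) := fun k => by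
          refine hp.mul ?_
          have hu := (continuous_uS_apply (φ k)).measurable
          have a6 : Measurable fun z : (ℝ × ℝ) × V => (z.1.2 + z.1.1, z.2) := by fun_prop
          have a7 : Measurable fun z : (ℝ × ℝ) × V => (z.1.2, z.2) := by fun_prop
          have m : Measurable fun z : (ℝ × ℝ) × V => wt z.2 * ‖uS (z.1.2 + z.1.1) (φ k) z.2 - uS z.1.2 (φ k) z.2‖ₑ ^ 2 :=
            (measurable_wt.comp measurable_snd).mul (((hu.comp a6).sub (hu.comp a7)).enorm.pow_const 2)
          exact m.lintegral_prod_right'.lintegral_prod_right'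
        refine (lintegral_finsetSum _ fun k _ => (((c1 k).add (c2 k)).add (c2 k) :)).trans (Finset.sum_congr rfl fun k _ => ?_)
        refine (lintegral_add_left ((c1 k).add (c2 k) :) _).trans ?_
        refine congrArg₂ _ ((lintegral_add_left (c1 k) _).trans ?_) (setLIntegral_sub_mul_self _ (by simp))
        exact congrArg₂ _ rfl (setLIntegral_sub_mul_self _ (by simp))
    _ ≤ _ := by
        refine Finset.sum_le_sum fun k _ => ?_
        rw [add_mul, add_mul]
        exact add_le_add (add_le_add (h₂ (φ k)) le_rfl) le_rfl

/-- The weighted difference-quotient norm of a piecewise free evolution. -/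
theorem lintegral_wt_sobQ_pw_le (hd : 3 ≤ Module.finrank ℝ V) : ∃ C : ℝ≥0∞, C ≠ ⊤ ∧
    ∀ (t : ℕ → ℝ), Monotone t → ∀ (N : ℕ) (φ : ℕ → 𝓢(V, ℂ)),
      ∫⁻ x, wt x * sobQ (pw t N φ x) ≤ C * ∑ k ∈ Finset.range N, ‖(φ k).toLp 2 volume‖ₑ ^ 2 := by
  obtain ⟨C₁, -, h₁⟩ := lintegral_weight_uS_le_norm hd
  obtain ⟨C₂, -, h₂⟩ := lintegral_weight_uS_diff_le hd
  refine ⟨ENNReal.ofReal C₁ + (ENNReal.ofReal C₂ + 4 + 4), by simp [ENNReal.add_eq_top], fun t ht N φ => ?_⟩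
  calc ∫⁻ x, wt x * sobQ (pw t N φ x) = (∫⁻ x, wt x * ∫⁻ s, ‖pw t N φ x s‖ₑ ^ 2) +
        ∫⁻ x, wt x * ∫⁻ τ in Set.Ioc (0 : ℝ) 1, ENNReal.ofReal (τ ^ (-(3 / 2) : ℝ)) * ∫⁻ s, ‖pw t N φ x (s + τ) - pw t N φ x s‖ₑ ^ 2 := by
        unfold sobQ
        simp_rw [mul_add]
        refine lintegral_add_left (measurable_wt.mul ?_) _
        exact Measurable.lintegral_prod_right' (f := fun z : V × ℝ => ‖pw t N φ z.1 z.2‖ₑ ^ 2) ((measurable_pw_swap t N φ).enorm.pow_const 2)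
    _ ≤ _ := add_le_add (lintegral_wt_pw_le h₁ ht N φ) (lintegral_wt_pw_frac_le h₂ ht N φ)
    _ = _ := by rw [← Finset.mul_sum, ← Finset.mul_sum]; ring

end Pieces

section Advanced

variable {V : Type*} [NormedAddCommGroup V] [InnerProductSpace ℝ V] [FiniteDimensional ℝ V]
  [MeasurableSpace V] [BorelSpace V]

theorem integrable_U_srcL2 (g : 𝓢(ℝ × V, ℂ)) : Integrable fun s => U (-s) (srcL2 g s) := by
  obtain ⟨C, -, hC⟩ := norm_srcL2_le g
  refine (integrable_inv_one_add_sq.const_mul C).mono' ?_ (Eventually.of_forall fun s => ?_)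
  · exact (continuous_U.comp (continuous_neg.prodMk (continuous_srcL2 g))).aestronglyMeasurable
  · rw [LinearIsometryEquiv.norm_map]
    exact hC s

/-- The source pulled back to time zero and accumulated up to time `t`. -/
noncomputable def adv (g : 𝓢(ℝ × V, ℂ)) (t : ℝ) : L2 V := ∫ s in Set.Iic t, U (-s) (srcL2 g s)

theorem adv_sub (g : 𝓢(ℝ × V, ℂ)) {a b : ℝ} (h : a ≤ b) :
    adv g b - adv g a = ∫ s in Set.Ioc a b, U (-s) (srcL2 g s) := by
  rw [adv, adv, intervalIntegral.integral_Iic_sub_Iic (integrable_U_srcL2 g).integrableOn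
    (integrable_U_srcL2 g).integrableOn, intervalIntegral.integral_of_le h]

theorem inner_adv_sub (g : 𝓢(ℝ × V, ℂ)) {a b : ℝ} (h : a ≤ b) (φ : 𝓢(V, ℂ)) :
    inner ℂ (φ.toLp 2 volume : L2 V) (adv g b - adv g a) = ∫ s in Set.Ioc a b, ∫ x, conj (uS s φ x) * src g s x := by
  rw [adv_sub g h, ← integral_inner (integrable_U_srcL2 g).integrableOn]
  refine integral_congr_ae (Eventually.of_forall fun s => ?_)
  have e : inner ℂ (φ.toLp 2 volume : L2 V) (U (-s) (srcL2 g s)) = inner ℂ ((uS s φ).toLp 2 volume : L2 V) (srcL2 g s) := by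
    rw [← U_toLp, inner_U_left]
  simp only [e]
  rw [inner_toLp]
  refine integral_congr_ae ?_
  filter_upwards [(memLp_src g s).coeFn_toLp] with x hx
  rw [srcL2, hx]

theorem integrable_pairing (g : 𝓢(ℝ × V, ℂ)) (φ : 𝓢(V, ℂ)) (a b : ℝ) :
    Integrable (fun z : ℝ × V => conj (uS z.1 φ z.2) * src g z.1 z.2)
      ((volume.restrict (Set.Ioc a b)).prod volume) := by
  obtain ⟨C, hC0, hC⟩ := norm_src_le g
  have hD := fun s x => norm_uS_apply_le s φ x
  set D := ∫ ξ, ‖𝓕 φ ξ‖ with hDdef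
  have hD0 : 0 ≤ D := integral_nonneg fun _ => norm_nonneg _
  have h1 : Integrable (fun z : ℝ × V => (D * C) * ((1 + z.1 ^ 2)⁻¹ * maj z.2)) ((volume.restrict (Set.Ioc a b)).prod volume) :=
    (Integrable.mul_prod (f := fun s : ℝ => (1 + s ^ 2)⁻¹) (g := maj)
      integrable_inv_one_add_sq.integrableOn integrable_maj).const_mul _
  refine h1.mono' ?_ (Eventually.of_forall fun z => ?_)
  · have m1 : Measurable fun z : ℝ × V => conj (uS z.1 φ z.2) := (continuous_uS_apply φ).star.measurable
    exact (m1.mul (measurable_src g)).aestronglyMeasurable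
  · rw [norm_mul, RCLike.norm_conj]
    calc ‖uS z.1 φ z.2‖ * ‖src g z.1 z.2‖ ≤ D * (C * (1 + z.1 ^ 2)⁻¹ * maj z.2) :=
          mul_le_mul (hD _ _) (hC _ _) (norm_nonneg _) hD0
      _ = _ := by ring

theorem inner_adv_sub_eq (g : 𝓢(ℝ × V, ℂ)) {a b : ℝ} (h : a ≤ b) (φ : 𝓢(V, ℂ)) :
    inner ℂ (φ.toLp 2 volume : L2 V) (adv g b - adv g a) = ∫ x, ∫ s in Set.Ioc a b, conj (uS s φ x) * src g s x := by
  rw [inner_adv_sub g h]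
  exact integral_integral_swap (f := fun s x => conj (uS s φ x) * src g s x) (integrable_pairing g φ a b)

theorem memLp_indicator_uS (φ : 𝓢(V, ℂ)) (a b : ℝ) (x : V) (p : ℝ≥0∞) :
    MemLp ((Set.Ioc a b).indicator fun s => uS s φ x) p := by
  rw [memLp_indicator_iff_restrict measurableSet_Ioc]
  refine MemLp.of_bound ?_ (∫ ξ, ‖𝓕 φ ξ‖) (Eventually.of_forall fun s => norm_uS_apply_le s φ x)
  have := (continuous_uS_apply φ).comp (Continuous.prodMk_left x)
  exact Continuous.aestronglyMeasurable this

theorem memLp_pw (t : ℕ → ℝ) (N : ℕ) (φ : ℕ → 𝓢(V, ℂ)) (x : V) (p : ℝ≥0∞) : MemLp (pw t N φ x) p := by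
  have := memLp_finsetSum (Finset.range N) fun k _ => memLp_indicator_uS (φ k) (t k) (t (k + 1)) x p
  have e : pw t N φ x = fun s => ∑ k ∈ Finset.range N, (Set.Ioc (t k) (t (k + 1))).indicator (fun s => uS s (φ k) x) s := rfl
  rwa [e]

theorem integral_conj_pw (g : 𝓢(ℝ × V, ℂ)) (t : ℕ → ℝ) (N : ℕ) (φ : ℕ → 𝓢(V, ℂ)) (x : V) :
    ∑ k ∈ Finset.range N, ∫ s in Set.Ioc (t k) (t (k + 1)), conj (uS s (φ k) x) * src g s x =
      (((1 + ‖x‖ ^ 2) ^ (-(1 : ℝ) / 2) : ℝ) : ℂ) * ∫ s, conj (pw t N φ x s) * quarterD (slice g x) s := by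
  have e : ∀ s, (((1 + ‖x‖ ^ 2) ^ (-(1 : ℝ) / 2) : ℝ) : ℂ) * (conj (pw t N φ x s) * quarterD (slice g x) s) =
      ∑ k ∈ Finset.range N, (Set.Ioc (t k) (t (k + 1))).indicator (fun s => conj (uS s (φ k) x) * src g s x) s := by
    intro s
    rw [pw, pieced, map_sum, Finset.sum_mul, Finset.mul_sum]
    refine Finset.sum_congr rfl fun k _ => ?_
    by_cases hs : s ∈ Set.Ioc (t k) (t (k + 1))
    · rw [Set.indicator_of_mem hs, Set.indicator_of_mem hs, src]; ring
    · rw [Set.indicator_of_notMem hs, Set.indicator_of_notMem hs]; simp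
  rw [← integral_const_mul]
  simp only [e]
  rw [integral_finsetSum]
  · exact Finset.sum_congr rfl fun k _ => (integral_indicator measurableSet_Ioc).symm
  · intro k _
    rw [integrable_indicator_iff measurableSet_Ioc]
    have c1 : Continuous fun s => conj (uS s (φ k) x) := ((continuous_uS_apply (φ k)).comp (Continuous.prodMk_left x)).star
    exact (((c1.mul (continuous_src_left g x)).continuousOn (s := Set.Icc (t k) (t (k+1)))).integrableOn_Icc).mono_set Set.Ioc_subset_Icc_self

theorem sum_inner_adv_sub (g : 𝓢(ℝ × V, ℂ)) {t : ℕ → ℝ} (ht : Monotone t) (N : ℕ) (φ : ℕ → 𝓢(V, ℂ)) :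
    ∑ k ∈ Finset.range N, inner ℂ ((φ k).toLp 2 volume : L2 V) (adv g (t (k + 1)) - adv g (t k)) =
      ∫ x, (((1 + ‖x‖ ^ 2) ^ (-(1 : ℝ) / 2) : ℝ) : ℂ) * ∫ s, conj (pw t N φ x s) * quarterD (slice g x) s := by
  simp only [← integral_conj_pw]
  rw [integral_finsetSum]
  · exact Finset.sum_congr rfl fun k _ => inner_adv_sub_eq g (ht (Nat.le_succ k)) (φ k)
  · intro k _
    exact (integrable_pairing g (φ k) _ _).integral_prod_right

end Advanced

section Variation

variable {V : Type*} [NormedAddCommGroup V] [InnerProductSpace ℝ V] [FiniteDimensional ℝ V]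
  [MeasurableSpace V] [BorelSpace V]

theorem enorm_weight_sq (x : V) : ‖(((1 + ‖x‖ ^ 2) ^ (-(1 : ℝ) / 2) : ℝ) : ℂ)‖ₑ ^ 2 = wt x := by
  rw [wt, ← ofReal_norm, ← ENNReal.ofReal_pow (norm_nonneg _), Complex.norm_real, Real.norm_of_nonneg (weight_nonneg x),
    ← Real.rpow_natCast, ← Real.rpow_mul (by positivity), ← Real.rpow_neg_one]
  norm_num

theorem measurable_sobQ_pw (t : ℕ → ℝ) (N : ℕ) (φ : ℕ → 𝓢(V, ℂ)) : Measurable fun x => sobQ (pw t N φ x) := by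
  refine Measurable.add ?_ ?_
  · exact Measurable.lintegral_prod_right' (f := fun z : V × ℝ => ‖pw t N φ z.1 z.2‖ₑ ^ 2)
      ((measurable_pw_swap t N φ).enorm.pow_const 2)
  · have m := measurable_pw_frac t N φ
    exact Measurable.lintegral_prod_right' (ν := volume.restrict (Set.Ioc (0 : ℝ) 1)) m

theorem lintegral_slice_sq (g : 𝓢(ℝ × V, ℂ)) : ∫⁻ x, ∫⁻ s, ‖slice g x s‖ₑ ^ 2 = eLpNorm g 2 volume ^ 2 := by
  have m : Measurable fun z : ℝ × V => ‖g z‖ₑ ^ 2 := g.continuous.measurable.enorm.pow_const 2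
  have e : eLpNorm g 2 volume ^ 2 = ∫⁻ z : ℝ × V, ‖g z‖ₑ ^ 2 := by
    rw [eLpNorm_eq_lintegral_rpow_enorm_toReal two_ne_zero ENNReal.ofNat_ne_top, ← ENNReal.rpow_natCast, ← ENNReal.rpow_mul]
    simp
  rw [e, show (volume : Measure (ℝ × V)) = (volume : Measure ℝ).prod volume from rfl, lintegral_prod_symm' _ m]
  rfl

theorem enorm_sum_inner_sq_le (hd : 3 ≤ Module.finrank ℝ V) : ∃ C : ℝ≥0∞, C ≠ ⊤ ∧ ∀ (g : 𝓢(ℝ × V, ℂ)) (t : ℕ → ℝ), Monotone t →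
    ∀ (N : ℕ) (φ : ℕ → 𝓢(V, ℂ)),
      ‖∑ k ∈ Finset.range N, inner ℂ ((φ k).toLp 2 volume : L2 V) (adv g (t (k + 1)) - adv g (t k))‖ₑ ^ 2 ≤
        C * eLpNorm g 2 volume ^ 2 * ∑ k ∈ Finset.range N, ‖((φ k).toLp 2 volume : L2 V)‖ₑ ^ 2 := by
  obtain ⟨C, hC, h⟩ := lintegral_wt_sobQ_pw_le (V := V) hd
  refine ⟨ENNReal.ofReal 12 * C, ENNReal.mul_ne_top ENNReal.ofReal_ne_top hC, fun g t ht N φ => ?_⟩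
  rw [sum_inner_adv_sub g ht]
  set G : V → ℝ≥0∞ := fun x => ENNReal.ofReal 12 * ∫⁻ s, ‖slice g x s‖ₑ ^ 2 with hG
  set H : V → ℝ≥0∞ := fun x => wt x * sobQ (pw t N φ x) with hH
  have mG : Measurable G := by
    have m : Measurable fun z : V × ℝ => ‖slice g z.1 z.2‖ₑ ^ 2 :=
      (g.continuous.measurable.comp measurable_swap).enorm.pow_const 2
    exact (Measurable.lintegral_prod_right' m).const_mul _
  have mH : Measurable H := measurable_wt.mul (measurable_sobQ_pw t N φ)
  have hsq : ∀ a : ℝ≥0∞, (a ^ (1 / 2 : ℝ)) ^ 2 = a := fun a => by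
    rw [← ENNReal.rpow_natCast, ← ENNReal.rpow_mul]; norm_num
  have pt : ∀ x, ‖(((1 + ‖x‖ ^ 2) ^ (-(1 : ℝ) / 2) : ℝ) : ℂ) * ∫ s, conj (pw t N φ x s) * quarterD (slice g x) s‖ₑ ≤
      G x ^ (1 / 2 : ℝ) * H x ^ (1 / 2 : ℝ) := fun x => by
    refine (ENNReal.pow_le_pow_left_iff two_ne_zero).1 ?_
    rw [mul_pow, hsq, hsq, enorm_mul, mul_pow, enorm_weight_sq]
    calc _ ≤ wt x * (ENNReal.ofReal 12 * (∫⁻ s, ‖slice g x s‖ₑ ^ 2) * sobQ (pw t N φ x)) :=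
          mul_le_mul_right (enorm_integral_quarterD_sq_le (slice g x)
            (memLp_one_iff_integrable.1 (memLp_pw t N φ x 1)) (memLp_pw t N φ x 2)) _
      _ = _ := by simp only [hG, hH]; ring
  calc _ ≤ (∫⁻ x, G x ^ (1 / 2 : ℝ) * H x ^ (1 / 2 : ℝ)) ^ 2 := by
        gcongr
        exact (enorm_integral_le_lintegral_enorm _).trans (lintegral_mono pt)
    _ ≤ (∫⁻ x, (G x ^ (1 / 2 : ℝ)) ^ 2) * ∫⁻ x, (H x ^ (1 / 2 : ℝ)) ^ 2 :=
        sq_lintegral_mul_le (mG.pow_const _).aemeasurable (mH.pow_const _).aemeasurable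
    _ = (∫⁻ x, G x) * ∫⁻ x, H x := by simp only [hsq]
    _ ≤ (ENNReal.ofReal 12 * eLpNorm g 2 volume ^ 2) * (C * ∑ k ∈ Finset.range N, ‖((φ k).toLp 2 volume : L2 V)‖ₑ ^ 2) := by
        refine mul_le_mul' (le_of_eq ?_) (h t ht N φ)
        rw [hG, lintegral_const_mul' _ _ ENNReal.ofReal_ne_top, lintegral_slice_sq]
    _ = _ := by ring

theorem eLpNorm_prod_ne_top (g : 𝓢(ℝ × V, ℂ)) : eLpNorm g 2 volume ≠ ⊤ := by
  have : (volume : Measure (ℝ × V)).IsAddHaarMeasure :=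
    inferInstanceAs ((volume : Measure ℝ).prod (volume : Measure V)).IsAddHaarMeasure
  exact (g.memLp 2 volume).2.ne

theorem enorm_sum_inner_sq_le_L2 (hd : 3 ≤ Module.finrank ℝ V) : ∃ C : ℝ≥0∞, C ≠ ⊤ ∧ ∀ (g : 𝓢(ℝ × V, ℂ)) (t : ℕ → ℝ), Monotone t →
    ∀ (N : ℕ) (f : ℕ → L2 V),
      ‖∑ k ∈ Finset.range N, inner ℂ (f k) (adv g (t (k + 1)) - adv g (t k))‖ₑ ^ 2 ≤
        C * eLpNorm g 2 volume ^ 2 * ∑ k ∈ Finset.range N, ‖f k‖ₑ ^ 2 := by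
  obtain ⟨C, hC, h⟩ := enorm_sum_inner_sq_le (V := V) hd
  refine ⟨C, hC, fun g t ht N f => ?_⟩
  have hg : C * eLpNorm g 2 volume ^ 2 ≠ ⊤ := ENNReal.mul_ne_top hC (ENNReal.pow_ne_top (eLpNorm_prod_ne_top g))
  have hdense : DenseRange (Pi.map fun _ : ℕ => (toL2 : 𝓢(V, ℂ) → L2 V)) := DenseRange.piMap fun _ => denseRange_toL2
  refine hdense.induction_on (p := fun f : ℕ → L2 V => ‖∑ k ∈ Finset.range N, inner ℂ (f k) (adv g (t (k + 1)) - adv g (t k))‖ₑ ^ 2 ≤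
        C * eLpNorm g 2 volume ^ 2 * ∑ k ∈ Finset.range N, ‖f k‖ₑ ^ 2) f ?_ ?_
  · refine isClosed_le ?_ ?_
    · have c : Continuous fun f : ℕ → L2 V => ∑ k ∈ Finset.range N, inner ℂ (f k) (adv g (t (k + 1)) - adv g (t k)) :=
        continuous_finsetSum _ fun k _ => (continuous_apply k).inner continuous_const
      exact (ENNReal.continuous_pow 2).comp c.enorm
    · refine (ENNReal.continuous_const_mul hg).comp (continuous_finsetSum _ fun k _ => ?_)
      exact (ENNReal.continuous_pow 2).comp (continuous_apply k).enorm
  · intro φ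
    exact h g t ht N φ

theorem sum_enorm_adv_sub_sq_le (hd : 3 ≤ Module.finrank ℝ V) : ∃ C : ℝ≥0∞, C ≠ ⊤ ∧ ∀ (g : 𝓢(ℝ × V, ℂ)) (t : ℕ → ℝ), Monotone t →
    ∀ N : ℕ, ∑ k ∈ Finset.range N, ‖adv g (t (k + 1)) - adv g (t k)‖ₑ ^ 2 ≤ C * eLpNorm g 2 volume ^ 2 := by
  obtain ⟨C, hC, h⟩ := enorm_sum_inner_sq_le_L2 (V := V) hd
  refine ⟨C, hC, fun g t ht N => ?_⟩
  have := h g t ht N fun k => adv g (t (k + 1)) - adv g (t k)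
  set S := ∑ k ∈ Finset.range N, ‖adv g (t (k + 1)) - adv g (t k)‖ₑ ^ 2 with hS
  have hfin : S ≠ ⊤ := ENNReal.sum_ne_top.2 fun k _ => ENNReal.pow_ne_top enorm_ne_top
  have e : ‖∑ k ∈ Finset.range N, inner ℂ (adv g (t (k + 1)) - adv g (t k)) (adv g (t (k + 1)) - adv g (t k))‖ₑ = S := by
    have : ∑ k ∈ Finset.range N, inner ℂ (adv g (t (k + 1)) - adv g (t k)) (adv g (t (k + 1)) - adv g (t k)) =
        ((∑ k ∈ Finset.range N, ‖adv g (t (k + 1)) - adv g (t k)‖ ^ 2 : ℝ) : ℂ) := by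
      push_cast
      exact Finset.sum_congr rfl fun k _ => by rw [inner_self_eq_norm_sq_to_K]; rfl
    rw [this, ← ofReal_norm, Complex.norm_real, Real.norm_of_nonneg (by positivity),
      ENNReal.ofReal_sum_of_nonneg (fun _ _ => by positivity), hS]
    exact Finset.sum_congr rfl fun k _ => by rw [ENNReal.ofReal_pow (norm_nonneg _), ofReal_norm]
  rw [e] at this
  rcases eq_or_ne S 0 with h0 | h0
  · rw [h0]; exact zero_le (a := _)
  · rw [pow_two] at this
    exact (ENNReal.mul_le_mul_iff_left h0 hfin).1 this

end Variation

section DyadicApproximation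

variable {E : Type*} [NormedAddCommGroup E]

theorem exists_control {A : ℝ → E} {K : ℝ≥0∞} (hK : K ≠ ⊤)
    (hA : ∀ u : ℕ → ℝ, Monotone u → ∀ N : ℕ, ∑ k ∈ Finset.range N, ‖A (u (k + 1)) - A (u k)‖ₑ ^ 2 ≤ K) :
    ∃ W : ℝ → ℝ, (∀ t, 0 ≤ W t ∧ W t ≤ K.toReal) ∧ ∀ s t, s ≤ t → ‖A t - A s‖ ^ 2 ≤ W t - W s := by
  set ω : ℝ → ℝ≥0∞ := fun t => ⨆ (u : ℕ → ℝ) (N : ℕ) (_ : Monotone u ∧ u N ≤ t),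
    ∑ k ∈ Finset.range N, ‖A (u (k + 1)) - A (u k)‖ₑ ^ 2 with hω
  have hle : ∀ t, ω t ≤ K := fun t => iSup_le fun u => iSup_le fun N => iSup_le fun h => hA u h.1 N
  have hfin : ∀ t, ω t ≠ ⊤ := fun t => ne_top_of_le_ne_top hK (hle t)
  have hadd : ∀ s t, s ≤ t → ω s + ‖A t - A s‖ₑ ^ 2 ≤ ω t := by
    intro s t hst
    have key : ω s ≤ ω t - ‖A t - A s‖ₑ ^ 2 := by
      refine iSup_le fun u => iSup_le fun N => iSup_le fun h => ?_
      refine ENNReal.le_sub_of_add_le_right (ENNReal.pow_ne_top enorm_ne_top) ?_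
      set v : ℕ → ℝ := fun k => if k ≤ N then u k else if k ≤ N + 1 then s else t with hv
      have mv : Monotone v := by
        refine monotone_nat_of_le_succ fun k => ?_
        simp only [hv]
        split_ifs
        all_goals first
          | omega
          | (exact h.1 (Nat.le_succ k))
          | (exact (h.1 (by assumption)).trans h.2)
          | (exact le_rfl)
      have v1 : v (N + 1) = s := by simp [hv]
      have v2 : v (N + 1 + 1) = t := by simp [hv]
      calc ∑ k ∈ Finset.range N, ‖A (u (k + 1)) - A (u k)‖ₑ ^ 2 + ‖A t - A s‖ₑ ^ 2
          ≤ ∑ k ∈ Finset.range (N + 1), ‖A (v (k + 1)) - A (v k)‖ₑ ^ 2 + ‖A t - A s‖ₑ ^ 2 := by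
            gcongr
            rw [Finset.sum_range_succ]
            refine le_add_right (Finset.sum_le_sum fun k hk => le_of_eq ?_)
            have hk' := Finset.mem_range.1 hk
            simp [hv, hk'.le, Nat.succ_le_iff.2 hk']
        _ = ∑ k ∈ Finset.range (N + 1 + 1), ‖A (v (k + 1)) - A (v k)‖ₑ ^ 2 := by
            rw [Finset.sum_range_succ _ (N + 1), v1, v2]
        _ ≤ ω t := le_iSup_of_le v (le_iSup_of_le (N + 1 + 1) (le_iSup_of_le ⟨mv, v2.le⟩ le_rfl))
    have h2 : ‖A t - A s‖ₑ ^ 2 ≤ ω t := by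
      set v : ℕ → ℝ := fun k => if k = 0 then s else t with hv
      have mv : Monotone v := by
        refine monotone_nat_of_le_succ fun k => ?_
        rcases k with _ | k
        · simpa [hv] using hst
        · simp [hv]
      refine le_iSup_of_le v (le_iSup_of_le 1 (le_iSup_of_le ⟨mv, by simp [hv]⟩ ?_))
      simp [hv]
    calc _ ≤ ω t - ‖A t - A s‖ₑ ^ 2 + ‖A t - A s‖ₑ ^ 2 := by gcongr
      _ = ω t := tsub_add_cancel_of_le h2
  refine ⟨fun t => (ω t).toReal, fun t => ⟨ENNReal.toReal_nonneg, ENNReal.toReal_mono hK (hle t)⟩, fun s t hst => ?_⟩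
  have := ENNReal.toReal_mono (hfin t) (hadd s t hst)
  rw [ENNReal.toReal_add (hfin s) (ENNReal.pow_ne_top enorm_ne_top), ENNReal.toReal_pow, toReal_enorm] at this
  linarith

theorem exists_dyadic_approximation {A : ℝ → E} {K : ℝ} (hK : 0 < K) (hA0 : Tendsto A atBot (𝓝 0))
    (hA : ∀ u : ℕ → ℝ, Monotone u → ∀ N : ℕ, ∑ k ∈ Finset.range N, ‖A (u (k + 1)) - A (u k)‖ₑ ^ 2 ≤ ENNReal.ofReal (K ^ 2)) :
    ∃ (e : ℕ → ℕ → E) (κ : ℕ → ℝ → ℕ), (∀ j t, κ j t ≤ 4 ^ j) ∧ (∀ j m, ‖e j m‖ ≤ 3 * K * (1 / 2) ^ j) ∧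
      ∀ t, Tendsto (fun n => ∑ j ∈ Finset.range n, e j (κ j t)) atTop (𝓝 (A t)) := by
  classical
  obtain ⟨W, hW, hWA⟩ := exists_control ENNReal.ofReal_ne_top hA
  rw [ENNReal.toReal_ofReal (by positivity)] at hW
  have hK2 : 0 < K ^ 2 := by positivity
  set κ : ℕ → ℝ → ℕ := fun j t => ⌊4 ^ j * (W t / K ^ 2)⌋₊ with hκ
  have hdiv : ∀ t, 0 ≤ W t / K ^ 2 ∧ W t / K ^ 2 ≤ 1 := fun t =>
    ⟨div_nonneg (hW t).1 hK2.le, (div_le_one hK2).2 (hW t).2⟩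
  have hκle : ∀ j t, κ j t ≤ 4 ^ j := fun j t => by
    refine Nat.floor_le_of_le ?_
    push_cast
    exact mul_le_of_le_one_right (by positivity) (hdiv t).2
  have hκdiv : ∀ j t, κ (j + 1) t / 4 = κ j t := fun j t => by
    simp only [hκ]
    rw [← Nat.floor_div_natCast]
    congr 1
    push_cast
    ring
  have hsq : ∀ s t, ‖A t - A s‖ ^ 2 ≤ |W t - W s| := fun s t => by
    rcases le_total s t with h | h
    · exact (hWA s t h).trans (le_abs_self _)
    · rw [norm_sub_rev, abs_sub_comm]
      exact (hWA t s h).trans (le_abs_self _)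
  have hclose : ∀ j s t, κ j s = κ j t → ‖A t - A s‖ ≤ K * (1 / 2) ^ j := fun j s t h => by
    refine (sq_le_sq₀ (norm_nonneg _) (by positivity)).1 ((hsq s t).trans ?_)
    have f1 := Nat.floor_le (mul_nonneg (by positivity : (0 : ℝ) ≤ 4 ^ j) (hdiv s).1)
    have f2 := Nat.lt_floor_add_one (4 ^ j * (W s / K ^ 2))
    have f3 := Nat.floor_le (mul_nonneg (by positivity : (0 : ℝ) ≤ 4 ^ j) (hdiv t).1)
    have f4 := Nat.lt_floor_add_one (4 ^ j * (W t / K ^ 2))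
    have h' : ⌊4 ^ j * (W s / K ^ 2)⌋₊ = ⌊4 ^ j * (W t / K ^ 2)⌋₊ := h
    rw [h'] at f1 f2
    have f5 : |4 ^ j * (W t / K ^ 2) - 4 ^ j * (W s / K ^ 2)| ≤ 1 := abs_le.2 ⟨by linarith, by linarith⟩
    have f6 : 4 ^ j * (W t / K ^ 2) - 4 ^ j * (W s / K ^ 2) = (W t - W s) * (4 ^ j / K ^ 2) := by ring
    have f7 : (K * (1 / 2) ^ j) ^ 2 = 1 / (4 ^ j / K ^ 2) := by
      rw [one_div_div, mul_pow, ← pow_mul, mul_comm j 2, pow_mul, div_eq_mul_inv (K ^ 2), ← inv_pow]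
      norm_num
    rw [f6, abs_mul, abs_of_pos (by positivity : (0 : ℝ) < 4 ^ j / K ^ 2)] at f5
    rw [f7]
    exact (le_div_iff₀ (by positivity)).2 f5
  have hbound : ∀ t, ‖A t‖ ≤ K := fun t => by
    have h1 : Tendsto (fun s => ‖A t - A s‖) atBot (𝓝 ‖A t - 0‖) := (tendsto_const_nhds.sub hA0).norm
    rw [sub_zero] at h1
    refine le_of_tendsto h1 (Eventually.of_forall fun s => ?_)
    refine (sq_le_sq₀ (norm_nonneg _) hK.le).1 ((hsq s t).trans ?_)
    exact abs_le.2 ⟨by linarith [(hW t).1, (hW s).2], by linarith [(hW t).2, (hW s).1]⟩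
  set ρ : ℕ → ℕ → ℝ := fun j m => if h : ∃ t, κ j t = m then h.choose else 0 with hρ
  have hρκ : ∀ j t, κ j (ρ j (κ j t)) = κ j t := fun j t => by
    have h : ∃ s, κ j s = κ j t := ⟨t, rfl⟩
    simp only [hρ, dif_pos h]
    exact h.choose_spec
  have hnear : ∀ j t, ‖A t - A (ρ j (κ j t))‖ ≤ K * (1 / 2) ^ j := fun j t => hclose j _ _ (hρκ j t)
  set e : ℕ → ℕ → E := fun j m => match j with
    | 0 => A (ρ 0 m)
    | j + 1 => if ∃ t, κ (j + 1) t = m then A (ρ (j + 1) m) - A (ρ j (m / 4)) else 0 with he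
  have hsum : ∀ n t, ∑ j ∈ Finset.range (n + 1), e j (κ j t) = A (ρ n (κ n t)) := fun n t => by
    induction n with
    | zero => simp [he]
    | succ n ih =>
      have h : ∃ s, κ (n + 1) s = κ (n + 1) t := ⟨t, rfl⟩
      rw [Finset.sum_range_succ, ih]
      simp only [he, if_pos h, hκdiv]
      abel
  refine ⟨e, κ, hκle, fun j m => ?_, fun t => ?_⟩
  · rcases j with _ | j
    · simp only [he, pow_zero, mul_one]
      linarith [hbound (ρ 0 m)]
    · simp only [he]
      split_ifs with h
      · obtain ⟨t, rfl⟩ := h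
        rw [hκdiv]
        have n1 := hnear (j + 1) t
        have n2 := hnear j t
        have n3 := norm_sub_le (A t - A (ρ j (κ j t))) (A t - A (ρ (j + 1) (κ (j + 1) t)))
        rw [_root_.sub_sub_sub_cancel_left] at n3
        rw [pow_succ] at *
        linarith
      · rw [norm_zero]; positivity
  · rw [← tendsto_add_atTop_iff_nat 1]
    simp only [hsum]
    rw [tendsto_iff_norm_sub_tendsto_zero]
    refine squeeze_zero (fun _ => norm_nonneg _) (fun n => (norm_sub_rev _ _).trans_le (hnear n t)) ?_
    simpa using (tendsto_pow_atTop_nhds_zero_of_lt_one (by norm_num : (0 : ℝ) ≤ 1 / 2) (by norm_num)).const_mul K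

end DyadicApproximation

section VariationStrichartz

variable {V : Type*} [NormedAddCommGroup V] [InnerProductSpace ℝ V] [FiniteDimensional ℝ V]
  [MeasurableSpace V] [BorelSpace V]

theorem eLpNorm_U_sum_le (q : ℝ≥0∞) (hq : 1 ≤ q) (t : ℝ) (N : ℕ) (f : ℕ → L2 V) :
    eLpNorm (U t (∑ j ∈ Finset.range N, f j)) q volume ≤ ∑ j ∈ Finset.range N, eLpNorm (U t (f j)) q volume := by
  induction N with
  | zero =>
    simp only [Finset.range_zero, Finset.sum_empty, map_zero]
    rw [eLpNorm_congr_ae (Lp.coeFn_zero ..)]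
    simp
  | succ N ih =>
    rw [Finset.sum_range_succ, Finset.sum_range_succ, map_add, eLpNorm_congr_ae (Lp.coeFn_add ..)]
    exact (eLpNorm_add_le (Lp.aestronglyMeasurable _) (Lp.aestronglyMeasurable _) hq).trans (by gcongr)

theorem lintegral_Lp_finsetSum_le {α : Type*} [MeasurableSpace α] {μ : Measure α} {p : ℝ} (hp : 1 ≤ p) {b : ℕ → α → ℝ≥0∞}
    (hb : ∀ j, Measurable (b j)) (N : ℕ) :
    (∫⁻ a, (∑ j ∈ Finset.range N, b j a) ^ p ∂μ) ^ (1 / p) ≤ ∑ j ∈ Finset.range N, (∫⁻ a, b j a ^ p ∂μ) ^ (1 / p) := by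
  have hp0 : 0 < p := by linarith
  induction N with
  | zero => simp [hp0]
  | succ N ih =>
    simp only [Finset.sum_range_succ]
    have := ENNReal.lintegral_Lp_add_le (μ := μ) (f := fun a => ∑ j ∈ Finset.range N, b j a) (g := b N)
      (Finset.measurable_fun_sum _ fun j _ => hb j).aemeasurable (hb N).aemeasurable hp
    exact this.trans (by gcongr)

/-- Strichartz estimate for profiles of bounded quadratic variation. -/
theorem strichartz_variation {p q : ℝ} (hp : 2 < p) (hq : 2 < q) (hpq : 2 / p = Module.finrank ℝ V * (1 / 2 - 1 / q)) :
    ∃ C : ℝ≥0∞, C ≠ ⊤ ∧ ∀ (A : ℝ → L2 V) (K : ℝ), 0 < K → Tendsto A atBot (𝓝 0) →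
      (∀ u : ℕ → ℝ, Monotone u → ∀ N : ℕ,
        ∑ k ∈ Finset.range N, ‖A (u (k + 1)) - A (u k)‖ₑ ^ 2 ≤ ENNReal.ofReal (K ^ 2)) →
      (∫⁻ t, eLpNorm (U t (A t)) (ENNReal.ofReal q) volume ^ p) ^ (1 / p) ≤ C * ENNReal.ofReal K := by
  obtain ⟨C, hC, hS⟩ := strichartz (V := V) hp hq hpq
  have hp0 : 0 < p := by linarith
  set r : ℝ := (1 / 2) * 4 ^ (1 / p) with hr
  have hr0 : 0 < r := by positivity
  have hr1 : r < 1 := by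
    have : (4 : ℝ) ^ (1 / p) < 4 ^ (1 / 2 : ℝ) := Real.rpow_lt_rpow_of_exponent_lt (by norm_num)
      (one_div_lt_one_div_of_lt (by norm_num) hp)
    have h4 : (4 : ℝ) ^ (1 / 2 : ℝ) = 2 := by
      rw [show (4 : ℝ) = 2 ^ (2 : ℝ) by norm_num, ← Real.rpow_mul (by norm_num)]; norm_num
    rw [hr]; linarith
  refine ⟨C * ENNReal.ofReal (6 / (1 - r)), ENNReal.mul_ne_top hC ENNReal.ofReal_ne_top, fun A K hK hA0 hA => ?_⟩
  obtain ⟨e, κ, hκ, he, hlim⟩ := exists_dyadic_approximation hK hA0 hA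
  set Q := ENNReal.ofReal q with hQ
  have hQ1 : 1 ≤ Q := by rw [hQ, ← ENNReal.ofReal_one]; exact ENNReal.ofReal_le_ofReal (by linarith)
  set b : ℕ → ℝ → ℝ≥0∞ := fun j t => (∑ m ∈ Finset.range (4 ^ j + 1), eLpNorm (U t (e j m)) Q volume ^ p) ^ (1 / p) with hb
  have hmb : ∀ j, Measurable (b j) := fun j => by
    refine (Finset.measurable_fun_sum _ fun m _ => ?_).pow_const _
    exact (measurable_eLpNorm_U Q (G := fun t => U t (e j m)) (continuous_U_apply _)).pow_const _
  have hinv : p * (1 / p) = 1 := by field_simp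
  have hinv' : 1 / p * p = 1 := by field_simp
  have hle : ∀ j t, eLpNorm (U t (e j (κ j t))) Q volume ≤ b j t := fun j t => by
    calc eLpNorm (U t (e j (κ j t))) Q volume = (eLpNorm (U t (e j (κ j t))) Q volume ^ p) ^ (1 / p) := by
          rw [← ENNReal.rpow_mul, hinv, ENNReal.rpow_one]
      _ ≤ b j t := by
          refine ENNReal.rpow_le_rpow ?_ (by positivity)
          exact Finset.single_le_sum (f := fun m => eLpNorm (U t (e j m)) Q volume ^ p) (fun _ _ => zero_le (a := _))
            (Finset.mem_range.2 (Nat.lt_succ_of_le (hκ j t)))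
  have hnorm : ∀ j, (∫⁻ t, b j t ^ p) ^ (1 / p) ≤ C * ENNReal.ofReal (6 * K * r ^ j) := fun j => by
    have h1 : ∀ m, ∫⁻ t, eLpNorm (U t (e j m)) Q volume ^ p ≤ (C * ENNReal.ofReal (3 * K * (1 / 2) ^ j)) ^ p := fun m => by
      have h2 := ENNReal.rpow_le_rpow (hS (e j m)) hp0.le
      rw [← ENNReal.rpow_mul, hinv', ENNReal.rpow_one] at h2
      refine h2.trans (ENNReal.rpow_le_rpow ?_ hp0.le)
      gcongr
      rw [← ofReal_norm]
      exact ENNReal.ofReal_le_ofReal (he j m)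
    calc (∫⁻ t, b j t ^ p) ^ (1 / p)
        = (∑ m ∈ Finset.range (4 ^ j + 1), ∫⁻ t, eLpNorm (U t (e j m)) Q volume ^ p) ^ (1 / p) := by
          congr 1
          rw [← lintegral_finsetSum]
          · refine lintegral_congr fun t => ?_
            rw [hb, ← ENNReal.rpow_mul, hinv', ENNReal.rpow_one]
          · exact fun m _ => (measurable_eLpNorm_U Q (G := fun t => U t (e j m)) (continuous_U_apply _)).pow_const _
      _ ≤ (((4 ^ j + 1 : ℕ) : ℝ≥0∞) * (C * ENNReal.ofReal (3 * K * (1 / 2) ^ j)) ^ p) ^ (1 / p) := by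
          refine ENNReal.rpow_le_rpow ((Finset.sum_le_sum fun m _ => h1 m).trans_eq ?_) (by positivity)
          rw [Finset.sum_const, Finset.card_range, nsmul_eq_mul]
      _ = ENNReal.ofReal (((4 ^ j + 1 : ℕ) : ℝ) ^ (1 / p)) * (C * ENNReal.ofReal (3 * K * (1 / 2) ^ j)) := by
          rw [ENNReal.mul_rpow_of_nonneg _ _ (by positivity), ← ENNReal.rpow_mul, hinv, ENNReal.rpow_one,
            ← ENNReal.ofReal_natCast, ENNReal.ofReal_rpow_of_nonneg (by positivity) (by positivity)]
      _ = C * ENNReal.ofReal (((4 ^ j + 1 : ℕ) : ℝ) ^ (1 / p) * (3 * K * (1 / 2) ^ j)) := by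
          rw [ENNReal.ofReal_mul (q := 3 * K * (1 / 2) ^ j) (by positivity)]; ring
      _ ≤ C * ENNReal.ofReal (6 * K * r ^ j) := by
          refine mul_le_mul_right (ENNReal.ofReal_le_ofReal ?_) _
          have h3 : ((4 ^ j + 1 : ℕ) : ℝ) ^ (1 / p) ≤ 2 * (4 ^ (1 / p)) ^ j := by
            calc ((4 ^ j + 1 : ℕ) : ℝ) ^ (1 / p) ≤ (2 * 4 ^ j : ℝ) ^ (1 / p) := by
                  refine Real.rpow_le_rpow (by positivity) ?_ (by positivity)
                  push_cast
                  linarith [one_le_pow₀ (by norm_num : (1 : ℝ) ≤ 4) (n := j)]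
              _ = 2 ^ (1 / p) * (4 ^ (1 / p)) ^ j := by
                  rw [Real.mul_rpow (by positivity) (by positivity), ← Real.rpow_natCast, ← Real.rpow_natCast,
                    ← Real.rpow_mul (by norm_num), ← Real.rpow_mul (by norm_num), mul_comm (j : ℝ)]
              _ ≤ _ := by
                  gcongr
                  calc (2 : ℝ) ^ (1 / p) ≤ 2 ^ (1 : ℝ) := Real.rpow_le_rpow_of_exponent_le (by norm_num)
                        ((div_le_one hp0).2 (by linarith))
                    _ = 2 := by norm_num
          calc ((4 ^ j + 1 : ℕ) : ℝ) ^ (1 / p) * (3 * K * (1 / 2) ^ j) ≤ 2 * (4 ^ (1 / p)) ^ j * (3 * K * (1 / 2) ^ j) := by gcongr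
            _ = 6 * K * r ^ j := by rw [hr, mul_pow]; ring
  have hsum : ∀ N, ∫⁻ t, (∑ j ∈ Finset.range N, b j t) ^ p ≤ (C * ENNReal.ofReal (6 / (1 - r)) * ENNReal.ofReal K) ^ p := fun N => by
    have h1 := (lintegral_Lp_finsetSum_le (μ := volume) (by linarith : 1 ≤ p) hmb N).trans (Finset.sum_le_sum fun j _ => hnorm j)
    have h2 : ∑ j ∈ Finset.range N, C * ENNReal.ofReal (6 * K * r ^ j) ≤ C * ENNReal.ofReal (6 / (1 - r)) * ENNReal.ofReal K := by
      rw [← Finset.mul_sum, ← ENNReal.ofReal_sum_of_nonneg (fun _ _ => by positivity), mul_assoc,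
        ← ENNReal.ofReal_mul (div_nonneg (by norm_num) (by linarith)), ← Finset.mul_sum]
      refine mul_le_mul_right (ENNReal.ofReal_le_ofReal ?_) _
      have h3 : ∑ j ∈ Finset.range N, r ^ j ≤ 1 / (1 - r) := by
        rw [one_div, ← tsum_geometric_of_lt_one hr0.le hr1]
        exact (summable_geometric_of_lt_one hr0.le hr1).sum_le_tsum _ fun _ _ => by positivity
      calc 6 * K * ∑ j ∈ Finset.range N, r ^ j ≤ 6 * K * (1 / (1 - r)) := by gcongr
        _ = _ := by ring
    have h4 := ENNReal.rpow_le_rpow (h1.trans h2) hp0.le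
    rwa [← ENNReal.rpow_mul, hinv', ENNReal.rpow_one] at h4
  have hfinal : ∫⁻ t, eLpNorm (U t (A t)) Q volume ^ p ≤ (C * ENNReal.ofReal (6 / (1 - r)) * ENNReal.ofReal K) ^ p := by
    calc _ ≤ ∫⁻ t, liminf (fun N => (∑ j ∈ Finset.range N, b j t) ^ p) atTop := by
          refine lintegral_mono fun t => ?_
          have hl : Tendsto (fun n => U t (∑ j ∈ Finset.range n, e j (κ j t))) atTop (𝓝 (U t (A t))) :=
            ((U t).continuous.tendsto _).comp (hlim t)
          refine (eLpNorm_rpow_le_liminf Q hp0.le hl).trans (liminf_le_liminf (Eventually.of_forall fun n => ?_))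
          refine ENNReal.rpow_le_rpow ?_ hp0.le
          exact (eLpNorm_U_sum_le Q hQ1 t n _).trans (Finset.sum_le_sum fun j _ => hle j t)
      _ ≤ liminf (fun N => ∫⁻ t, (∑ j ∈ Finset.range N, b j t) ^ p) atTop :=
          lintegral_liminf_le fun N => (Finset.measurable_fun_sum _ fun j _ => hmb j).pow_const _
      _ ≤ _ := (liminf_le_liminf (Eventually.of_forall hsum)).trans_eq (by simp)
  have := ENNReal.rpow_le_rpow hfinal (by positivity : 0 ≤ 1 / p)
  rwa [← ENNReal.rpow_mul, hinv, ENNReal.rpow_one] at this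

end VariationStrichartz

section RetardedBound

variable {V : Type*} [NormedAddCommGroup V] [InnerProductSpace ℝ V] [FiniteDimensional ℝ V]
  [MeasurableSpace V] [BorelSpace V]

theorem tendsto_adv (g : 𝓢(ℝ × V, ℂ)) : Tendsto (adv g) atBot (𝓝 0) := by
  obtain ⟨C, hC0, hC⟩ := norm_srcL2_le g
  refine squeeze_zero_norm (a := fun t => C * (Real.arctan t + Real.pi / 2)) (fun t => ?_) ?_
  · calc ‖adv g t‖ ≤ ∫ s in Set.Iic t, ‖U (-s) (srcL2 g s)‖ := norm_integral_le_integral_norm _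
      _ ≤ ∫ s in Set.Iic t, C * (1 + s ^ 2)⁻¹ := by
          refine integral_mono (integrable_U_srcL2 g).norm.integrableOn
            (integrable_inv_one_add_sq.const_mul C).integrableOn fun s => ?_
          rw [LinearIsometryEquiv.norm_map]
          exact hC s
      _ = _ := by rw [integral_const_mul, integral_Iic_inv_one_add_sq]
  · have h := (Real.tendsto_arctan_atBot.mono_right nhdsWithin_le_nhds).add_const (Real.pi / 2) |>.const_mul C
    simpa using h

theorem strichartz_adv (hd : 3 ≤ Module.finrank ℝ V) {p q : ℝ} (hp : 2 < p) (hq : 2 < q)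
    (hpq : 2 / p = Module.finrank ℝ V * (1 / 2 - 1 / q)) :
    ∃ C : ℝ≥0∞, C ≠ ⊤ ∧ ∀ g : 𝓢(ℝ × V, ℂ),
      (∫⁻ t, eLpNorm (U t (adv g t)) (ENNReal.ofReal q) volume ^ p) ^ (1 / p) ≤ C * eLpNorm g 2 volume := by
  obtain ⟨B, hB, hvar⟩ := sum_enorm_adv_sub_sq_le (V := V) hd
  obtain ⟨C, hC, hS⟩ := strichartz_variation (V := V) hp hq hpq
  set D := B ^ (1 / 2 : ℝ) with hD
  have hDt : D ≠ ⊤ := ENNReal.rpow_ne_top_of_nonneg (by norm_num) hB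
  have hD2 : D ^ 2 = B := by rw [hD, ← ENNReal.rpow_natCast, ← ENNReal.rpow_mul]; norm_num
  refine ⟨C * D, ENNReal.mul_ne_top hC hDt, fun g => ?_⟩
  set X := eLpNorm g 2 volume
  have hX : D * X ≠ ⊤ := ENNReal.mul_ne_top hDt (eLpNorm_prod_ne_top g)
  have key : ∀ ε : ℝ, 0 < ε → (∫⁻ t, eLpNorm (U t (adv g t)) (ENNReal.ofReal q) volume ^ p) ^ (1 / p) ≤
      C * (D * X + ENNReal.ofReal ε) := fun ε hε => by
    have e : ENNReal.ofReal ((D * X).toReal + ε) = D * X + ENNReal.ofReal ε := by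
      rw [ENNReal.ofReal_add ENNReal.toReal_nonneg hε.le, ENNReal.ofReal_toReal hX]
    have h := hS (adv g) ((D * X).toReal + ε) (by positivity) (tendsto_adv g) fun u hu N => by
      refine (hvar g u hu N).trans ?_
      rw [ENNReal.ofReal_pow (by positivity), e, ← hD2, ← mul_pow]
      gcongr
      exact le_self_add
    rwa [e] at h
  have hl : Tendsto (fun ε : ℝ => C * (D * X + ENNReal.ofReal ε)) (𝓝[>] 0) (𝓝 (C * (D * X + ENNReal.ofReal 0))) :=
    (((ENNReal.continuous_const_mul hC).comp (continuous_const.add ENNReal.continuous_ofReal)).tendsto 0).mono_left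
      nhdsWithin_le_nhds
  rw [ENNReal.ofReal_zero, add_zero, ← mul_assoc] at hl
  exact ge_of_tendsto hl (eventually_mem_nhdsWithin.mono key)

theorem enorm_adv_le (hd : 3 ≤ Module.finrank ℝ V) :
    ∃ C : ℝ≥0∞, C ≠ ⊤ ∧ ∀ (g : 𝓢(ℝ × V, ℂ)) (t : ℝ), ‖adv g t‖ₑ ≤ C * eLpNorm g 2 volume := by
  obtain ⟨B, hB, hvar⟩ := sum_enorm_adv_sub_sq_le (V := V) hd
  refine ⟨B ^ (1 / 2 : ℝ), ENNReal.rpow_ne_top_of_nonneg (by norm_num) hB, fun g t => ?_⟩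
  have hD2 : (B ^ (1 / 2 : ℝ)) ^ 2 = B := by rw [← ENNReal.rpow_natCast, ← ENNReal.rpow_mul]; norm_num
  have h1 : Tendsto (fun s => ‖adv g t - adv g s‖ₑ) atBot (𝓝 ‖adv g t - 0‖ₑ) :=
    (continuous_enorm.tendsto _).comp (tendsto_const_nhds.sub (tendsto_adv g))
  rw [sub_zero] at h1
  refine le_of_tendsto h1 ((eventually_le_atBot t).mono fun s hs => ?_)
  refine (ENNReal.pow_le_pow_left_iff two_ne_zero).1 ?_
  rw [mul_pow, hD2]
  have := hvar g (fun k => if k = 0 then s else t) (monotone_nat_of_le_succ fun k => by rcases k with _ | k <;> simp [hs]) 1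
  simpa using this

end RetardedBound

section Retarded

variable {V : Type*} [NormedAddCommGroup V] [InnerProductSpace ℝ V] [FiniteDimensional ℝ V]
  [MeasurableSpace V] [BorelSpace V]

/-- The source at time `s`, evolved up to time `t`. -/
noncomputable def evol (g : 𝓢(ℝ × V, ℂ)) (t s : ℝ) (x : V) : ℂ := ∫ y, kern (t - s) (x - y) * src g s y

theorem measurable_evol (g : 𝓢(ℝ × V, ℂ)) (t : ℝ) : Measurable fun z : ℝ × V => evol g t z.1 z.2 := by
  have m1 : Measurable fun w : (ℝ × V) × V => kern (t - w.1.1) (w.1.2 - w.2) :=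
    measurable_kern.comp (g := fun z : ℝ × V => kern z.1 z.2) (f := fun w : (ℝ × V) × V => (t - w.1.1, w.1.2 - w.2)) (by fun_prop)
  have m2 : Measurable fun w : (ℝ × V) × V => src g w.1.1 w.2 :=
    (measurable_src g).comp (f := fun w : (ℝ × V) × V => (w.1.1, w.2)) (by fun_prop)
  have := (m1.mul m2).stronglyMeasurable.integral_prod_right' (ν := (volume : Measure V))
  exact this.measurable

theorem measurable_evol_right (g : 𝓢(ℝ × V, ℂ)) (t s : ℝ) : Measurable fun x => evol g t s x :=
  Measurable.comp (g := fun z : ℝ × V => evol g t z.1 z.2) (f := fun x => (s, x)) (measurable_evol g t) measurable_prodMk_left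

theorem evol_ae_eq (g : 𝓢(ℝ × V, ℂ)) {t s : ℝ} (h : s ≠ t) : (U (t - s) (srcL2 g s) : V → ℂ) =ᵐ[volume] evol g t s :=
  U_ae_eq_kern (sub_ne_zero.2 h.symm) (integrable_src g s) (memLp_src g s)

theorem lintegral_enorm_sq_eq {α : Type*} [MeasurableSpace α] {μ : Measure α} (f : α → ℂ) :
    ∫⁻ x, ‖f x‖ₑ ^ 2 ∂μ = eLpNorm f 2 μ ^ 2 := by
  rw [eLpNorm_eq_lintegral_rpow_enorm_toReal two_ne_zero ENNReal.ofNat_ne_top, ← ENNReal.rpow_natCast, ← ENNReal.rpow_mul]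
  simp

theorem integrable_mul_evol (g : 𝓢(ℝ × V, ℂ)) (t : ℝ) {f : V → ℂ} (hf : Measurable f) (hf2 : MemLp f 2 volume) :
    Integrable (fun z : ℝ × V => f z.2 * evol g t z.1 z.2) ((volume.restrict (Set.Iic t)).prod volume) := by
  obtain ⟨C, hC0, hC⟩ := norm_srcL2_le g
  have m : Measurable fun z : ℝ × V => f z.2 * evol g t z.1 z.2 := (hf.comp measurable_snd).mul (measurable_evol g t)
  refine ⟨m.aestronglyMeasurable, ?_⟩
  rw [hasFiniteIntegral_iff_enorm, lintegral_prod _ m.enorm.aemeasurable]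
  have hb : ∀ s, s ≠ t → ∫⁻ x, ‖f x * evol g t s x‖ₑ ≤ eLpNorm f 2 volume * ENNReal.ofReal (C * (1 + s ^ 2)⁻¹) := fun s hs => by
    have ms := measurable_evol_right g t s
    have e : eLpNorm (evol g t s) 2 volume ≤ ENNReal.ofReal (C * (1 + s ^ 2)⁻¹) := by
      rw [← eLpNorm_congr_ae (evol_ae_eq g hs), ← Lp.enorm_def, ← ofReal_norm, LinearIsometryEquiv.norm_map]
      exact ENNReal.ofReal_le_ofReal (hC s)
    refine (ENNReal.pow_le_pow_left_iff two_ne_zero).1 ?_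
    simp only [enorm_mul]
    refine (sq_lintegral_mul_le hf.enorm.aemeasurable ms.enorm.aemeasurable).trans ?_
    rw [lintegral_enorm_sq_eq, lintegral_enorm_sq_eq, ← mul_pow]
    gcongr
  have hne : ∀ᵐ s : ℝ, s ≠ t := by rw [ae_iff]; simp
  calc ∫⁻ s in Set.Iic t, ∫⁻ x, ‖f x * evol g t s x‖ₑ
      ≤ ∫⁻ s, ∫⁻ x, ‖f x * evol g t s x‖ₑ := setLIntegral_le_lintegral _ _
    _ ≤ ∫⁻ s, eLpNorm f 2 volume * ENNReal.ofReal (C * (1 + s ^ 2)⁻¹) := lintegral_mono_ae (by filter_upwards [hne] with s hs using hb s hs)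
    _ = eLpNorm f 2 volume * ∫⁻ s, ENNReal.ofReal (C * (1 + s ^ 2)⁻¹) := lintegral_const_mul' _ _ hf2.2.ne
    _ < ⊤ := by
        refine ENNReal.mul_lt_top hf2.2 ?_
        exact Integrable.lintegral_lt_top (f := fun s : ℝ => C * (1 + s ^ 2)⁻¹) (integrable_inv_one_add_sq.const_mul C)

theorem retarded_ae_eq (g : 𝓢(ℝ × V, ℂ)) (t : ℝ) :
    (fun x => ∫ s in Set.Iic t, evol g t s x) =ᵐ[volume] (U t (adv g t) : V → ℂ) := by
  refine ae_eq_of_schwartz ?_ ?_ fun ψ _ => ?_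
  · rw [locallyIntegrable_iff]
    intro K hK
    have h := integrable_mul_evol g t (f := K.indicator fun _ => 1) (measurable_const.indicator hK.measurableSet)
      (memLp_indicator_const 2 hK.measurableSet 1 (Or.inr hK.measure_lt_top.ne))
    rw [← integrable_indicator_iff hK.measurableSet]
    refine h.integral_prod_right.congr (Eventually.of_forall fun x => ?_)
    by_cases hx : x ∈ K <;> simp [hx]
  · exact (Lp.memLp (U t (adv g t))).locallyIntegrable (by norm_num)
  · have h := integrable_mul_evol g t (f := fun x => conj (ψ x)) (by fun_prop) (ψ.memLp 2 volume).star
    calc ∫ x, conj (ψ x) * ∫ s in Set.Iic t, evol g t s x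
        = ∫ x, ∫ s in Set.Iic t, conj (ψ x) * evol g t s x := by simp only [integral_const_mul]
      _ = ∫ s in Set.Iic t, ∫ x, conj (ψ x) * evol g t s x :=
          (integral_integral_swap (f := fun s x => conj (ψ x) * evol g t s x) h).symm
      _ = ∫ s in Set.Iic t, inner ℂ (U (-t) (ψ.toLp 2 volume)) (U (-s) (srcL2 g s)) := by
          refine setIntegral_congr_ae measurableSet_Iic ?_
          have hne : ∀ᵐ s : ℝ, s ≠ t := by rw [ae_iff]; simp
          filter_upwards [hne] with s hs _
          rw [inner_U_left, neg_neg, U_add, ← sub_eq_add_neg, inner_toLp]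
          refine integral_congr_ae ?_
          filter_upwards [evol_ae_eq g hs] with x hx
          rw [hx]
      _ = inner ℂ (U (-t) (ψ.toLp 2 volume)) (adv g t) := integral_inner (integrable_U_srcL2 g).integrableOn _
      _ = _ := by rw [inner_U_left, neg_neg, inner_toLp]

end Retarded

section Conversion

theorem fracD_quarter {n : ℕ} (g : 𝓢(ℝ × EuclideanSpace ℝ (Fin n), ℂ)) (s : ℝ) (x : EuclideanSpace ℝ (Fin n)) :
    fracD ((1 : ℝ) / 4) (⇑g) s x = quarterD (slice g x) s := by
  set G : ℝ → ℂ := fun lam => Complex.exp (Complex.I * (s : ℂ) * (lam : ℂ)) *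
      (((1 + lam ^ 2 : ℝ) ^ ((1 : ℝ) / 4 / 2) : ℝ) : ℂ) *
      ∫ σ : ℝ, Complex.exp (-(Complex.I * (σ : ℂ) * (lam : ℂ))) * g (σ, x) with hG
  have h := Measure.integral_comp_mul_left G (2 * Real.pi)
  have hpi : (0 : ℝ) < 2 * Real.pi := by positivity
  rw [abs_of_pos (inv_pos.2 hpi)] at h
  have e1 : fracD ((1 : ℝ) / 4) (⇑g) s x = ∫ ν, G (2 * Real.pi * ν) := by
    rw [h, fracD, Complex.real_smul]
    push_cast
    rfl
  rw [e1, quarterD_apply]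
  refine integral_congr_ae (Eventually.of_forall fun ν => ?_)
  have e2 : 𝓕 (slice g x) ν = ∫ σ : ℝ, Complex.exp (-(Complex.I * (σ : ℂ) * ((2 * Real.pi * ν : ℝ) : ℂ))) * g (σ, x) := by
    rw [fourier_coe, Real.fourier_real_eq_integral_exp_smul]
    refine integral_congr_ae (Eventually.of_forall fun σ => ?_)
    simp only [slice_apply, smul_eq_mul]
    congr 2
    push_cast
    ring
  have e3 : Complex.exp (Complex.I * (s : ℂ) * ((2 * Real.pi * ν : ℝ) : ℂ)) =
      Complex.exp (((2 * Real.pi * (s * ν) : ℝ) : ℂ) * Complex.I) := by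
    congr 1
    push_cast
    ring
  simp only [hG]
  rw [e2, e3, quarterSym, mul_assoc, show (1 : ℝ) / 4 / 2 = 1 / 8 by norm_num]

theorem schrod_eq_kern {n : ℕ} {t : ℝ} (ht : t ≠ 0) (f : EuclideanSpace ℝ (Fin n) → ℂ) (x : EuclideanSpace ℝ (Fin n)) :
    schrod n t f x = ∫ y, kern t (x - y) * f y := by
  rw [schrod, if_neg ht, ← integral_const_mul]
  refine integral_congr_ae (Eventually.of_forall fun y => ?_)
  simp only [kern, finrank_euclideanSpace_fin, mul_assoc]

theorem integral_schrod_eq {n : ℕ} (g : 𝓢(ℝ × EuclideanSpace ℝ (Fin n), ℂ)) (t : ℝ) (x : EuclideanSpace ℝ (Fin n)) :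
    ∫ s in Set.Iic t, schrod n (t - s)
        (fun y => (((1 + ‖y‖ ^ 2 : ℝ) ^ (-(1 : ℝ) / 2) : ℝ) : ℂ) * fracD ((1 : ℝ) / 4) (⇑g) s y) x =
      ∫ s in Set.Iic t, evol g t s x := by
  refine setIntegral_congr_ae measurableSet_Iic ?_
  have hne : ∀ᵐ s : ℝ, s ≠ t := by rw [ae_iff]; simp
  filter_upwards [hne] with s hs _
  rw [schrod_eq_kern (sub_ne_zero.2 hs.symm), evol]
  simp only [fracD_quarter, src]

theorem admissible_toReal {n : ℕ} (hn : 3 ≤ n) {p q : ℝ≥0∞} (hp : 2 < p) (hpt : p ≠ ⊤) (hq : 2 ≤ q)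
    (hpq : 2 / p + (n : ℝ≥0∞) / q = (n : ℝ≥0∞) / 2) :
    q ≠ ⊤ ∧ 2 < p.toReal ∧ 2 < q.toReal ∧ 2 / p.toReal = n * (1 / 2 - 1 / q.toReal) := by
  have hP : 2 < p.toReal := by
    rw [← ENNReal.toReal_ofNat 2]
    exact (ENNReal.toReal_lt_toReal (by simp) hpt).2 hp
  have hn' : (3 : ℝ) ≤ n := by exact_mod_cast hn
  have h2P : 2 / p.toReal < 1 := (div_lt_one (by linarith)).2 hP
  have hp0 : p ≠ 0 := (lt_trans (by norm_num) hp).ne'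
  have hq0 : q ≠ 0 := (lt_of_lt_of_le (by norm_num) hq).ne'
  have h := congrArg ENNReal.toReal hpq
  rw [ENNReal.toReal_add (ENNReal.div_ne_top (by simp) hp0) (ENNReal.div_ne_top (by simp) hq0)] at h
  simp only [ENNReal.toReal_div, ENNReal.toReal_ofNat, ENNReal.toReal_natCast] at h
  have hqt : q ≠ ⊤ := by
    rintro rfl
    simp only [ENNReal.toReal_top, _root_.div_zero, add_zero] at h
    linarith
  have h2 : 0 < 2 / p.toReal := by positivity
  have hQ0 : 0 < q.toReal := ENNReal.toReal_pos hq0 hqt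
  refine ⟨hqt, hP, ?_, by rw [mul_sub, mul_one_div, mul_one_div]; linarith⟩
  by_contra! hle
  have : (n : ℝ) / 2 ≤ n / q.toReal := by gcongr
  linarith

theorem eq_two_of_top {n : ℕ} (hn : 3 ≤ n) {q : ℝ≥0∞} (hpq : 2 / ⊤ + (n : ℝ≥0∞) / q = (n : ℝ≥0∞) / 2) : q = 2 := by
  have hn0 : (n : ℝ≥0∞) ≠ 0 := by simp; omega
  rw [ENNReal.div_top, zero_add, div_eq_mul_inv, div_eq_mul_inv] at hpq
  exact inv_injective ((ENNReal.mul_right_inj hn0 (by simp)).1 hpq)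

end Conversion

end Schrodinger

/-- Retarded Strichartz estimate for the quarter-derivative term: with
`h(s,x) = ⟨x⟩⁻¹ (⟨∂_s⟩^{1/4} g)(s,x)`, the Duhamel integral
`∫_{-∞}^t e^{i(t-s)Δ} h(s,·) ds` obeys `‖F‖_{L^p_t L^q_x} ≤ C ‖g‖_{L²(ℝ×ℝⁿ)}`
for admissible `(p,q)` with `p > 2`. -/
theorem strichartz_retarded_quarter_derivative (n : ℕ) (hn : 3 ≤ n) (p q : ℝ≥0∞)
    (hp : 2 < p) (hq : 2 ≤ q) (hpq : 2 / p + (n : ℝ≥0∞) / q = (n : ℝ≥0∞) / 2) :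
    ∃ C : ℝ≥0∞, C ≠ ⊤ ∧
      ∀ g : 𝓢(ℝ × EuclideanSpace ℝ (Fin n), ℂ),
        mixedNorm p q
            (fun t x =>
              ∫ s in Set.Iic t,
                schrod n (t - s)
                  (fun y => (((1 + ‖y‖ ^ 2 : ℝ) ^ (-(1 : ℝ) / 2) : ℝ) : ℂ) *
                    fracD ((1 : ℝ) / 4) (⇑g) s y) x)
          ≤ C * eLpNorm (⇑g) 2 volume := by
  obtain ⟨C, hC, h⟩ : ∃ C : ℝ≥0∞, C ≠ ⊤ ∧ ∀ g : 𝓢(ℝ × EuclideanSpace ℝ (Fin n), ℂ),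
      mixedNorm p q (fun t => ⇑(Schrodinger.U t (Schrodinger.adv g t))) ≤ C * eLpNorm (⇑g) 2 volume := by
    have hd : 3 ≤ Module.finrank ℝ (EuclideanSpace ℝ (Fin n)) := by rwa [finrank_euclideanSpace_fin]
    rcases eq_or_ne p ⊤ with rfl | hpt
    · obtain rfl := Schrodinger.eq_two_of_top hn hpq
      obtain ⟨C, hC, h⟩ := Schrodinger.enorm_adv_le hd
      refine ⟨C, hC, fun g => ?_⟩
      rw [mixedNorm, if_pos rfl]
      refine essSup_le_of_ae_le _ (Filter.Eventually.of_forall fun t => ?_)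
      have e : eLpNorm (Schrodinger.U t (Schrodinger.adv g t)) 2 volume = ‖Schrodinger.adv g t‖ₑ := by
        rw [← Lp.enorm_def, ← ofReal_norm, LinearIsometryEquiv.norm_map, ofReal_norm]
      exact e.trans_le (h g t)
    · obtain ⟨hqt, hP, hQ, hPQ⟩ := Schrodinger.admissible_toReal hn hp hpt hq hpq
      rw [← finrank_euclideanSpace_fin (𝕜 := ℝ) (n := n)] at hPQ
      obtain ⟨C, hC, h⟩ := Schrodinger.strichartz_adv hd hP hQ hPQ
      rw [ENNReal.ofReal_toReal hqt] at h
      refine ⟨C, hC, fun g => ?_⟩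
      rw [mixedNorm, if_neg hpt]
      exact h g
  refine ⟨C, hC, fun g => ?_⟩
  have e : ∀ t, eLpNorm (fun x => ∫ s in Set.Iic t, schrod n (t - s)
      (fun y => (((1 + ‖y‖ ^ 2 : ℝ) ^ (-(1 : ℝ) / 2) : ℝ) : ℂ) * fracD ((1 : ℝ) / 4) (⇑g) s y) x) q volume =
        eLpNorm (Schrodinger.U t (Schrodinger.adv g t)) q volume := fun t => by
    simp only [Schrodinger.integral_schrod_eq]
    exact eLpNorm_congr_ae (Schrodinger.retarded_ae_eq g t)
  refine le_of_eq_of_le ?_ (h g)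
  simp only [mixedNorm, e]
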